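/- Let P_Z be a probability distribution on ℝ defining a BMS channel in multiplicative-noise form with capacity C ∈ (0,1). Fix integers 0 ≤ r ≤ m with m ≥ 1 and set N = 2^m. Let X be uniformly distributed on the BPSK image of RM(r,m), let Z ∈ ℝ^N have i.i.d. components with law P_Z independent of X, and let Y = X ⊙ Z. If R(r,m) > C, then for every i ∈ {0,…,N−1}, BER(X_i | Y) ≥ BER(X_i | Y_i) − (1 − C)·√( ln(2)·ρ(m) / (2·ψ(1−C)·Ψ(R(r,m) − C)) ), where ρ(m) := (6 ln m + 34)/(5 √m), ψ(u) := 1 − (1 − 2·h_b^{−1}(u))², h_b^{−1} : [0,1] → [0,1/2] is the inverse of the binary entropy function restricted to [0,1/2], and Ψ(u) := ∫₀^u ψ(v) dv. -/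

import Mathlib

open MeasureTheory ProbabilityTheory

noncomputable section

/-- The binary entropy function (base 2). -/
def hb (p : ℝ) : ℝ := -(p * Real.logb 2 p) - (1 - p) * Real.logb 2 (1 - p)

/-- Conditional expectation `E[X | W]` of `X` given the σ-algebra generated by `W`. -/
def condMean {Ω β E : Type*} [MeasurableSpace Ω] [MeasurableSpace β]
    [NormedAddCommGroup E] [NormedSpace ℝ E] [CompleteSpace E]
    (μ : Measure Ω) (X : Ω → E) (W : Ω → β) : Ω → E :=
  μ[X | MeasurableSpace.comap W inferInstance]

/-- Bit-error probability of the MAP decision rule for `X ∈ {±1}` given `W`. -/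
def BER {Ω β : Type*} [MeasurableSpace Ω] [MeasurableSpace β]
    (μ : Measure Ω) (X : Ω → ℝ) (W : Ω → β) : ℝ :=
  (1 - ∫ ω, |condMean μ X W ω| ∂μ) / 2

/-- Minimum mean squared error of estimating `X` from `W`. -/
def mmse {Ω β : Type*} [MeasurableSpace Ω] [MeasurableSpace β]
    (μ : Measure Ω) (X : Ω → ℝ) (W : Ω → β) : ℝ :=
  ∫ ω, (X ω - condMean μ X W ω) ^ 2 ∂μ

/-- Uniform distribution on `{-1, 1} ⊆ ℝ`. -/
def signMeasure : Measure ℝ := (2 : ENNReal)⁻¹ • (Measure.dirac (-1) + Measure.dirac 1)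

/-- Capacity of the BMS channel (in multiplicative-noise form) with noise law `PZ`:
`C = 1 - E[h_b((1 + E[X_u | Y_u])/2)]` where `X_u` is uniform on `{±1}`, independent of
`Z₀ ~ PZ`, and `Y_u = X_u · Z₀`. -/
def capacity (PZ : Measure ℝ) : ℝ :=
  1 - ∫ p, hb ((1 + condMean (signMeasure.prod PZ)
        (fun q : ℝ × ℝ => q.1) (fun q : ℝ × ℝ => q.1 * q.2) p) / 2) ∂(signMeasure.prod PZ)

/-- Evaluation vector of the multilinear polynomial whose coefficients on monomials
of degree at most `r` are given by `α` (higher-degree coefficients being ignored),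
evaluated at the point `v ∈ 𝔽₂^m` with index `i = Σ_j v_j 2^j`. -/
def RMword (r m : ℕ) (α : Finset (Fin m) → ZMod 2) : Fin (2 ^ m) → ZMod 2 :=
  fun i => ∑ S ∈ Finset.univ.filter (fun S : Finset (Fin m) => S.card ≤ r),
    α S * ∏ j ∈ S, ((((i : ℕ) / 2 ^ (j : ℕ)) % 2 : ℕ) : ZMod 2)

/-- The Reed–Muller code RM(r, m) ⊆ 𝔽₂^{2^m}. -/
def RMcode (r m : ℕ) : Finset (Fin (2 ^ m) → ZMod 2) :=
  Finset.image (RMword r m) Finset.univ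

/-- The rate `R(r,m)` of RM(r,m). -/
def RMrate (r m : ℕ) : ℝ := (2 ^ m : ℝ)⁻¹ * ∑ i ∈ Finset.range (r + 1), (m.choose i : ℝ)

/-- BPSK modulation map `c ↦ ((-1)^{c_0}, …, (-1)^{c_{N-1}})`. -/
def bpsk {N : ℕ} (c : Fin N → ZMod 2) : Fin N → ℝ := fun i => (-1 : ℝ) ^ ((c i).val)

/-- BPSK image of a binary code. -/
def bpskImage {N : ℕ} (C : Finset (Fin N → ZMod 2)) : Finset (Fin N → ℝ) :=
  letI := Classical.decEq (Fin N → ℝ)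
  C.image bpsk

/-- BPSK image of RM(r,m). -/
def bpskRM (r m : ℕ) : Finset (Fin (2 ^ m) → ℝ) := bpskImage (RMcode r m)

/-- Uniform probability measure on a finite set. -/
def uniformOnFinset {α : Type*} [MeasurableSpace α] (s : Finset α) : Measure α :=
  (s.card : ENNReal)⁻¹ • ∑ x ∈ s, Measure.dirac x

/-- `ρ(m) = (6 ln m + 34)/(5 √m)`. -/
def rho (m : ℕ) : ℝ := (6 * Real.log m + 34) / (5 * Real.sqrt m)

/-- Inverse of the binary entropy function restricted to `[0, 1/2]`. -/
def hbInv (u : ℝ) : ℝ := sSup {p : ℝ | p ∈ Set.Icc (0 : ℝ) (1 / 2) ∧ hb p ≤ u}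

/-- `ψ(u) = 1 - (1 - 2 h_b^{-1}(u))²`. -/
def psi (u : ℝ) : ℝ := 1 - (1 - 2 * hbInv u) ^ 2

/-- `Ψ(u) = ∫₀^u ψ(v) dv`. -/
def PsiInt (u : ℝ) : ℝ := ∫ v in (0 : ℝ)..u, psi v

/-- The coefficients `c_k = 1/(ln 2 · 2k (2k-1))`. -/
def ck (k : ℕ) : ℝ := 1 / (Real.log 2 * (2 * k) * (2 * k - 1))

/-- The channel moments `q_k = E[(E[X_u | Y_u])^{2k}]` for uniform input. -/
def qmom (PZ : Measure ℝ) (k : ℕ) : ℝ :=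
  ∫ p, (condMean (signMeasure.prod PZ)
      (fun q : ℝ × ℝ => q.1) (fun q : ℝ × ℝ => q.1 * q.2) p) ^ (2 * k) ∂(signMeasure.prod PZ)

end

namespace RMP
set_option linter.unusedSectionVars false
noncomputable section

/-- Bounded measurable functions. -/
def BM {β : Type*} [MeasurableSpace β] (F : β → ℝ) : Prop :=
  Measurable F ∧ ∃ C : ℝ, ∀ a, |F a| ≤ C

section BMlemmas
variable {β γ : Type*} [MeasurableSpace β] [MeasurableSpace γ]

lemma BM.meas {F : β → ℝ} (h : BM F) : Measurable F := h.1

lemma BM.integrable {F : β → ℝ} (h : BM F) (μ : Measure β) [IsFiniteMeasure μ] :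
    Integrable F μ := by
  obtain ⟨hm, C, hC⟩ := h
  exact Integrable.of_bound hm.aestronglyMeasurable C (Filter.Eventually.of_forall hC)

lemma BM.add {F G : β → ℝ} (h : BM F) (h' : BM G) : BM (fun a => F a + G a) := by
  obtain ⟨hm, C, hC⟩ := h
  obtain ⟨hm', C', hC'⟩ := h'
  exact ⟨hm.add hm', C + C', fun a => (abs_add_le _ _).trans (add_le_add (hC a) (hC' a))⟩

lemma BM.neg {F : β → ℝ} (h : BM F) : BM (fun a => - F a) := by
  obtain ⟨hm, C, hC⟩ := h
  exact ⟨hm.neg, C, fun a => by rw [abs_neg]; exact hC a⟩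

lemma BM.sub {F G : β → ℝ} (h : BM F) (h' : BM G) : BM (fun a => F a - G a) := by
  simpa [sub_eq_add_neg] using h.add h'.neg

lemma BM.mul {F G : β → ℝ} (h : BM F) (h' : BM G) : BM (fun a => F a * G a) := by
  obtain ⟨hm, C, hC⟩ := h
  obtain ⟨hm', C', hC'⟩ := h'
  refine ⟨hm.mul hm', C * C', fun a => ?_⟩
  rw [abs_mul]
  exact mul_le_mul (hC a) (hC' a) (abs_nonneg _) ((abs_nonneg _).trans (hC a))

lemma BM.const (c : ℝ) : BM (fun _ : β => c) := ⟨measurable_const, |c|, fun _ => le_rfl⟩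

lemma BM.pow {F : β → ℝ} (h : BM F) (n : ℕ) : BM (fun a => F a ^ n) := by
  induction n with
  | zero => simpa using BM.const (β := β) 1
  | succ n ih => simpa [pow_succ] using ih.mul h

lemma BM.abs {F : β → ℝ} (h : BM F) : BM (fun a => |F a|) := by
  obtain ⟨hm, C, hC⟩ := h
  exact ⟨hm.abs, C, fun a => by rw [abs_abs]; exact hC a⟩

lemma BM.comp {F : β → ℝ} (h : BM F) {g : γ → β} (hg : Measurable g) :
    BM (fun a => F (g a)) := ⟨h.1.comp hg, h.2.imp fun _ hC a => hC (g a)⟩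

lemma BM.sum {κ : Type*} (s : Finset κ) {F : κ → β → ℝ} (h : ∀ k ∈ s, BM (F k)) :
    BM (fun a => ∑ k ∈ s, F k a) := by
  classical
  induction s using Finset.induction_on with
  | empty => simpa using BM.const (β := β) 0
  | insert k s hk ih =>
    simp only [Finset.sum_insert hk]
    exact (h k (by simp)).add (ih fun k' hk' => h k' (by simp [hk']))

lemma BM.prod {κ : Type*} (s : Finset κ) {F : κ → β → ℝ} (h : ∀ k ∈ s, BM (F k)) :
    BM (fun a => ∏ k ∈ s, F k a) := by
  classical
  induction s using Finset.induction_on with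
  | empty => simpa using BM.const (β := β) 1
  | insert k s hk ih =>
    simp only [Finset.prod_insert hk]
    exact (h k (by simp)).mul (ih fun k' hk' => h k' (by simp [hk']))

/-- Composition with a continuous function. -/
lemma BM.cont {F : β → ℝ} (h : BM F) {g : ℝ → ℝ} (hg : Continuous g) : BM (fun a => g (F a)) := by
  obtain ⟨hm, C, hC⟩ := h
  refine ⟨hg.measurable.comp hm, ?_⟩
  obtain ⟨B, hB⟩ := (isCompact_Icc (a := -C) (b := C)).exists_bound_of_continuousOn hg.continuousOn
  exact ⟨B, fun a => hB _ (abs_le.mp (hC a))⟩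

lemma BM.integral_snd {F : β × γ → ℝ} (h : BM F) (μ : Measure γ) [IsProbabilityMeasure μ] :
    BM (fun a => ∫ b, F (a, b) ∂μ) := by
  obtain ⟨hm, C, hC⟩ := h
  refine ⟨(hm.stronglyMeasurable.integral_prod_right').measurable, C, fun a => ?_⟩
  have := norm_integral_le_of_norm_le_const (μ := μ) (f := fun b => F (a, b)) (C := C)
    (Filter.Eventually.of_forall fun b => hC _)
  simpa using this

end BMlemmas

section PiLemmas
variable {ι α : Type*} [Fintype ι] [DecidableEq ι] [MeasurableSpace α]

lemma measurable_pw (S : Finset ι) :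
    Measurable (fun p : (ι → α) × (ι → α) => S.piecewise p.1 p.2) := by
  refine measurable_pi_lambda _ fun j => ?_
  by_cases h : j ∈ S
  · simpa [Finset.piecewise, h] using! (measurable_pi_apply j).comp measurable_fst
  · simpa [Finset.piecewise, h] using! (measurable_pi_apply j).comp measurable_snd

lemma measurePreserving_pw (P : ι → Measure α) [∀ j, IsProbabilityMeasure (P j)] (S : Finset ι) :
    MeasurePreserving (fun p : (ι → α) × (ι → α) => S.piecewise p.1 p.2)
      ((Measure.pi P).prod (Measure.pi P)) (Measure.pi P) := by
  refine ⟨measurable_pw S, ?_⟩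
  symm
  refine Measure.pi_eq fun t ht => ?_
  rw [Measure.map_apply (measurable_pw S) (MeasurableSet.univ_pi ht)]
  have : (fun p : (ι → α) × (ι → α) => S.piecewise p.1 p.2) ⁻¹' (Set.univ.pi t)
      = (Set.univ.pi fun j => if j ∈ S then t j else Set.univ) ×ˢ
        (Set.univ.pi fun j => if j ∈ S then Set.univ else t j) := by
    ext p
    simp only [Set.mem_preimage, Set.mem_pi, Set.mem_univ, true_implies, Set.mem_prod,
      Finset.piecewise]
    constructor
    · intro h
      refine ⟨fun j => ?_, fun j => ?_⟩ <;> have := h j <;> by_cases hj : j ∈ S <;>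
        simp_all
    · rintro ⟨h1, h2⟩ j
      have := h1 j
      have := h2 j
      by_cases hj : j ∈ S <;> simp_all
  rw [this, Measure.prod_prod, Measure.pi_pi, Measure.pi_pi, ← Finset.prod_mul_distrib]
  refine Finset.prod_congr rfl fun j _ => ?_
  by_cases hj : j ∈ S <;> simp [hj]

variable (P : ι → Measure α) [∀ j, IsProbabilityMeasure (P j)]

lemma integral_pw (S : Finset ι) {F : (ι → α) → ℝ} (hF : BM F) :
    ∫ a, F a ∂(Measure.pi P) =
      ∫ a, ∫ b, F (S.piecewise a b) ∂(Measure.pi P) ∂(Measure.pi P) := by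
  have h := (measurePreserving_pw P S)
  rw [← h.map_eq, integral_map h.measurable.aemeasurable hF.1.aestronglyMeasurable, h.map_eq,
    integral_prod _ ((hF.comp (measurable_pw S)).integrable _)]

/-- `F` depends only on the coordinates in `D`. -/
def Dep (D : Finset ι) (F : (ι → α) → ℝ) : Prop := ∀ a b, (∀ j ∈ D, a j = b j) → F a = F b

lemma Dep.mono {D D' : Finset ι} {F : (ι → α) → ℝ} (h : Dep D F) (hD : D ⊆ D') : Dep D' F :=
  fun a b hab => h a b fun j hj => hab j (hD hj)

lemma integral_indep (S S' : Finset ι) (hS : Disjoint S S') {F G : (ι → α) → ℝ} (hF : BM F)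
    (hG : BM G) (dF : Dep S F) (dG : Dep S' G) :
    ∫ a, F a * G a ∂(Measure.pi P) = (∫ a, F a ∂(Measure.pi P)) * ∫ a, G a ∂(Measure.pi P) := by
  rw [integral_pw P S (hF.mul hG)]
  have : ∀ a b, F (S.piecewise a b) * G (S.piecewise a b) = F a * G b := by
    intro a b
    congr 1
    · exact dF _ _ fun j hj => by simp [hj]
    · exact dG _ _ fun j hj => by
        have : j ∉ S := fun h => Finset.disjoint_left.mp hS h hj
        simp [this]
  simp_rw [this, integral_const_mul, integral_mul_const]

/-- Averaging out the coordinates outside `D`. -/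
def Q (D : Finset ι) (f : (ι → α) → ℝ) (a : ι → α) : ℝ :=
  ∫ b, f (D.piecewise a b) ∂(Measure.pi P)

lemma BM.Q {f : (ι → α) → ℝ} (hf : BM f) (D : Finset ι) : BM (Q P D f) :=
  (hf.comp (measurable_pw D)).integral_snd (Measure.pi P)

lemma dep_Q (f : (ι → α) → ℝ) (D : Finset ι) : Dep D (Q P D f) := by
  intro a b hab
  unfold RMP.Q
  congr 1
  ext c
  congr 1
  ext j
  by_cases hj : j ∈ D <;> simp [hj, hab]

lemma integral_Q_mul {f g : (ι → α) → ℝ} (hf : BM f) (hg : BM g) (D : Finset ι) (dg : Dep D g) :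
    ∫ a, Q P D f a * g a ∂(Measure.pi P) = ∫ a, f a * g a ∂(Measure.pi P) := by
  rw [integral_pw P D (hf.mul hg)]
  congr 1
  ext a
  unfold Q
  rw [← integral_mul_const]
  congr 1
  ext b
  congr 1
  exact dg _ _ fun j hj => by simp [hj]

lemma Q_Q {f : (ι → α) → ℝ} (hf : BM f) (D D' : Finset ι) :
    Q P D (Q P D' f) = Q P (D ∩ D') f := by
  ext a
  unfold Q
  have h := integral_pw P (D'ᶜ) (F := fun c => f ((D ∩ D').piecewise a c))
    (hf.comp ((measurable_pw (D ∩ D')).comp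
      ((measurable_const (a := a)).prodMk measurable_id)))
  rw [h, integral_integral_swap]
  · congr 1; ext b; congr 1; ext c; congr 1; ext j
    by_cases hj : j ∈ D' <;> by_cases hj' : j ∈ D <;> simp [hj, hj', Finset.piecewise]
  · apply BM.integrable
    refine hf.comp ?_
    exact (measurable_pw D').comp
      (((measurable_pw D).comp ((measurable_const (a := a)).prodMk measurable_fst)).prodMk
        measurable_snd)

/-- Squared norm of the projection of `f` on functions of the coordinates in `D`. -/
def V (f : (ι → α) → ℝ) (D : Finset ι) : ℝ := ∫ a, Q P D f a ^ 2 ∂(Measure.pi P)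

lemma integral_Q_mul_Q {f : (ι → α) → ℝ} (hf : BM f) {D D' : Finset ι} (h : D ⊆ D') :
    ∫ a, Q P D' f a * Q P D f a ∂(Measure.pi P) = V P f D := by
  unfold V
  simp_rw [pow_two]
  rw [integral_Q_mul P hf (hf.Q P D) D' ((dep_Q P f D).mono h),
    integral_Q_mul P hf (hf.Q P D) D (dep_Q P f D)]

lemma V_sub {f : (ι → α) → ℝ} (hf : BM f) {D D' : Finset ι} (h : D ⊆ D') :
    ∫ a, (Q P D' f a - Q P D f a) ^ 2 ∂(Measure.pi P) = V P f D' - V P f D := by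
  have e : ∀ a, (Q P D' f a - Q P D f a) ^ 2
      = (Q P D' f a ^ 2 - 2 * (Q P D' f a * Q P D f a)) + Q P D f a ^ 2 := fun a => by ring
  simp_rw [e]
  have b1 := (hf.Q P D').pow 2
  have b2 := (BM.const (β := ι → α) 2).mul ((hf.Q P D').mul (hf.Q P D))
  have b3 := (hf.Q P D).pow 2
  rw [integral_add ((b1.sub b2).integrable _) (b3.integrable _),
    integral_sub (b1.integrable _) (b2.integrable _), integral_const_mul,
    integral_Q_mul_Q P hf h]
  unfold V
  ring

/-- `L²`-contraction of `Q`. -/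
lemma Q_contr {f : (ι → α) → ℝ} (hf : BM f) (D : Finset ι) :
    ∫ a, Q P D f a ^ 2 ∂(Measure.pi P) ≤ ∫ a, f a ^ 2 ∂(Measure.pi P) := by
  have h0 : 0 ≤ ∫ a, (f a - Q P D f a) ^ 2 ∂(Measure.pi P) :=
    integral_nonneg fun a => sq_nonneg _
  have e : ∀ a, (f a - Q P D f a) ^ 2
      = (f a ^ 2 - 2 * (f a * Q P D f a)) + Q P D f a ^ 2 := fun a => by ring
  simp_rw [e] at h0
  have b1 := hf.pow 2
  have b2 := (BM.const (β := ι → α) 2).mul (hf.mul (hf.Q P D))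
  have b3 := (hf.Q P D).pow 2
  rw [integral_add ((b1.sub b2).integrable _) (b3.integrable _),
    integral_sub (b1.integrable _) (b2.integrable _), integral_const_mul,
    ← integral_Q_mul P hf (hf.Q P D) D (dep_Q P f D)] at h0
  simp_rw [← pow_two] at h0
  linarith

lemma Q_sub {f g : (ι → α) → ℝ} (hf : BM f) (hg : BM g) (D : Finset ι) (a : ι → α) :
    Q P D (fun a => f a - g a) a = Q P D f a - Q P D g a := by
  unfold Q
  have hm : Measurable fun b : ι → α => D.piecewise a b :=
    (measurable_pw D).comp ((measurable_const (a := a)).prodMk measurable_id)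
  exact integral_sub ((hf.comp hm).integrable _) ((hg.comp hm).integrable _)

/-- Supermodularity. -/
lemma V_super {f : (ι → α) → ℝ} (hf : BM f) {S S' : Finset ι} (h : S ⊆ S') {j : ι} (hj : j ∉ S') :
    V P f (insert j S) - V P f S ≤ V P f (insert j S') - V P f S' := by
  rw [← V_sub P hf (Finset.subset_insert j S), ← V_sub P hf (Finset.subset_insert j S')]
  have key : ∀ a, Q P (insert j S) f a - Q P S f a
      = Q P (insert j S) (fun a => Q P (insert j S') f a - Q P S' f a) a := by
    intro a
    rw [Q_sub P (hf.Q P _) (hf.Q P _), Q_Q P hf, Q_Q P hf]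
    congr 2
    · ext l; simp only [Finset.mem_insert, Finset.mem_inter]; have := @h l; tauto
    · ext l
      simp only [Finset.mem_insert, Finset.mem_inter]
      constructor
      · intro hl; exact ⟨Or.inr hl, h hl⟩
      · rintro ⟨rfl | hl, hl'⟩
        · exact absurd hl' hj
        · exact hl
  simp_rw [key]
  exact Q_contr P ((hf.Q P _).sub (hf.Q P _)) _

/-- Efron-Stein type inequality for a random set of coordinates. -/
lemma efron_stein {ℒ : Type*} [Fintype ℒ] {f : (ι → α) → ℝ} (hf : BM f) (i : ι)
    (df : Dep (Finset.univ.erase i) f) (D : ℒ → Finset ι)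
    (hD : ∀ j, j ≠ i → 2 * (Finset.univ.filter fun l => j ∈ D l).card ≤ Fintype.card ℒ) :
    2 * ∑ l, V P f (D l) ≤ Fintype.card ℒ * (V P f Finset.univ + V P f ∅) := by
  have key : ∀ S : Finset ι, 2 * ∑ l, (V P f (D l ∩ S) - V P f ∅)
      ≤ Fintype.card ℒ * (V P f S - V P f ∅) := by
    intro S
    induction S using Finset.induction_on with
    | empty => simp
    | insert j S hj ih =>
      by_cases hji : j = i
      · subst hji
        have hV : ∀ T : Finset ι, V P f (insert j T) = V P f T := by
          intro T
          unfold V Q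
          congr 1; ext a; congr 2; ext b
          apply df
          intro l hl
          have : l ≠ j := (Finset.mem_erase.mp hl).1
          by_cases hT : l ∈ T <;> simp [Finset.piecewise, hT, this]
        have : ∀ l, V P f (D l ∩ insert j S) = V P f (D l ∩ S) := by
          intro l
          by_cases hl : j ∈ D l
          · rw [Finset.inter_insert_of_mem hl, hV]
          · rw [Finset.inter_insert_of_notMem hl]
        simp_rw [this, hV]
        exact ih
      · have hstep : ∀ l, V P f (D l ∩ insert j S) ≤ V P f (D l ∩ S)
            + (if j ∈ D l then 1 else 0) * (V P f (insert j S) - V P f S) := by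
          intro l
          by_cases hl : j ∈ D l
          · rw [Finset.inter_insert_of_mem hl]
            have := V_super P hf (S := D l ∩ S) (S' := S) Finset.inter_subset_right hj
            simp only [hl, if_true]; linarith
          · rw [Finset.inter_insert_of_notMem hl]; simp [hl]
        have hnn : 0 ≤ V P f (insert j S) - V P f S := by
          rw [← V_sub P hf (Finset.subset_insert j S)]
          exact integral_nonneg fun a => sq_nonneg _
        have hc : (2 : ℝ) * ∑ l, (if j ∈ D l then (1 : ℝ) else 0) ≤ Fintype.card ℒ := by
          have := hD j hji
          rw [Finset.sum_boole]
          exact_mod_cast this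
        have hs := Finset.sum_le_sum fun l (_ : l ∈ Finset.univ) => hstep l
        rw [Finset.sum_add_distrib, ← Finset.sum_mul] at hs
        rw [Finset.sum_sub_distrib] at ih ⊢
        have := mul_le_mul_of_nonneg_right hc hnn
        nlinarith
  have := key Finset.univ
  simp only [Finset.inter_univ, Finset.sum_sub_distrib, Finset.sum_const, Finset.card_univ,
    nsmul_eq_mul] at this
  linarith

end PiLemmas
end
end RMP

namespace RMP
noncomputable section

def eta (x : ℝ) : ℝ := x * Real.log x

def EE (t : ℝ) : ℝ := (eta (1 + t) + eta (1 - t)) / 2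

/-- the derivative of `EE` -/
def AA (t : ℝ) : ℝ := (Real.log (1 + t) - Real.log (1 - t)) / 2

lemma eta_cont : Continuous eta := Real.continuous_mul_log

lemma EE_cont : Continuous EE := by
  unfold EE
  exact ((eta_cont.comp (by fun_prop)).add (eta_cont.comp (by fun_prop))).div_const _

lemma EE_neg (t : ℝ) : EE (-t) = EE t := by
  unfold EE
  rw [sub_neg_eq_add, ← sub_eq_add_neg]; ring

lemma EE_zero : EE 0 = 0 := by simp [EE, eta]
lemma EE_one : EE 1 = Real.log 2 := by simp [EE, eta]; norm_num

lemma AA_zero : AA 0 = 0 := by simp [AA]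

lemma EE_abs (t : ℝ) : EE |t| = EE t := by
  rcases abs_choice t with h | h <;> rw [h]
  exact EE_neg t

lemma hasDerivAt_EE {t : ℝ} (h1 : -1 < t) (h2 : t < 1) : HasDerivAt EE (AA t) t := by
  have e1 : HasDerivAt (fun t : ℝ => eta (1 + t)) (Real.log (1 + t) + 1) t := by
    have := (Real.hasDerivAt_mul_log (x := 1 + t) (by linarith)).comp t
      ((hasDerivAt_id t).const_add 1)
    simpa [eta, Function.comp_def] using! this
  have e2 : HasDerivAt (fun t : ℝ => eta (1 - t)) (-(Real.log (1 - t) + 1)) t := by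
    have := (Real.hasDerivAt_mul_log (x := 1 - t) (by linarith)).comp t
      ((hasDerivAt_id t).const_sub 1)
    simpa [eta, Function.comp_def] using! this
  have := (e1.add e2).div_const 2
  convert! this using 1
  unfold AA; ring

lemma hasDerivAt_AA {t : ℝ} (h1 : -1 < t) (h2 : t < 1) : HasDerivAt AA (1 / (1 - t ^ 2)) t := by
  have e1 : HasDerivAt (fun t : ℝ => Real.log (1 + t)) (1 / (1 + t)) t :=
    ((hasDerivAt_id t).const_add 1).log (by simp; linarith)
  have e2 : HasDerivAt (fun t : ℝ => Real.log (1 - t)) (-1 / (1 - t)) t :=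
    ((hasDerivAt_id t).const_sub 1).log (by simp; linarith)
  have := (e1.sub e2).div_const 2
  convert! this using 1
  have : 1 + t ≠ 0 := by linarith
  have : 1 - t ≠ 0 := by linarith
  have : 1 - t ^ 2 ≠ 0 := by
    have : (1 - t) * (1 + t) ≠ 0 := by positivity
    intro h; apply this; linarith [h]
  field_simp
  ring

lemma one_sub_sq_pos {t : ℝ} (h1 : -1 < t) (h2 : t < 1) : 0 < 1 - t ^ 2 := by nlinarith

lemma EE_convex : ConvexOn ℝ (Set.Icc (-1) 1) EE := by
  refine convexOn_of_hasDerivWithinAt2_nonneg (convex_Icc _ _) EE_cont.continuousOn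
    (f' := AA) (f'' := fun t => 1 / (1 - t ^ 2)) ?_ ?_ ?_
  · intro x hx
    rw [interior_Icc] at hx
    exact (hasDerivAt_EE hx.1 hx.2).hasDerivWithinAt
  · intro x hx
    rw [interior_Icc] at hx
    exact (hasDerivAt_AA hx.1 hx.2).hasDerivWithinAt
  · intro x hx
    rw [interior_Icc] at hx
    have := one_sub_sq_pos hx.1 hx.2
    positivity

/-- scaling towards the origin shrinks `EE`. -/
lemma EE_scale {s c : ℝ} (hs0 : 0 ≤ s) (hs : s ≤ 1) (hc : |c| ≤ 1) : EE (s * c) ≤ s * EE c := by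
  have := EE_convex.2 (show c ∈ Set.Icc (-1 : ℝ) 1 from abs_le.mp hc)
    (show (0 : ℝ) ∈ Set.Icc (-1 : ℝ) 1 by norm_num) hs0
    (show 0 ≤ 1 - s by linarith) (by ring)
  simpa [EE_zero] using this

lemma EE_nonneg {c : ℝ} (hc : |c| ≤ 1) : 0 ≤ EE c := by
  have := EE_convex.2 (show c ∈ Set.Icc (-1 : ℝ) 1 from abs_le.mp hc)
    (show -c ∈ Set.Icc (-1 : ℝ) 1 from abs_le.mp (by rwa [abs_neg]))
    (show (0 : ℝ) ≤ 1 / 2 by norm_num) (show (0 : ℝ) ≤ 1 / 2 by norm_num) (by norm_num)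
  simp only [smul_eq_mul] at this
  rw [EE_neg, show (1 / 2 : ℝ) * c + 1 / 2 * -c = 0 by ring, EE_zero] at this
  linarith

lemma EE_le_abs {a : ℝ} (ha : |a| ≤ 1) : EE a ≤ |a| * Real.log 2 := by
  have := EE_scale (s := |a|) (c := 1) (abs_nonneg a) ha (by simp)
  rwa [mul_one, EE_abs, EE_one] at this

lemma EE_mul_le {c f : ℝ} (hc : |c| ≤ 1) (hf : |f| ≤ 1) : EE (c * f) ≤ EE c := by
  have h1 := EE_scale (s := |f|) (c := c) (abs_nonneg f) hf hc
  have h2 : EE (|f| * c) = EE (c * f) := by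
    rw [← EE_abs (c * f), ← EE_abs (|f| * c)]; congr 1; simp [abs_mul, mul_comm]
  rw [h2] at h1
  have := EE_nonneg hc
  nlinarith

lemma AA_convex : ConvexOn ℝ (Set.Ico 0 1) AA := by
  refine MonotoneOn.convexOn_of_deriv (convex_Ico _ _) ?_ ?_ ?_
  · intro x hx
    exact (hasDerivAt_AA (by linarith [hx.1]) hx.2).continuousAt.continuousWithinAt
  · intro x hx
    rw [interior_Ico] at hx
    exact (hasDerivAt_AA (by linarith [hx.1]) hx.2).differentiableAt.differentiableWithinAt
  · intro x hx y hy hxy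
    rw [interior_Ico] at hx hy
    rw [(hasDerivAt_AA (by linarith [hx.1]) hx.2).deriv,
      (hasDerivAt_AA (by linarith [hy.1]) hy.2).deriv]
    have := one_sub_sq_pos (by linarith [hx.1]) hx.2
    have := one_sub_sq_pos (by linarith [hy.1]) hy.2
    apply one_div_le_one_div_of_le this
    have := hx.1
    nlinarith

/-- `AA x / x` is monotone. -/
lemma AA_ratio {x y : ℝ} (hx : 0 ≤ x) (hxy : x ≤ y) (hy0 : 0 < y) (hy : y < 1) :
    AA x * y ≤ AA y * x := by
  have := AA_convex.2 (show y ∈ Set.Ico (0 : ℝ) 1 from ⟨hy0.le, hy⟩)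
    (show (0 : ℝ) ∈ Set.Ico (0 : ℝ) 1 by norm_num) (show 0 ≤ x / y by positivity)
    (show 0 ≤ 1 - x / y by rw [sub_nonneg, div_le_one hy0]; exact hxy) (by ring)
  simp only [smul_eq_mul, mul_zero, add_zero, AA_zero] at this
  rw [div_mul_cancel₀ _ hy0.ne'] at this
  calc AA x * y ≤ (x / y * AA y) * y := by gcongr
    _ = AA y * x := by field_simp

lemma AA_pos {x : ℝ} (h0 : 0 < x) (h1 : x < 1) : 0 < AA x := by
  unfold AA
  have := Real.log_lt_log (x := 1 - x) (y := 1 + x) (by linarith) (by linarith)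
  linarith

lemma EE_tangent {x0 : ℝ} (h0 : 0 < x0) (h1 : x0 < 1) :
    ∃ κ : ℝ, 0 ≤ κ ∧ ∀ x, |x| ≤ 1 → 1 - x0 ^ 2 + κ * (EE x0 - EE x) ≤ 1 - x ^ 2 := by
  have hA := AA_pos h0 h1
  set m : ℝ := AA x0 / (2 * x0) with hm
  have hmpos : 0 < m := by positivity
  have hm2 : 2 * m * x0 = AA x0 := by rw [hm]; field_simp
  have hder : ∀ x, -1 < x → x < 1 →
      HasDerivAt (fun x => EE x - m * x ^ 2) (AA x - 2 * m * x) x := by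
    intro x hx hx'
    have := (hasDerivAt_EE hx hx').sub (((hasDerivAt_id x).pow 2).const_mul m)
    convert! this using 1
    simp; ring
  have hcont : Continuous (fun x => EE x - m * x ^ 2) := EE_cont.sub (by fun_prop)
  have anti : AntitoneOn (fun x => EE x - m * x ^ 2) (Set.Icc 0 x0) := by
    refine antitoneOn_of_deriv_nonpos (convex_Icc _ _) hcont.continuousOn ?_ ?_
    · intro x hx
      rw [interior_Icc] at hx
      exact (hder x (by linarith [hx.1]) (by linarith [hx.2])).differentiableAt.differentiableWithinAt
    · intro x hx
      rw [interior_Icc] at hx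
      rw [(hder x (by linarith [hx.1]) (by linarith [hx.2])).deriv]
      have := AA_ratio hx.1.le hx.2.le h0 h1
      rw [← hm2] at this
      have : AA x * x0 ≤ (2 * m * x) * x0 := by linarith
      have := le_of_mul_le_mul_right this h0
      linarith
  have mono : MonotoneOn (fun x => EE x - m * x ^ 2) (Set.Icc x0 1) := by
    refine monotoneOn_of_deriv_nonneg (convex_Icc _ _) hcont.continuousOn ?_ ?_
    · intro x hx
      rw [interior_Icc] at hx
      exact (hder x (by linarith [hx.1]) (by linarith [hx.2])).differentiableAt.differentiableWithinAt
    · intro x hx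
      rw [interior_Icc] at hx
      rw [(hder x (by linarith [hx.1]) (by linarith [hx.2])).deriv]
      have := AA_ratio h0.le hx.1.le (h0.trans hx.1) hx.2
      rw [← hm2] at this
      have : (2 * m * x) * x0 ≤ AA x * x0 := by linarith
      have := le_of_mul_le_mul_right this h0
      linarith
  refine ⟨1 / m, by positivity, fun x hx => ?_⟩
  have key : EE x0 - m * x0 ^ 2 ≤ EE |x| - m * |x| ^ 2 := by
    rcases le_total |x| x0 with h | h
    · exact anti ⟨abs_nonneg x, h⟩ ⟨h0.le, le_rfl⟩ h
    · exact mono ⟨le_rfl, h1.le⟩ ⟨h, hx⟩ h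
  rw [EE_abs, sq_abs] at key
  have : 1 / m * (EE x0 - EE x) ≤ 1 / m * (m * x0 ^ 2 - m * x ^ 2) := by
    exact mul_le_mul_of_nonneg_left (by linarith) (by positivity)
  have e : 1 / m * (m * x0 ^ 2 - m * x ^ 2) = x0 ^ 2 - x ^ 2 := by field_simp
  linarith

/-- The entropy of a bit observed through two channels of reliability `c` and `f`. -/
def phi (c f : ℝ) : ℝ := Real.log 2 - EE c - EE f + EE (c * f)

lemma phi_concave {c : ℝ} (hc : |c| ≤ 1) :
    ConcaveOn ℝ (Set.Icc (-1) 1) (fun f => phi c f + (1 - c ^ 2) / 2 * f ^ 2) := by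
  have hcc : c ^ 2 ≤ 1 := by rw [← sq_abs]; exact pow_le_one₀ (abs_nonneg c) hc
  have hcf : ∀ f : ℝ, -1 < f → f < 1 → -1 < c * f ∧ c * f < 1 := by
    intro f h1 h2
    rw [← abs_lt, abs_mul]
    have : |f| < 1 := abs_lt.mpr ⟨h1, h2⟩
    have := abs_nonneg f
    nlinarith
  refine concaveOn_of_hasDerivWithinAt2_nonpos (convex_Icc _ _)
    (f' := fun f => - AA f + c * AA (c * f) + (1 - c ^ 2) * f)
    (f'' := fun f => - (1 / (1 - f ^ 2)) + c * (c * (1 / (1 - (c * f) ^ 2))) + (1 - c ^ 2)) ?_ ?_ ?_ ?_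
  · apply Continuous.continuousOn
    unfold phi
    exact (((continuous_const.sub continuous_const).sub EE_cont).add
      (EE_cont.comp (by fun_prop))).add (by fun_prop)
  · intro f hf
    rw [interior_Icc] at hf
    obtain ⟨g1, g2⟩ := hcf f hf.1 hf.2
    apply HasDerivAt.hasDerivWithinAt
    have d1 := hasDerivAt_EE hf.1 hf.2
    have d2 : HasDerivAt (fun f => EE (c * f)) (c * AA (c * f)) f := by
      have := (hasDerivAt_EE g1 g2).comp f ((hasDerivAt_id f).const_mul c)
      convert! this using 1
      simp [mul_comm]
    have d3 := (((hasDerivAt_id f).pow 2).const_mul ((1 - c ^ 2) / 2))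
    have := ((d1.const_sub (Real.log 2 - EE c)).add d2).add d3
    convert! this using 1
    simp; ring
  · intro f hf
    rw [interior_Icc] at hf
    obtain ⟨g1, g2⟩ := hcf f hf.1 hf.2
    apply HasDerivAt.hasDerivWithinAt
    have d1 := hasDerivAt_AA hf.1 hf.2
    have d2 : HasDerivAt (fun f => AA (c * f)) (c * (1 / (1 - (c * f) ^ 2))) f := by
      have := (hasDerivAt_AA g1 g2).comp f ((hasDerivAt_id f).const_mul c)
      convert! this using 1
      simp [mul_comm]
    have d3 := ((hasDerivAt_id f).const_mul (1 - c ^ 2))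
    have := ((d1.neg).add (d2.const_mul c)).add d3
    convert! this using 1
    simp
  · intro f hf
    rw [interior_Icc] at hf
    obtain ⟨g1, g2⟩ := hcf f hf.1 hf.2
    have p1 := one_sub_sq_pos hf.1 hf.2
    have p2 := one_sub_sq_pos g1 g2
    have e : - (1 / (1 - f ^ 2)) + c * (c * (1 / (1 - (c * f) ^ 2))) + (1 - c ^ 2)
        = - ((1 - c ^ 2) * (1 - (1 - f ^ 2) * (1 - (c * f) ^ 2))
            / ((1 - f ^ 2) * (1 - (c * f) ^ 2))) := by
      have n1 := p1.ne'
      have n2 := p2.ne'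
      generalize hA : 1 - f ^ 2 = A at *
      generalize hB : 1 - (c * f) ^ 2 = B at *
      have hAB : c ^ 2 * (1 - A) = 1 - B := by rw [← hA, ← hB]; ring
      field_simp
      linear_combination (-1) * hAB
    simp only [e]
    rw [neg_nonpos]
    have h3 : (1 - f ^ 2) * (1 - (c * f) ^ 2) ≤ 1 := by
      have : 1 - f ^ 2 ≤ 1 := by nlinarith [sq_nonneg f]
      have : 1 - (c * f) ^ 2 ≤ 1 := by nlinarith [sq_nonneg (c * f)]
      nlinarith
    have : 0 ≤ 1 - c ^ 2 := by linarith
    have : 0 ≤ 1 - (1 - f ^ 2) * (1 - (c * f) ^ 2) := by linarith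
    positivity

lemma hb_eq_binEntropy (p : ℝ) : hb p = Real.binEntropy p / Real.log 2 := by
  unfold hb Real.binEntropy Real.logb
  rw [Real.log_inv, Real.log_inv]; ring

lemma hb_eq_EE (x : ℝ) : hb ((1 + x) / 2) = (Real.log 2 - EE x) / Real.log 2 := by
  rw [hb_eq_binEntropy]
  congr 1
  unfold Real.binEntropy EE eta
  rw [Real.log_inv, Real.log_inv, show 1 - (1 + x) / 2 = (1 - x) / 2 by ring]
  by_cases h1 : 1 + x = 0
  · have : x = -1 := by linarith
    subst this; norm_num
  by_cases h2 : 1 - x = 0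
  · have : x = 1 := by linarith
    subst this; norm_num
  rw [Real.log_div h1 (by norm_num), Real.log_div h2 (by norm_num)]
  ring

lemma log2_pos : 0 < Real.log 2 := Real.log_pos (by norm_num)

lemma hb_strictMono : StrictMonoOn hb (Set.Icc 0 (1 / 2)) := by
  intro x hx y hy hxy
  rw [hb_eq_binEntropy, hb_eq_binEntropy]
  have := Real.binEntropy_strictMonoOn (by simpa using hx) (by simpa using hy) hxy
  have := log2_pos
  gcongr

lemma hbInv_spec {u : ℝ} (h0 : 0 < u) (h1 : u < 1) :
    ∃ x : ℝ, 0 < x ∧ x < 1 ∧ hbInv u = (1 - x) / 2 ∧ Real.log 2 - EE x = u * Real.log 2 := by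
  have hl := log2_pos
  have hcont : ContinuousOn hb (Set.Icc 0 (1 / 2)) := by
    have : hb = fun p => Real.binEntropy p / Real.log 2 := funext hb_eq_binEntropy
    rw [this]
    exact (Real.binEntropy_continuous.div_const _).continuousOn
  have hz : hb 0 = 0 := by simp [hb_eq_binEntropy]
  have hh : hb (1 / 2) = 1 := by
    rw [hb_eq_binEntropy, one_div, Real.binEntropy_two_inv, div_self hl.ne']
  obtain ⟨p, hp, hpu⟩ := intermediate_value_Icc (by norm_num) hcont
    (show u ∈ Set.Icc (hb 0) (hb (1 / 2)) by rw [hz, hh]; exact ⟨h0.le, h1.le⟩)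
  have hp0 : p ≠ 0 := by rintro rfl; linarith
  have hp1 : p ≠ 1 / 2 := by rintro rfl; linarith
  have hp0' : 0 < p := lt_of_le_of_ne hp.1 (Ne.symm hp0)
  have hp1' : p < 1 / 2 := lt_of_le_of_ne hp.2 hp1
  refine ⟨1 - 2 * p, by linarith, by linarith, ?_, ?_⟩
  · rw [show (1 - (1 - 2 * p)) / 2 = p by ring]
    unfold hbInv
    refine IsLUB.csSup_eq (s := {p : ℝ | p ∈ Set.Icc (0 : ℝ) (1 / 2) ∧ hb p ≤ u}) ?_ ⟨p, hp, hpu.le⟩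
    constructor
    · rintro q ⟨hq, hqu⟩
      by_contra hlt
      push Not at hlt
      have := hb_strictMono hp hq hlt
      linarith
    · intro b hb'
      exact hb' ⟨hp, hpu.le⟩
  · have := hb_eq_EE (-(1 - 2 * p))
    rw [EE_neg, show (1 + -(1 - 2 * p)) / 2 = p by ring, hpu, eq_div_iff hl.ne'] at this
    exact this.symm

lemma hbInv_set_ne {u : ℝ} (h : 0 ≤ u) :
    (0 : ℝ) ∈ {p : ℝ | p ∈ Set.Icc (0 : ℝ) (1 / 2) ∧ hb p ≤ u} :=
  ⟨by norm_num, by simpa [hb_eq_binEntropy] using h⟩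

lemma hbInv_mem {u : ℝ} (h : 0 ≤ u) : 0 ≤ hbInv u ∧ hbInv u ≤ 1 / 2 := by
  constructor
  · exact le_csSup ⟨1 / 2, fun p hp => hp.1.2⟩ (hbInv_set_ne h)
  · exact csSup_le ⟨0, hbInv_set_ne h⟩ fun p hp => hp.1.2

lemma hbInv_mono {u v : ℝ} (h : 0 ≤ u) (huv : u ≤ v) : hbInv u ≤ hbInv v :=
  csSup_le_csSup ⟨1 / 2, fun p hp => hp.1.2⟩ ⟨0, hbInv_set_ne h⟩
    fun p hp => ⟨hp.1, hp.2.trans huv⟩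

lemma psi_mono {u v : ℝ} (h : 0 ≤ u) (huv : u ≤ v) : psi u ≤ psi v := by
  unfold psi
  have := hbInv_mono h huv
  have := hbInv_mem h
  have := hbInv_mem (h.trans huv)
  nlinarith

lemma psi_nonneg {u : ℝ} (h : 0 ≤ u) : 0 ≤ psi u := by
  unfold psi
  have := hbInv_mem h
  nlinarith

lemma psi_pos {u : ℝ} (h0 : 0 < u) (h1 : u < 1) : 0 < psi u := by
  obtain ⟨x, hx0, hx1, hx, -⟩ := hbInv_spec h0 h1
  unfold psi
  rw [hx]
  nlinarith

lemma psi_intble {u v : ℝ} (h : 0 ≤ u) (huv : u ≤ v) : IntervalIntegrable psi volume u v := by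
  apply MonotoneOn.intervalIntegrable
  rw [Set.uIcc_of_le huv]
  intro x hx y hy hxy
  exact psi_mono (h.trans hx.1) hxy

lemma PsiInt_le {u : ℝ} (h0 : 0 < u) (h1 : u < 1) : PsiInt u ≤ psi u := by
  unfold PsiInt
  have := intervalIntegral.integral_mono_on h0.le (psi_intble le_rfl h0.le)
    (intervalIntegrable_const (c := psi u)) (fun x hx => psi_mono hx.1 hx.2)
  rw [intervalIntegral.integral_const, sub_zero, smul_eq_mul] at this
  have := psi_nonneg h0.le
  nlinarith

lemma PsiInt_pos {u : ℝ} (h0 : 0 < u) (h1 : u < 1) : 0 < PsiInt u := by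
  unfold PsiInt
  rw [← intervalIntegral.integral_add_adjacent_intervals (b := u / 2)
    (psi_intble le_rfl (by linarith)) (psi_intble (by linarith) (by linarith))]
  have a1 : 0 ≤ ∫ x in (0:ℝ)..(u/2), psi x :=
    intervalIntegral.integral_nonneg (by linarith) fun x hx => psi_nonneg hx.1
  have a2 := intervalIntegral.integral_mono_on (a := u / 2) (b := u) (by linarith)
    (intervalIntegrable_const (c := psi (u / 2))) (psi_intble (by linarith) (by linarith))
    (fun x hx => psi_mono (by linarith) hx.1)
  rw [intervalIntegral.integral_const, smul_eq_mul] at a2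
  have := psi_pos (u := u / 2) (by linarith) (by linarith)
  nlinarith

end
end RMP

namespace RMP
set_option linter.unusedSectionVars false
noncomputable section

/-- measurable, bounded by one and odd -/
structure OddFn {α : Type*} [MeasurableSpace α] (σ : α → α) (c : α → ℝ) : Prop where
  meas : Measurable c
  le : ∀ p, |c p| ≤ 1
  odd : ∀ p, c (σ p) = - c p

lemma OddFn.bm {α : Type*} [MeasurableSpace α] {σ : α → α} {c : α → ℝ} (h : OddFn σ c) : BM c :=
  ⟨h.meas, 1, h.le⟩

/-- a family of sign characters -/
structure Chars (κ ι : Type*) [AddCommGroup κ] (χ : κ → ι → ℝ) : Prop where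
  sq : ∀ k j, χ k j * χ k j = 1
  add : ∀ k k' j, χ (k + k') j = χ k j * χ k' j

section
variable {κ ι : Type*} [AddCommGroup κ] {χ : κ → ι → ℝ}
lemma Chars.zero (h : Chars κ ι χ) (j : ι) : χ 0 j = 1 := by
  have h1 := h.add 0 0 j
  have h2 := h.sq 0 j
  rw [add_zero] at h1
  rw [h1, h2]
lemma Chars.cases (h : Chars κ ι χ) (k : κ) (j : ι) : χ k j = 1 ∨ χ k j = -1 :=
  mul_self_eq_one_iff.mp (h.sq k j)
lemma Chars.abs (h : Chars κ ι χ) (k : κ) (j : ι) : |χ k j| = 1 := by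
  rcases h.cases k j with e | e <;> simp [e]
end

section core
variable {ι α κ : Type*} [Fintype ι] [DecidableEq ι] [MeasurableSpace α]
  [AddCommGroup κ] [Fintype κ]
variable (χ : κ → ι → ℝ) (cc : ι → α → ℝ)

def W (D : Finset ι) (k : κ) (a : ι → α) : ℝ := ∏ j ∈ D, (1 + χ k j * cc j (a j))

def LL (w : κ → ℝ) (D : Finset ι) (a : ι → α) : ℝ :=
  (Fintype.card κ : ℝ)⁻¹ * ∑ k, w k * W χ cc D k a

variable {χ cc}
variable {σ : α → α}

lemma fac_nonneg (hχ : Chars κ ι χ) (hc : ∀ j, OddFn σ (cc j)) (k : κ) (j : ι) (p : α) : 0 ≤ 1 + χ k j * cc j p := by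
  have := (hc j).le p
  rw [abs_le] at this
  rcases hχ.cases k j with e | e <;> rw [e] <;> linarith

lemma W_nonneg (hχ : Chars κ ι χ) (hc : ∀ j, OddFn σ (cc j)) (D : Finset ι) (k : κ) (a : ι → α) : 0 ≤ W χ cc D k a :=
  Finset.prod_nonneg fun j _ => fac_nonneg hχ hc k j (a j)

lemma W_bm (hχ : Chars κ ι χ) (hc : ∀ j, OddFn σ (cc j)) (D : Finset ι) (k : κ) : BM (W χ cc D k) :=
  BM.prod D fun j _ => (BM.const 1).add ((BM.const (χ k j)).mul
    ((hc j).bm.comp (measurable_pi_apply j)))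

lemma W_dep (D : Finset ι) (k : κ) : Dep D (W χ cc D k) := by
  intro a b hab
  exact Finset.prod_congr rfl fun j hj => by rw [hab j hj]

lemma W_union {D E : Finset ι} (h : Disjoint D E) (k : κ) (a : ι → α) :
    W χ cc (D ∪ E) k a = W χ cc D k a * W χ cc E k a := Finset.prod_union h

lemma LL_bm (hχ : Chars κ ι χ) (hc : ∀ j, OddFn σ (cc j)) (w : κ → ℝ) (D : Finset ι) : BM (LL χ cc w D) :=
  (BM.const _).mul (BM.sum _ fun k _ => (BM.const (w k)).mul (W_bm hχ hc D k))

lemma LL_dep (w : κ → ℝ) (D : Finset ι) : Dep D (LL χ cc w D) := by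
  intro a b hab
  unfold LL
  simp_rw [W_dep D _ a b hab]

lemma card_pos' : (0 : ℝ) < Fintype.card κ := by
  exact_mod_cast Fintype.card_pos

lemma LL_abs_le (hχ : Chars κ ι χ) (hc : ∀ j, OddFn σ (cc j)) {w : κ → ℝ} (hw : ∀ k, |w k| ≤ 1) (D : Finset ι) (a : ι → α) :
    |LL χ cc w D a| ≤ LL χ cc 1 D a := by
  unfold LL
  rw [abs_mul, abs_of_pos (inv_pos.mpr card_pos')]
  refine mul_le_mul_of_nonneg_left ?_ (inv_pos.mpr card_pos').le
  refine (Finset.abs_sum_le_sum_abs _ _).trans (Finset.sum_le_sum fun k _ => ?_)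
  rw [abs_mul, abs_of_nonneg (W_nonneg hχ hc D k a)]
  exact mul_le_mul_of_nonneg_right (hw k) (W_nonneg hχ hc D k a)

lemma LL_nonneg (hχ : Chars κ ι χ) (hc : ∀ j, OddFn σ (cc j)) (D : Finset ι) (a : ι → α) : 0 ≤ LL χ cc 1 D a :=
  (abs_nonneg _).trans (LL_abs_le hχ hc (w := 1) (by simp) D a)

lemma W_le (hχ : Chars κ ι χ) (hc : ∀ j, OddFn σ (cc j)) (D : Finset ι) (k : κ) (a : ι → α) :
    W χ cc D k a ≤ Fintype.card κ * LL χ cc 1 D a := by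
  unfold LL
  rw [← mul_assoc, mul_inv_cancel₀ card_pos'.ne', one_mul]
  simp only [Pi.one_apply, one_mul]
  exact Finset.single_le_sum (f := fun k => W χ cc D k a) (fun k _ => W_nonneg hχ hc D k a)
    (Finset.mem_univ k)


lemma integral_odd (hc : ∀ j, OddFn σ (cc j))
    (lam : Measure α) [IsProbabilityMeasure lam] (hσ : MeasurePreserving σ lam lam) (j : ι) : ∫ p, cc j p ∂lam = 0 := by
  have h := integral_map (μ := lam) hσ.measurable.aemeasurable
    (f := cc j) (hc j).meas.aestronglyMeasurable
  rw [hσ.map_eq] at h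
  simp_rw [(hc j).odd, integral_neg] at h
  linarith

lemma integral_W (hχ : Chars κ ι χ) (hc : ∀ j, OddFn σ (cc j))
    (lam : Measure α) [IsProbabilityMeasure lam] (hσ : MeasurePreserving σ lam lam) (D : Finset ι) (k : κ) : ∫ a, W χ cc D k a ∂(Measure.pi fun _ => lam) = 1 := by
  have e : ∀ a : ι → α, W χ cc D k a
      = ∏ j, (if j ∈ D then (1 + χ k j * cc j (a j)) else 1) := by
    intro a
    unfold W
    rw [Finset.prod_ite_mem, Finset.univ_inter]
  simp_rw [e]
  rw [integral_fintype_prod_eq_prod (f := fun j p => if j ∈ D then (1 + χ k j * cc j p) else 1)]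
  refine Finset.prod_eq_one fun j _ => ?_
  by_cases hj : j ∈ D
  · simp only [hj, if_true]
    rw [integral_add (integrable_const _) ((((hc j).bm).integrable _).const_mul _),
      integral_const_mul, integral_odd hc lam hσ]
    simp
  · simp [hj]

/-- marginalization -/
lemma marg (hχ : Chars κ ι χ) (hc : ∀ j, OddFn σ (cc j))
    (lam : Measure α) [IsProbabilityMeasure lam] (hσ : MeasurePreserving σ lam lam) {D D' : Finset ι} (h : D ⊆ D') {F : (ι → α) → ℝ} (dF : Dep D F) (k : κ)
    (hF : BM fun a => F a * W χ cc D k a) :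
    (BM fun a => F a * W χ cc D' k a) ∧
    ∫ a, F a * W χ cc D' k a ∂(Measure.pi fun _ => lam)
      = ∫ a, F a * W χ cc D k a ∂(Measure.pi fun _ => lam) := by
  have e : ∀ a, F a * W χ cc D' k a = (F a * W χ cc D k a) * W χ cc (D' \ D) k a := by
    intro a
    rw [mul_assoc, ← W_union Finset.disjoint_sdiff, Finset.union_sdiff_of_subset h]
  simp_rw [e]
  refine ⟨hF.mul (W_bm hχ hc _ k), ?_⟩
  rw [integral_indep (fun _ => lam) D (D' \ D) Finset.disjoint_sdiff hF (W_bm hχ hc _ k) ?_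
    (W_dep _ k), integral_W hχ hc lam hσ, mul_one]
  intro a b hab
  simp only [dF a b hab, W_dep D k a b hab]

lemma margL (hχ : Chars κ ι χ) (hc : ∀ j, OddFn σ (cc j))
    (lam : Measure α) [IsProbabilityMeasure lam] (hσ : MeasurePreserving σ lam lam) {D D' : Finset ι} (h : D ⊆ D') {F : (ι → α) → ℝ} (dF : Dep D F) (w : κ → ℝ)
    (hm : Measurable F) (hF : ∃ C, ∀ a, |F a * LL χ cc 1 D a| ≤ C) :
    (BM fun a => F a * LL χ cc w D' a) ∧
    ∫ a, F a * LL χ cc w D' a ∂(Measure.pi fun _ => lam)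
      = ∫ a, F a * LL χ cc w D a ∂(Measure.pi fun _ => lam) := by
  obtain ⟨C, hC⟩ := hF
  have hk : ∀ k, BM fun a => F a * W χ cc D k a := by
    intro k
    refine ⟨hm.mul (W_bm hχ hc D k).1, Fintype.card κ * C, fun a => ?_⟩
    rw [abs_mul, abs_of_nonneg (W_nonneg hχ hc D k a)]
    calc |F a| * W χ cc D k a ≤ |F a| * (Fintype.card κ * LL χ cc 1 D a) :=
          mul_le_mul_of_nonneg_left (W_le hχ hc D k a) (abs_nonneg _)
      _ = Fintype.card κ * |F a * LL χ cc 1 D a| := by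
          rw [abs_mul, abs_of_nonneg (LL_nonneg hχ hc D a)]; ring
      _ ≤ _ := mul_le_mul_of_nonneg_left (hC a) card_pos'.le
  have e : ∀ E a, F a * LL χ cc w E a
      = (Fintype.card κ : ℝ)⁻¹ * ∑ k, w k * (F a * W χ cc E k a) := by
    intro E a
    unfold LL
    rw [mul_left_comm, Finset.mul_sum]
    congr 1
    exact Finset.sum_congr rfl fun k _ => by ring
  simp_rw [e]
  have m := fun k => marg hχ hc lam hσ h dF k (hk k)
  refine ⟨(BM.const _).mul (BM.sum _ fun k _ => (BM.const (w k)).mul (m k).1), ?_⟩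
  rw [integral_const_mul, integral_const_mul, integral_finsetSum, integral_finsetSum]
  · simp_rw [integral_const_mul, (m _).2]
  · intro k _; exact ((hk k).integrable _).const_mul _
  · intro k _; exact ((m k).1.integrable _).const_mul _

lemma margB (hχ : Chars κ ι χ) (hc : ∀ j, OddFn σ (cc j))
    (lam : Measure α) [IsProbabilityMeasure lam] (hσ : MeasurePreserving σ lam lam) {D D' : Finset ι} (h : D ⊆ D') {F : (ι → α) → ℝ} (dF : Dep D F) (w : κ → ℝ)
    (hF : BM F) :
    ∫ a, F a * LL χ cc w D' a ∂(Measure.pi fun _ => lam)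
      = ∫ a, F a * LL χ cc w D a ∂(Measure.pi fun _ => lam) :=
  (margL hχ hc lam hσ h dF w hF.1 (hF.mul (LL_bm hχ hc 1 D)).2).2

lemma integral_LL (hχ : Chars κ ι χ) (hc : ∀ j, OddFn σ (cc j))
    (lam : Measure α) [IsProbabilityMeasure lam] (hσ : MeasurePreserving σ lam lam) (D : Finset ι) : ∫ a, LL χ cc 1 D a ∂(Measure.pi fun _ => lam) = 1 := by
  unfold LL
  rw [integral_const_mul, integral_finsetSum _ fun k _ =>
    ((BM.const _).mul (W_bm hχ hc D k)).integrable _]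
  simp [integral_W hχ hc lam hσ]

/-- the (negative) entropy functional -/
def KK (χ : κ → ι → ℝ) (cc : ι → α → ℝ) (lam : Measure α) (D : Finset ι) : ℝ :=
  ∫ a, eta (LL χ cc 1 D a) ∂(Measure.pi fun _ => lam)

lemma eta_ge {t s : ℝ} (ht : 0 ≤ t) (hs : 0 < s) : t * Real.log s + t - s ≤ eta t := by
  unfold eta
  rcases ht.eq_or_lt with rfl | ht
  · simp [hs.le]
  have := Real.log_le_sub_one_of_pos (div_pos hs ht)
  rw [Real.log_div hs.ne' ht.ne'] at this
  have h2 := mul_le_mul_of_nonneg_left this ht.le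
  have : t * (s / t - 1) = s - t := by field_simp
  linarith

lemma LL_zero_of (hχ : Chars κ ι χ) (hc : ∀ j, OddFn σ (cc j)) {D D' : Finset ι} (h : D ⊆ D') {a : ι → α} (h0 : LL χ cc 1 D a = 0) :
    LL χ cc 1 D' a = 0 := by
  have : ∀ k, W χ cc D' k a = 0 := by
    intro k
    rw [← Finset.union_sdiff_of_subset h, W_union Finset.disjoint_sdiff]
    have h1 := W_le hχ hc D k a
    rw [h0, mul_zero] at h1
    rw [le_antisymm h1 (W_nonneg hχ hc D k a), zero_mul]
  simp [LL, this]

lemma logL (hχ : Chars κ ι χ) (hc : ∀ j, OddFn σ (cc j))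
    (lam : Measure α) [IsProbabilityMeasure lam] (hσ : MeasurePreserving σ lam lam) (D : Finset ι) :
    (BM fun a => Real.log (LL χ cc 1 D a) * LL χ cc 1 Finset.univ a) ∧
    ∫ a, Real.log (LL χ cc 1 D a) * LL χ cc 1 Finset.univ a ∂(Measure.pi fun _ => lam)
      = KK χ cc lam D := by
  have := margL hχ hc lam hσ (Finset.subset_univ D) (F := fun a => Real.log (LL χ cc 1 D a))
    (fun a b hab => by simp only [LL_dep 1 D a b hab]) 1
    (Real.measurable_log.comp (LL_bm hχ hc 1 D).1)
    (by
      obtain ⟨C, hC⟩ := ((LL_bm hχ hc 1 D).cont eta_cont).2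
      exact ⟨C, fun a => by rw [mul_comm]; exact hC a⟩)
  refine ⟨this.1, this.2.trans ?_⟩
  unfold KK eta
  congr 1; ext a; ring

lemma KK_super (hχ : Chars κ ι χ) (hc : ∀ j, OddFn σ (cc j))
    (lam : Measure α) [IsProbabilityMeasure lam] (hσ : MeasurePreserving σ lam lam) (D : Finset ι) : KK χ cc lam D + KK χ cc lam Dᶜ ≤ KK χ cc lam Finset.univ := by
  obtain ⟨b1, e1⟩ := logL hχ hc lam hσ D
  obtain ⟨b2, e2⟩ := logL hχ hc lam hσ Dᶜ
  have bL := LL_bm (cc := cc) hχ hc 1 Finset.univ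
  have b3 := (LL_bm hχ hc 1 D).mul (LL_bm hχ hc 1 Dᶜ)
  have e3 : ∫ a, LL χ cc 1 D a * LL χ cc 1 Dᶜ a ∂(Measure.pi fun _ => lam) = 1 := by
    rw [integral_indep (fun _ => lam) D Dᶜ disjoint_compl_right (LL_bm hχ hc 1 D)
      (LL_bm hχ hc 1 Dᶜ) (LL_dep 1 D) (LL_dep 1 Dᶜ), integral_LL hχ hc lam hσ,
      integral_LL hχ hc lam hσ, mul_one]
  have key : ∫ a, (((Real.log (LL χ cc 1 D a) * LL χ cc 1 Finset.univ a
      + Real.log (LL χ cc 1 Dᶜ a) * LL χ cc 1 Finset.univ a) + LL χ cc 1 Finset.univ a)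
      - LL χ cc 1 D a * LL χ cc 1 Dᶜ a) ∂(Measure.pi fun _ => lam)
      ≤ KK χ cc lam Finset.univ := by
    refine integral_mono ((((b1.add b2).add bL).sub b3).integrable _)
      ((bL.cont eta_cont).integrable _) fun a => ?_
    have n1 := LL_nonneg hχ hc D a
    have n2 := LL_nonneg hχ hc Dᶜ a
    have n3 := LL_nonneg hχ hc Finset.univ a
    simp only
    rcases n1.eq_or_lt with h1 | h1
    · rw [LL_zero_of hχ hc (Finset.subset_univ D) h1.symm, ← h1]; simp [eta]
    rcases n2.eq_or_lt with h2 | h2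
    · rw [LL_zero_of hχ hc (Finset.subset_univ Dᶜ) h2.symm, ← h2]; simp [eta]
    have := eta_ge n3 (mul_pos h1 h2)
    rw [Real.log_mul h1.ne' h2.ne'] at this
    linarith
  rw [integral_sub (((b1.add b2).add bL).integrable _) (b3.integrable _),
    integral_add ((b1.add b2).integrable _) (bL.integrable _),
    integral_add (b1.integrable _) (b2.integrable _), e1, e2, e3, integral_LL hχ hc lam hσ] at key
  linarith

lemma KK_nonneg (hχ : Chars κ ι χ) (hc : ∀ j, OddFn σ (cc j))
    (lam : Measure α) [IsProbabilityMeasure lam] (hσ : MeasurePreserving σ lam lam) (D : Finset ι) : 0 ≤ KK χ cc lam D := by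
  have bL := LL_bm (cc := cc) hχ hc 1 D
  have key : ∫ a, (LL χ cc 1 D a - 1) ∂(Measure.pi fun _ => lam) ≤ KK χ cc lam D := by
    refine integral_mono ((bL.sub (BM.const 1)).integrable _)
      ((bL.cont eta_cont).integrable _) fun a => ?_
    have := eta_ge (LL_nonneg hχ hc D a) one_pos
    simpa using this
  rw [integral_sub (bL.integrable _) (integrable_const _), integral_LL hχ hc lam hσ] at key
  simpa using key

end core
end
end RMP

namespace RMP
set_option linter.unusedSectionVars false
set_option linter.unusedVariables false
noncomputable section

lemma abs_div_le_one {n d : ℝ} (h : |n| ≤ d) : |n / d| ≤ 1 := by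
  have hd : 0 ≤ d := (abs_nonneg _).trans h
  rw [abs_div, abs_of_nonneg hd]
  exact div_le_one_of_le₀ h hd

lemma div_mul_self' {n d : ℝ} (h : |n| ≤ d) : n / d * d = n := by
  by_cases h0 : d = 0
  · subst h0
    have : n = 0 := by simpa using h
    simp [this]
  · exact div_mul_cancel₀ n h0

lemma jensen {β : Type*} [MeasurableSpace β] (μ : Measure β) [IsProbabilityMeasure μ]
    {d n : β → ℝ} (hd : BM d) (hn : BM n) (h : ∀ b, |n b| ≤ d b) {Φ : ℝ → ℝ}
    (hΦ : ConcaveOn ℝ (Set.Icc (-1) 1) Φ) (hcont : Continuous Φ) :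
    ∫ b, Φ (n b / d b) * d b ∂μ ≤ Φ ((∫ b, n b ∂μ) / ∫ b, d b ∂μ) * ∫ b, d b ∂μ := by
  have d0 : ∀ b, 0 ≤ d b := fun b => (abs_nonneg _).trans (h b)
  have fbm : BM fun b => n b / d b := ⟨hn.1.div hd.1, 1, fun b => abs_div_le_one (h b)⟩
  set ν := μ.withDensity fun b => ENNReal.ofReal (d b) with hν
  have hIntg : ∀ g : β → ℝ, ∫ b, g b ∂ν = ∫ b, g b * d b ∂μ := by
    intro g
    rw [hν, integral_withDensity_eq_integral_toReal_smul hd.1.ennreal_ofReal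
      (Filter.Eventually.of_forall fun b => ENNReal.ofReal_lt_top)]
    congr 1; ext b
    rw [ENNReal.toReal_ofReal (d0 b), smul_eq_mul, mul_comm]
  have hfin : IsFiniteMeasure ν := by
    refine isFiniteMeasure_withDensity_ofReal ?_
    exact (hd.integrable μ).2
  have huniv : ν.real Set.univ = ∫ b, d b ∂μ := by
    have := hIntg (fun _ => 1)
    simpa using this
  rcases (integral_nonneg d0 : 0 ≤ ∫ b, d b ∂μ).eq_or_lt with hz | hz
  · rw [← hz, mul_zero]
    have : d =ᵐ[μ] 0 := (integral_eq_zero_iff_of_nonneg d0 (hd.integrable μ)).mp hz.symm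
    refine (integral_eq_zero_of_ae ?_).le
    filter_upwards [this] with b hb
    simp [hb]
  have hne : NeZero ν := ⟨fun h0 => by rw [h0] at huniv; simp at huniv; linarith⟩
  have J := hΦ.le_map_average (μ := ν) hcont.continuousOn isClosed_Icc (f := fun b => n b / d b)
    (Filter.Eventually.of_forall fun b => abs_le.mp (abs_div_le_one (h b)))
    (fbm.integrable ν) ((fbm.cont hcont).integrable ν)
  rw [average_eq, average_eq, huniv, smul_eq_mul, smul_eq_mul] at J
  rw [hIntg, hIntg] at J
  simp_rw [div_mul_self' (h _)] at J
  rw [inv_mul_eq_div, inv_mul_eq_div, div_le_iff₀ hz] at J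
  exact J

lemma cont_bar {α : Type*} [MeasurableSpace α] (lam : Measure α) [IsProbabilityMeasure lam]
    {c : α → ℝ} (hc : BM c) {G : ℝ → ℝ} (hG : Continuous G) :
    Continuous fun f => ∫ p, G (c p * f) ∂lam := by
  rw [continuous_iff_continuousAt]
  intro x
  obtain ⟨hm, C, hC⟩ := hc
  obtain ⟨B, hB⟩ := (isCompact_Icc (a := -(C * (|x| + 1))) (b := C * (|x| + 1))).exists_bound_of_continuousOn
    hG.continuousOn
  refine continuousAt_of_dominated (bound := fun _ => B) ?_ ?_ (integrable_const _) ?_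
  · exact Filter.Eventually.of_forall fun f =>
      (hG.measurable.comp (hm.mul_const f)).aestronglyMeasurable
  · have : Metric.ball x 1 ∈ nhds x := Metric.ball_mem_nhds x one_pos
    filter_upwards [this] with f hf
    refine Filter.Eventually.of_forall fun p => hB _ ?_
    rw [Set.mem_Icc, ← abs_le, abs_mul]
    have h1 : |f| ≤ |x| + 1 := by
      rw [Metric.mem_ball, Real.dist_eq] at hf
      have := abs_sub_abs_le_abs_sub f x
      linarith
    exact mul_le_mul (hC p) h1 (abs_nonneg _) ((abs_nonneg _).trans (hC p))
  · exact Filter.Eventually.of_forall fun p => by fun_prop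

section bar
variable {α : Type*} [MeasurableSpace α] (lam : Measure α) (c : α → ℝ)

/-- average of `phi` over the channel -/
def phibar (f : ℝ) : ℝ := ∫ p, phi (c p) f ∂lam

def H0 : ℝ := ∫ p, (Real.log 2 - EE (c p)) ∂lam

def q1 : ℝ := ∫ p, c p ^ 2 ∂lam

variable [IsProbabilityMeasure lam] {c}

lemma phibar_eq (hc : BM c) (f : ℝ) :
    phibar lam c f = H0 lam c - EE f + ∫ p, EE (c p * f) ∂lam := by
  unfold phibar H0 phi
  have b1 : BM fun p => Real.log 2 - EE (c p) := (BM.const _).sub (hc.cont EE_cont)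
  have b2 : BM fun p => EE (c p * f) := (hc.mul (BM.const f)).cont EE_cont
  rw [integral_add ((b1.sub (BM.const _)).integrable _) (b2.integrable _),
    integral_sub (b1.integrable _) (integrable_const _)]
  simp

lemma phibar_cont (hc : BM c) : Continuous (phibar lam c) := by
  have : phibar lam c = fun f => H0 lam c - EE f + ∫ p, EE (c p * f) ∂lam :=
    funext (phibar_eq lam hc)
  rw [this]
  exact (continuous_const.sub EE_cont).add (cont_bar lam hc EE_cont)

lemma phi_bm (hc : BM c) (f : ℝ) : BM fun p => phi (c p) f := by
  unfold phi
  exact (((BM.const _).sub (hc.cont EE_cont)).sub (BM.const _)).add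
    ((hc.mul (BM.const f)).cont EE_cont)

lemma phibar_concave (hc : BM c) (h1 : ∀ p, |c p| ≤ 1) :
    ConcaveOn ℝ (Set.Icc (-1) 1) (fun f => phibar lam c f + (1 - q1 lam c) / 2 * f ^ 2) := by
  have b : ∀ f, BM fun p => phi (c p) f + (1 - c p ^ 2) / 2 * f ^ 2 := by
    intro f
    simp_rw [div_eq_mul_inv]
    exact (phi_bm hc f).add ((((BM.const 1).sub (hc.pow 2)).mul (BM.const _)).mul (BM.const _))
  have e : ∀ f, phibar lam c f + (1 - q1 lam c) / 2 * f ^ 2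
      = ∫ p, (phi (c p) f + (1 - c p ^ 2) / 2 * f ^ 2) ∂lam := by
    intro f
    have b2 : BM fun p => (1 - c p ^ 2) / 2 * f ^ 2 := by
      simp_rw [div_eq_mul_inv]
      exact ((((BM.const 1).sub (hc.pow 2)).mul (BM.const _)).mul (BM.const _))
    rw [integral_add ((phi_bm hc f).integrable _) (b2.integrable _), integral_mul_const,
      integral_div, integral_sub (integrable_const _) ((hc.pow 2).integrable _)]
    simp [phibar, q1]
  simp_rw [e]
  refine ⟨convex_Icc _ _, fun x hx y hy s t hs ht hst => ?_⟩
  simp only [smul_eq_mul]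
  rw [← integral_const_mul, ← integral_const_mul,
    ← integral_add (((b x).integrable _).const_mul _) (((b y).integrable _).const_mul _)]
  refine integral_mono (((BM.const s).mul (b x)).add ((BM.const t).mul (b y)) |>.integrable _)
    ((b _).integrable _) fun p => ?_
  exact (phi_concave (h1 p)).2 hx hy hs ht hst

end bar

section core
variable {ι α κ : Type*} [Fintype ι] [DecidableEq ι] [MeasurableSpace α]
  [AddCommGroup κ] [Fintype κ]
variable (χ : κ → ι → ℝ) (cc : ι → α → ℝ)

/-- estimate of bit `i` from the observations in `D` -/
def ff (i : ι) (D : Finset ι) (a : ι → α) : ℝ :=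
  LL χ cc (fun k => χ k i) D a / LL χ cc 1 D a

def qq (lam : Measure α) (i : ι) (D : Finset ι) : ℝ :=
  ∫ a, ff χ cc i D a ^ 2 * LL χ cc 1 D a ∂(Measure.pi fun _ => lam)

variable {χ cc}
variable {σ : α → α}

lemma LL_chi_le (hχ : Chars κ ι χ) (hc : ∀ j, OddFn σ (cc j)) (i : ι) (D : Finset ι) (a : ι → α) :
    |LL χ cc (fun k => χ k i) D a| ≤ LL χ cc 1 D a :=
  LL_abs_le hχ hc (fun k => (hχ.abs k i).le) D a

lemma ff_le (hχ : Chars κ ι χ) (hc : ∀ j, OddFn σ (cc j)) (i : ι) (D : Finset ι) (a : ι → α) :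
    |ff χ cc i D a| ≤ 1 := abs_div_le_one (LL_chi_le hχ hc i D a)

lemma ff_mul (hχ : Chars κ ι χ) (hc : ∀ j, OddFn σ (cc j)) (i : ι) (D : Finset ι) (a : ι → α) :
    ff χ cc i D a * LL χ cc 1 D a = LL χ cc (fun k => χ k i) D a :=
  div_mul_self' (LL_chi_le hχ hc i D a)

lemma ff_bm (hχ : Chars κ ι χ) (hc : ∀ j, OddFn σ (cc j)) (i : ι) (D : Finset ι) :
    BM (ff χ cc i D) :=
  ⟨(LL_bm hχ hc _ D).1.div (LL_bm hχ hc 1 D).1, 1, ff_le hχ hc i D⟩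

lemma ff_dep (i : ι) (D : Finset ι) : Dep D (ff χ cc i D) := by
  intro a b hab
  unfold ff
  rw [LL_dep _ D a b hab, LL_dep _ D a b hab]

lemma integral_LL_pw (hχ : Chars κ ι χ) (hc : ∀ j, OddFn σ (cc j))
    (lam : Measure α) [IsProbabilityMeasure lam] (hσ : MeasurePreserving σ lam lam)
    {D D' : Finset ι} (h : D ⊆ D') (w : κ → ℝ) (a : ι → α) :
    ∫ b, LL χ cc w D' (D.piecewise a b) ∂(Measure.pi fun _ => lam) = LL χ cc w D a := by
  have e : ∀ k b, W χ cc D' k (D.piecewise a b) = W χ cc D k a * W χ cc (D' \ D) k b := by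
    intro k b
    rw [← Finset.union_sdiff_of_subset h, W_union Finset.disjoint_sdiff,
      Finset.union_sdiff_of_subset h]
    congr 1
    · exact W_dep D k _ _ fun j hj => by simp [hj]
    · refine W_dep _ k _ _ fun j hj => ?_
      have := (Finset.mem_sdiff.mp hj).2
      simp [this]
  unfold LL
  simp_rw [e]
  rw [integral_const_mul, integral_finsetSum]
  · simp_rw [integral_const_mul, integral_W hχ hc lam hσ, mul_one]
  · intro k _
    exact (((W_bm hχ hc (D' \ D) k).integrable _).const_mul _).const_mul _

lemma measurable_pw_right (D : Finset ι) (a : ι → α) :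
    Measurable fun b : ι → α => D.piecewise a b :=
  (measurable_pw D).comp ((measurable_const (a := a)).prodMk measurable_id)

lemma jensenL (hχ : Chars κ ι χ) (hc : ∀ j, OddFn σ (cc j))
    (lam : Measure α) [IsProbabilityMeasure lam] (hσ : MeasurePreserving σ lam lam)
    {D D' : Finset ι} (h : D ⊆ D') (i : ι) {Φ : ℝ → ℝ}
    (hΦ : ConcaveOn ℝ (Set.Icc (-1) 1) Φ) (hcont : Continuous Φ) :
    ∫ a, Φ (ff χ cc i D' a) * LL χ cc 1 D' a ∂(Measure.pi fun _ => lam)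
      ≤ ∫ a, Φ (ff χ cc i D a) * LL χ cc 1 D a ∂(Measure.pi fun _ => lam) := by
  have b1 : BM fun a => Φ (ff χ cc i D' a) * LL χ cc 1 D' a :=
    ((ff_bm hχ hc i D').cont hcont).mul (LL_bm hχ hc 1 D')
  have b2 : BM fun a => Φ (ff χ cc i D a) * LL χ cc 1 D a :=
    ((ff_bm hχ hc i D).cont hcont).mul (LL_bm hχ hc 1 D)
  rw [integral_pw (fun _ => lam) D b1]
  refine integral_mono ((b1.Q (fun _ => lam) D).integrable _) (b2.integrable _) fun a => ?_
  have hm := measurable_pw_right D a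
  have := jensen (Measure.pi fun _ : ι => lam) ((LL_bm hχ hc 1 D').comp hm)
    ((LL_bm hχ hc (fun k => χ k i) D').comp hm)
    (fun b => LL_chi_le hχ hc i D' (D.piecewise a b)) hΦ hcont
  rw [integral_LL_pw hχ hc lam hσ h, integral_LL_pw hχ hc lam hσ h] at this
  exact this

/-- conditional entropy of bit `i` given its channel output and the observations in `D` -/
def gg (χ : κ → ι → ℝ) (cc : ι → α → ℝ) (lam : Measure α) (c0 : α → ℝ) (i : ι) (D : Finset ι) : ℝ :=
  ∫ a, phibar lam c0 (ff χ cc i D a) * LL χ cc 1 D a ∂(Measure.pi fun _ => lam)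

lemma gg_sub (hχ : Chars κ ι χ) (hc : ∀ j, OddFn σ (cc j))
    (lam : Measure α) [IsProbabilityMeasure lam] (hσ : MeasurePreserving σ lam lam)
    {c0 : α → ℝ} (h0 : OddFn σ c0) {D D' : Finset ι} (h : D ⊆ D') (i : ι) :
    (1 - q1 lam c0) / 2 * (qq χ cc lam i D' - qq χ cc lam i D)
      ≤ gg χ cc lam c0 i D - gg χ cc lam c0 i D' := by
  have J := jensenL hχ hc lam hσ h i (phibar_concave lam h0.bm h0.le)
    ((phibar_cont lam h0.bm).add (by fun_prop))
  have e : ∀ E, ∫ a, (phibar lam c0 (ff χ cc i E a) + (1 - q1 lam c0) / 2 * (ff χ cc i E a) ^ 2)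
      * LL χ cc 1 E a ∂(Measure.pi fun _ => lam)
      = gg χ cc lam c0 i E + (1 - q1 lam c0) / 2 * qq χ cc lam i E := by
    intro E
    unfold gg qq
    rw [← integral_const_mul, ← integral_add]
    · congr 1; ext a; ring
    · exact (((ff_bm hχ hc i E).cont (phibar_cont lam h0.bm)).mul (LL_bm hχ hc 1 E)).integrable _
    · exact ((((ff_bm hχ hc i E).pow 2).mul (LL_bm hχ hc 1 E)).integrable _).const_mul _
  rw [e, e] at J
  linarith

end core
end
end RMP

namespace RMP
set_option linter.unusedSectionVars false
set_option linter.unusedVariables false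
noncomputable section

section core
variable {ι α κ : Type*} [Fintype ι] [DecidableEq ι] [MeasurableSpace α]
  [AddCommGroup κ] [Fintype κ]
variable {χ : κ → ι → ℝ} {cc : ι → α → ℝ}
variable {σ : α → α}

/-- the twist by the codeword `k` -/
def tw (χ : κ → ι → ℝ) (σ : α → α) (k : κ) (a : ι → α) : ι → α := fun j =>
  open Classical in (if χ k j = 1 then id else σ) (a j)

lemma tw_mp (lam : Measure α) [IsProbabilityMeasure lam] (hσ : MeasurePreserving σ lam lam)
    (k : κ) : MeasurePreserving (tw χ σ k) (Measure.pi fun _ : ι => lam)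
      (Measure.pi fun _ : ι => lam) := by
  classical
  refine measurePreserving_pi _ _ fun j => ?_
  split_ifs
  · exact MeasurePreserving.id lam
  · exact hσ

lemma cc_tw (hχ : Chars κ ι χ) (hc : ∀ j, OddFn σ (cc j)) (k : κ) (a : ι → α) (j : ι) :
    cc j (tw χ σ k a j) = χ k j * cc j (a j) := by
  unfold tw
  rcases hχ.cases k j with h | h
  · simp [h]
  · have : ¬ ((-1 : ℝ) = 1) := by norm_num
    simp [h, this, (hc j).odd]

lemma W_tw (hχ : Chars κ ι χ) (hc : ∀ j, OddFn σ (cc j)) (D : Finset ι) (k k' : κ) (a : ι → α) :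
    W χ cc D k' (tw χ σ k a) = W χ cc D (k' + k) a := by
  unfold W
  refine Finset.prod_congr rfl fun j _ => ?_
  rw [cc_tw hχ hc, hχ.add, mul_assoc]

lemma LL_tw (hχ : Chars κ ι χ) (hc : ∀ j, OddFn σ (cc j)) (D : Finset ι) (k : κ) (a : ι → α) :
    LL χ cc 1 D (tw χ σ k a) = LL χ cc 1 D a := by
  unfold LL
  simp_rw [W_tw hχ hc]
  congr 1
  exact Fintype.sum_equiv (Equiv.addRight k) _ _ fun k' => by simp

lemma LL_tw_chi (hχ : Chars κ ι χ) (hc : ∀ j, OddFn σ (cc j)) (i : ι) (D : Finset ι) (k : κ)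
    (a : ι → α) :
    LL χ cc (fun k => χ k i) D (tw χ σ k a) = χ k i * LL χ cc (fun k => χ k i) D a := by
  unfold LL
  simp_rw [W_tw hχ hc]
  rw [mul_left_comm, Finset.mul_sum (a := χ k i)]
  congr 1
  refine Fintype.sum_equiv (Equiv.addRight k) _ _ fun k' => ?_
  simp only [Equiv.coe_addRight, hχ.add]
  have := hχ.sq k i
  linear_combination (- χ k' i * W χ cc D (k' + k) a) * this

lemma ff_tw (hχ : Chars κ ι χ) (hc : ∀ j, OddFn σ (cc j)) (i : ι) (D : Finset ι) (k : κ)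
    (a : ι → α) : ff χ cc i D (tw χ σ k a) = χ k i * ff χ cc i D a := by
  unfold ff
  rw [LL_tw hχ hc, LL_tw_chi hχ hc, mul_div_assoc]

lemma tw_avg (hχ : Chars κ ι χ) (hc : ∀ j, OddFn σ (cc j))
    (lam : Measure α) [IsProbabilityMeasure lam] (hσ : MeasurePreserving σ lam lam)
    (w : κ → ℝ) {F : (ι → α) → ℝ} (hF : BM F) (hw : ∀ k a, F (tw χ σ k a) = w k * F a)
    (D : Finset ι) :
    ∫ a, F a * W χ cc D 0 a ∂(Measure.pi fun _ => lam)
      = ∫ a, F a * LL χ cc w D a ∂(Measure.pi fun _ => lam) := by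
  have h : ∀ k, ∫ a, F a * W χ cc D 0 a ∂(Measure.pi fun _ => lam)
      = ∫ a, w k * (F a * W χ cc D k a) ∂(Measure.pi fun _ => lam) := by
    intro k
    have mp := tw_mp (χ := χ) lam hσ k
    conv_lhs => rw [← mp.map_eq]
    rw [integral_map mp.measurable.aemeasurable
      (hF.mul (W_bm hχ hc D 0)).1.aestronglyMeasurable]
    simp_rw [hw, W_tw hχ hc, zero_add, mul_assoc]
  have e : ∀ a, F a * LL χ cc w D a
      = (Fintype.card κ : ℝ)⁻¹ * ∑ k, w k * (F a * W χ cc D k a) := by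
    intro a
    unfold LL
    rw [mul_left_comm, Finset.mul_sum]
    congr 1
    exact Finset.sum_congr rfl fun k _ => by ring
  simp_rw [e]
  rw [integral_const_mul, integral_finsetSum]
  · simp_rw [← h]
    rw [Finset.sum_const, Finset.card_univ, nsmul_eq_mul, ← mul_assoc,
      inv_mul_cancel₀ card_pos'.ne', one_mul]
  · intro k _
    exact ((hF.mul (W_bm hχ hc D k)).integrable _).const_mul _

/-- the noise law given the all-one codeword -/
def Pp (cc : ι → α → ℝ) (lam : Measure α) (j : ι) : Measure α :=
  lam.withDensity fun p => ENNReal.ofReal (1 + cc j p)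

lemma one_add_nonneg (hc : ∀ j, OddFn σ (cc j)) (j : ι) (p : α) : 0 ≤ 1 + cc j p := by
  have := (abs_le.mp ((hc j).le p)).1
  linarith

lemma Pp_prob (hc : ∀ j, OddFn σ (cc j))
    (lam : Measure α) [IsProbabilityMeasure lam] (hσ : MeasurePreserving σ lam lam) (j : ι) :
    IsProbabilityMeasure (Pp cc lam j) := by
  constructor
  unfold Pp
  rw [withDensity_apply _ MeasurableSet.univ, Measure.restrict_univ,
    ← ofReal_integral_eq_lintegral_ofReal
      (((BM.const 1).add (hc j).bm).integrable lam)
      (Filter.Eventually.of_forall (one_add_nonneg hc j)),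
    integral_add (integrable_const _) ((hc j).bm.integrable _), integral_odd hc lam hσ]
  simp

lemma pi_Pp (hc : ∀ j, OddFn σ (cc j))
    (lam : Measure α) [IsProbabilityMeasure lam] (hσ : MeasurePreserving σ lam lam) :
    Measure.pi (Pp cc lam) = (Measure.pi fun _ : ι => lam).withDensity
      fun a => ENNReal.ofReal (∏ j, (1 + cc j (a j))) := by
  have := Pp_prob hc lam hσ
  refine Measure.pi_eq fun t ht => ?_
  rw [withDensity_apply _ (MeasurableSet.univ_pi ht), ← lintegral_indicator (MeasurableSet.univ_pi ht)]
  have e : ∀ a : ι → α, (Set.univ.pi t).indicator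
      (fun a => ENNReal.ofReal (∏ j, (1 + cc j (a j)))) a
      = ENNReal.ofReal (∏ j, (t j).indicator (fun p => 1 + cc j p) (a j)) := by
    intro a
    by_cases h : a ∈ Set.univ.pi t
    · rw [Set.indicator_of_mem h]
      congr 1
      refine Finset.prod_congr rfl fun j _ => ?_
      rw [Set.indicator_of_mem (h j trivial)]
    · rw [Set.indicator_of_notMem h]
      have : ∃ j, a j ∉ t j := by
        by_contra hh
        push Not at hh
        exact h fun j _ => hh j
      obtain ⟨j, hj⟩ := this
      rw [Finset.prod_eq_zero (Finset.mem_univ j) (Set.indicator_of_notMem hj _)]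
      simp
  simp_rw [e]
  have ib : ∀ j, BM ((t j).indicator (fun p => 1 + cc j p)) := fun j =>
    ⟨((BM.const 1).add (hc j).bm).1.indicator (ht j), 2, fun p => by
      have := abs_le.mp ((hc j).le p)
      by_cases h : p ∈ t j
      · rw [Set.indicator_of_mem h, abs_le]; constructor <;> linarith
      · rw [Set.indicator_of_notMem h]; norm_num⟩
  have inn : ∀ j p, 0 ≤ (t j).indicator (fun p => 1 + cc j p) p := fun j p =>
    Set.indicator_nonneg (fun p _ => one_add_nonneg hc j p) p
  rw [← ofReal_integral_eq_lintegral_ofReal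
    ((BM.prod Finset.univ fun j _ => (ib j).comp (measurable_pi_apply j)).integrable _)
    (Filter.Eventually.of_forall fun a => Finset.prod_nonneg fun j _ => inn j _),
    integral_fintype_prod_eq_prod (f := fun j p => (t j).indicator (fun p => 1 + cc j p) p),
    ENNReal.ofReal_prod_of_nonneg fun j _ => integral_nonneg (inn j)]
  refine Finset.prod_congr rfl fun j _ => ?_
  unfold Pp
  rw [withDensity_apply _ (ht j), ofReal_integral_eq_lintegral_ofReal ((ib j).integrable _)
    (Filter.Eventually.of_forall (inn j)), ← lintegral_indicator (ht j)]
  congr 1; ext p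
  by_cases h : p ∈ t j
  · simp [h]
  · simp [h]

lemma integral_Pp (hχ : Chars κ ι χ) (hc : ∀ j, OddFn σ (cc j))
    (lam : Measure α) [IsProbabilityMeasure lam] (hσ : MeasurePreserving σ lam lam)
    (F : (ι → α) → ℝ) :
    ∫ a, F a ∂(Measure.pi (Pp cc lam))
      = ∫ a, F a * W χ cc Finset.univ 0 a ∂(Measure.pi fun _ : ι => lam) := by
  have e : ∀ a : ι → α, ∏ j, (1 + cc j (a j)) = W χ cc Finset.univ 0 a := by
    intro a
    unfold W
    simp_rw [hχ.zero, one_mul]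
  rw [pi_Pp hc lam hσ, integral_withDensity_eq_integral_toReal_smul]
  · congr 1; ext a
    rw [e, ENNReal.toReal_ofReal (W_nonneg hχ hc _ _ _), smul_eq_mul, mul_comm]
  · simp_rw [e]
    exact (W_bm hχ hc _ _).1.ennreal_ofReal
  · exact Filter.Eventually.of_forall fun a => ENNReal.ofReal_lt_top

/-- even functions -/
lemma integral_Pp_even (hχ : Chars κ ι χ) (hc : ∀ j, OddFn σ (cc j))
    (lam : Measure α) [IsProbabilityMeasure lam] (hσ : MeasurePreserving σ lam lam)
    {F : (ι → α) → ℝ} (hF : BM F) (hw : ∀ k a, F (tw χ σ k a) = F a) {D : Finset ι} (dF : Dep D F) :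
    ∫ a, F a ∂(Measure.pi (Pp cc lam))
      = ∫ a, F a * LL χ cc 1 D a ∂(Measure.pi fun _ : ι => lam) := by
  rw [integral_Pp hχ hc lam hσ, tw_avg hχ hc lam hσ 1 hF (by simpa using hw),
    margB hχ hc lam hσ (Finset.subset_univ D) dF 1 hF]

lemma integral_Pp_odd (hχ : Chars κ ι χ) (hc : ∀ j, OddFn σ (cc j))
    (lam : Measure α) [IsProbabilityMeasure lam] (hσ : MeasurePreserving σ lam lam) (i : ι)
    {F : (ι → α) → ℝ} (hF : BM F) (hw : ∀ k a, F (tw χ σ k a) = χ k i * F a) {D : Finset ι}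
    (dF : Dep D F) :
    ∫ a, F a ∂(Measure.pi (Pp cc lam))
      = ∫ a, F a * LL χ cc (fun k => χ k i) D a ∂(Measure.pi fun _ : ι => lam) := by
  rw [integral_Pp hχ hc lam hσ, tw_avg hχ hc lam hσ (fun k => χ k i) hF hw,
    margB hχ hc lam hσ (Finset.subset_univ D) dF _ hF]

lemma qq_nonneg (hχ : Chars κ ι χ) (hc : ∀ j, OddFn σ (cc j)) (lam : Measure α) (i : ι)
    (D : Finset ι) : 0 ≤ qq χ cc lam i D :=
  integral_nonneg fun a => mul_nonneg (sq_nonneg _) (LL_nonneg hχ hc D a)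

lemma qq_le_one (hχ : Chars κ ι χ) (hc : ∀ j, OddFn σ (cc j))
    (lam : Measure α) [IsProbabilityMeasure lam] (hσ : MeasurePreserving σ lam lam) (i : ι)
    (D : Finset ι) : qq χ cc lam i D ≤ 1 := by
  rw [← integral_LL hχ hc lam hσ D]
  refine integral_mono ((((ff_bm hχ hc i D).pow 2).mul (LL_bm hχ hc 1 D)).integrable _)
    ((LL_bm hχ hc 1 D).integrable _) fun a => ?_
  have h1 := LL_nonneg hχ hc D a
  have h2 : ff χ cc i D a ^ 2 ≤ 1 := by
    rw [← sq_abs]; exact pow_le_one₀ (abs_nonneg _) (ff_le hχ hc i D a)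
  exact mul_le_of_le_one_left h1 h2

/-- The main Efron-Stein consequence. -/
lemma qq_es (hχ : Chars κ ι χ) (hc : ∀ j, OddFn σ (cc j))
    (lam : Measure α) [IsProbabilityMeasure lam] (hσ : MeasurePreserving σ lam lam) (i : ι)
    {ℒ : Type*} [Fintype ℒ] (D : ℒ → Finset ι)
    (hD : ∀ j, j ≠ i → 2 * (Finset.univ.filter fun l => j ∈ D l).card ≤ Fintype.card ℒ) :
    Fintype.card ℒ * (qq χ cc lam i (Finset.univ.erase i) * (1 - qq χ cc lam i (Finset.univ.erase i)))
      ≤ 2 * ∑ l, (qq χ cc lam i (Finset.univ.erase i) - qq χ cc lam i ((D l).erase i)) := by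
  have hp := Pp_prob hc lam hσ
  set U := Finset.univ.erase i with hU
  set f := ff χ cc i U with hf
  have bf : BM f := ff_bm hχ hc i U
  have ES := efron_stein (Pp cc lam) bf i (ff_dep i U) D hD
  have hsq : ∀ E, ∀ k a, ff χ cc i E (tw χ σ k a) ^ 2 = ff χ cc i E a ^ 2 := by
    intro E k a
    rw [ff_tw hχ hc, mul_pow, pow_two (χ k i), hχ.sq, one_mul]
  have sqdep : ∀ E, Dep E (fun a => ff χ cc i E a ^ 2) := by
    intro E a b hab
    simp only [ff_dep i E a b hab]
  have isq : ∀ E, ∫ a, ff χ cc i E a ^ 2 ∂(Measure.pi (Pp cc lam)) = qq χ cc lam i E := fun E =>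
    integral_Pp_even hχ hc lam hσ ((ff_bm hχ hc i E).pow 2) (hsq E) (sqdep E)
  have V1 : V (Pp cc lam) f Finset.univ = qq χ cc lam i U := by
    rw [← isq U]
    unfold V Q
    simp [hf]
  have V0 : V (Pp cc lam) f ∅ = qq χ cc lam i U ^ 2 := by
    have : ∫ a, f a ∂(Measure.pi (Pp cc lam)) = qq χ cc lam i U := by
      rw [integral_Pp_odd hχ hc lam hσ i bf (ff_tw hχ hc i U) (ff_dep i U)]
      unfold qq
      congr 1; ext a
      rw [← ff_mul hχ hc, hf]; ring
    unfold V Q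
    simp [this]
  have VD : ∀ E : Finset ι, qq χ cc lam i (E.erase i) ≤ V (Pp cc lam) f E := by
    intro E
    set f0 := ff χ cc i (E.erase i) with hf0
    have b0 : BM f0 := ff_bm hχ hc i _
    have hsub : E.erase i ⊆ U := Finset.erase_subset_erase i (Finset.subset_univ E)
    have cross : ∫ a, f a * f0 a ∂(Measure.pi (Pp cc lam)) = qq χ cc lam i (E.erase i) := by
      rw [integral_Pp_even hχ hc lam hσ (bf.mul b0) (D := U)]
      · have e1 : ∀ a, f a * f0 a * LL χ cc 1 U a = f0 a * LL χ cc (fun k => χ k i) U a := by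
          intro a
          rw [← ff_mul hχ hc, hf]; ring
        simp_rw [e1]
        rw [margB hχ hc lam hσ hsub (ff_dep i _) _ b0]
        unfold qq
        congr 1; ext a
        rw [← ff_mul hχ hc]; ring
      · intro k a
        simp only [hf, hf0, ff_tw hχ hc]
        have := hχ.sq k i
        linear_combination (ff χ cc i U a * ff χ cc i (E.erase i) a) * this
      · intro a b hab
        simp only [hf, hf0, ff_dep i U a b hab, (ff_dep i (E.erase i)).mono hsub a b hab]
    have h0 : 0 ≤ ∫ a, (Q (Pp cc lam) E f a - f0 a) ^ 2 ∂(Measure.pi (Pp cc lam)) :=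
      integral_nonneg fun a => sq_nonneg _
    have e : ∀ a, (Q (Pp cc lam) E f a - f0 a) ^ 2
        = (Q (Pp cc lam) E f a ^ 2 - 2 * (Q (Pp cc lam) E f a * f0 a)) + f0 a ^ 2 :=
      fun a => by ring
    simp_rw [e] at h0
    have bQ := bf.Q (Pp cc lam) E
    rw [integral_add ((((bQ.pow 2)).sub ((BM.const 2).mul (bQ.mul b0))).integrable _)
      ((b0.pow 2).integrable _), integral_sub ((bQ.pow 2).integrable _)
      (((BM.const 2).mul (bQ.mul b0)).integrable _), integral_const_mul,
      integral_Q_mul (Pp cc lam) bf b0 E ((ff_dep i _).mono (Finset.erase_subset i E)), cross,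
      isq] at h0
    unfold V
    linarith
  rw [V1, V0] at ES
  have := Finset.sum_le_sum fun l (_ : l ∈ Finset.univ) => VD (D l)
  rw [Finset.sum_sub_distrib, Finset.sum_const, Finset.card_univ, nsmul_eq_mul]
  nlinarith

end core
end
end RMP

namespace RMP
set_option linter.unusedSectionVars false
set_option linter.unusedVariables false
noncomputable section

lemma eta_mul (x y : ℝ) : eta (x * y) = x * eta y + y * eta x := by
  unfold eta
  by_cases hx : x = 0
  · simp [hx]
  by_cases hy : y = 0
  · simp [hy]
  rw [Real.log_mul hx hy]; ring

lemma eta_pair (d t : ℝ) : (eta (d * (1 + t)) + eta (d * (1 - t))) / 2 = EE t * d + eta d := by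
  rw [eta_mul, eta_mul]
  unfold EE
  ring

/-- perspective of the square -/
def Xv (n d : ℝ) : ℝ := (n / d) ^ 2 * d

lemma Xv_convex {s t u v a b : ℝ} (hs : 0 ≤ s) (ht : 0 ≤ t) (hu : |u| ≤ a) (hv : |v| ≤ b) :
    Xv (s * u + t * v) (s * a + t * b) ≤ s * Xv u a + t * Xv v b := by
  have ha : 0 ≤ a := (abs_nonneg _).trans hu
  have hb : 0 ≤ b := (abs_nonneg _).trans hv
  obtain ⟨x, rfl⟩ : ∃ x, u = x * a := ⟨u / a, (div_mul_self' hu).symm⟩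
  obtain ⟨y, rfl⟩ : ∃ y, v = y * b := ⟨v / b, (div_mul_self' hv).symm⟩
  have e : ∀ x a : ℝ, Xv (x * a) a = x ^ 2 * a := by
    intro x a
    unfold Xv
    by_cases h : a = 0
    · simp [h]
    · rw [mul_div_cancel_right₀ _ h]
  rw [e, e]
  have hsum : 0 ≤ s * a + t * b := by positivity
  rcases hsum.eq_or_lt with h | h
  · rw [← h]
    have : 0 ≤ s * (x ^ 2 * a) + t * (y ^ 2 * b) := by positivity
    simpa [Xv] using this
  unfold Xv
  rw [div_pow, pow_two (s * a + t * b), div_mul_eq_mul_div, mul_div_mul_right _ _ h.ne',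
    div_le_iff₀ h]
  have : 0 ≤ s * t * (a * b) * (x - y) ^ 2 := by positivity
  nlinarith

section core
variable {ι α κ : Type*} [Fintype ι] [DecidableEq ι] [MeasurableSpace α]
  [AddCommGroup κ] [Fintype κ]
variable {χ : κ → ι → ℝ} {cc : ι → α → ℝ}
variable {σ : α → α}

lemma LL_congr {cc' : ι → α → ℝ} {D : Finset ι} (h : ∀ j ∈ D, cc j = cc' j) (w : κ → ℝ) :
    LL χ cc w D = LL χ cc' w D := by
  ext a
  unfold LL W
  congr 1
  refine Finset.sum_congr rfl fun k _ => ?_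
  congr 1
  exact Finset.prod_congr rfl fun j hj => by rw [h j hj]

lemma ff_congr {cc' : ι → α → ℝ} {D : Finset ι} (h : ∀ j ∈ D, cc j = cc' j) (i : ι) :
    ff χ cc i D = ff χ cc' i D := by
  ext a; unfold ff; rw [LL_congr h, LL_congr h]

lemma LL_split {D : Finset ι} {i : ι} (hi : i ∈ D) (w : κ → ℝ) (a : ι → α) :
    LL χ cc w D a = LL χ cc w (D.erase i) a
      + cc i (a i) * LL χ cc (fun k => w k * χ k i) (D.erase i) a := by
  unfold LL W
  rw [mul_left_comm, ← mul_add, Finset.mul_sum (a := cc i (a i)), ← Finset.sum_add_distrib]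
  congr 1
  refine Finset.sum_congr rfl fun k _ => ?_
  rw [← Finset.mul_prod_erase D _ hi]
  ring

/-- integrating out a single coordinate -/
lemma integral_one (lam : Measure α) [IsProbabilityMeasure lam] {D : Finset ι} {i : ι} (hi : i ∉ D)
    {G : (ι → α) → α → ℝ} (hG : BM fun a => G a (a i)) (hGm : ∀ a, Measurable (G a))
    (dG : ∀ a b, (∀ j ∈ D, a j = b j) → G a = G b) :
    ∫ a, G a (a i) ∂(Measure.pi fun _ : ι => lam)
      = ∫ a, ∫ p, G a p ∂lam ∂(Measure.pi fun _ : ι => lam) := by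
  rw [integral_pw (fun _ => lam) D hG]
  congr 1; ext a
  have e : ∀ b, G (D.piecewise a b) (D.piecewise a b i) = G a (b i) := by
    intro b
    rw [dG (D.piecewise a b) a fun j hj => by simp [hj]]
    simp [hi]
  simp_rw [e]
  have mp := measurePreserving_eval (fun _ : ι => lam) i
  conv_rhs => rw [← mp.map_eq]
  rw [integral_map mp.measurable.aemeasurable (hGm a).aestronglyMeasurable]

lemma integral_symm (lam : Measure α) [IsProbabilityMeasure lam] (hσ : MeasurePreserving σ lam lam)
    {c : α → ℝ} (hc : OddFn σ c) {g : ℝ → ℝ} (hg : BM fun p => g (c p)) :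
    ∫ p, g (c p) ∂lam = ∫ p, (g (c p) + g (- c p)) / 2 ∂lam := by
  have h := integral_map (μ := lam) hσ.measurable.aemeasurable
    (f := fun p => g (c p)) hg.1.aestronglyMeasurable
  rw [hσ.map_eq] at h
  simp_rw [hc.odd] at h
  have b2 : BM fun p => g (- c p) := by
    have := hg.comp hσ.measurable
    simp_rw [hc.odd] at this
    exact this
  rw [integral_div, integral_add (hg.integrable _) (b2.integrable _), ← h]
  ring

lemma KK_split (hχ : Chars κ ι χ) (hc : ∀ j, OddFn σ (cc j))
    (lam : Measure α) [IsProbabilityMeasure lam] (hσ : MeasurePreserving σ lam lam)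
    {D : Finset ι} {i : ι} (hi : i ∈ D) :
    KK χ cc lam D = KK χ cc lam (D.erase i)
      + ∫ a, (∫ p, EE (cc i p * ff χ cc i (D.erase i) a) ∂lam) * LL χ cc 1 (D.erase i) a
        ∂(Measure.pi fun _ => lam) := by
  set D' := D.erase i with hD'
  have e1 : ∀ a, LL χ cc 1 D a = LL χ cc 1 D' a + cc i (a i) * LL χ cc (fun k => χ k i) D' a := by
    intro a
    rw [LL_split hi]
    simp [hD']
  unfold KK
  simp_rw [e1]
  have hb : BM fun a : ι → α => eta (LL χ cc 1 D' a + cc i (a i) * LL χ cc (fun k => χ k i) D' a) :=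
    ((LL_bm hχ hc 1 D').add (((hc i).bm.comp (measurable_pi_apply i)).mul
      (LL_bm hχ hc _ D'))).cont eta_cont
  have hbp : ∀ a, BM fun p => eta (LL χ cc 1 D' a + cc i p * LL χ cc (fun k => χ k i) D' a) :=
    fun a => ((BM.const _).add ((hc i).bm.mul (BM.const _))).cont eta_cont
  rw [integral_one lam (D := D') (i := i) (by simp [hD'])
    (G := fun a p => eta (LL χ cc 1 D' a + cc i p * LL χ cc (fun k => χ k i) D' a)) hb
    (fun a => (hbp a).1) (fun a b hab => by
      ext p; rw [LL_dep _ _ a b hab, LL_dep _ _ a b hab])]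
  rw [add_comm, ← integral_add]
  · congr 1; ext a
    rw [integral_symm lam hσ (hc i)
      (g := fun c => eta (LL χ cc 1 D' a + c * LL χ cc (fun k => χ k i) D' a)) (hbp a)]
    have e2 : ∀ p, (eta (LL χ cc 1 D' a + cc i p * LL χ cc (fun k => χ k i) D' a)
        + eta (LL χ cc 1 D' a + (-cc i p) * LL χ cc (fun k => χ k i) D' a)) / 2
        = EE (cc i p * ff χ cc i D' a) * LL χ cc 1 D' a + eta (LL χ cc 1 D' a) := by
      intro p
      rw [← eta_pair, ← ff_mul hχ hc]
      congr 3 <;> ring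
    simp_rw [e2]
    have b3 : BM fun p => EE (cc i p * ff χ cc i D' a) * LL χ cc 1 D' a :=
      (((hc i).bm.mul (BM.const _)).cont EE_cont).mul (BM.const _)
    rw [integral_add (b3.integrable _) (integrable_const _), integral_mul_const]
    simp
  · exact (((ff_bm hχ hc i D').cont (cont_bar lam (hc i).bm EE_cont)).mul
      (LL_bm hχ hc 1 D')).integrable _
  · exact ((LL_bm hχ hc 1 D').cont eta_cont).integrable _

lemma EE_sign {c : ℝ} (h : c * c = 1) (f : ℝ) : EE (c * f) = EE f := by
  rcases mul_self_eq_one_iff.mp h with rfl | rfl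
  · rw [one_mul]
  · rw [neg_one_mul, EE_neg]

lemma KK_diff (hχ : Chars κ ι χ) (hc : ∀ j, OddFn σ (cc j)) {cc' : ι → α → ℝ}
    (hc' : ∀ j, OddFn σ (cc' j))
    (lam : Measure α) [IsProbabilityMeasure lam] (hσ : MeasurePreserving σ lam lam)
    {D : Finset ι} {i : ι} (hi : i ∈ D) (hcc : ∀ j, j ≠ i → cc j = cc' j)
    (h1 : ∀ p, cc' i p * cc' i p = 1) :
    KK χ cc' lam D - KK χ cc lam D = H0 lam (cc i) - gg χ cc lam (cc i) i (D.erase i) := by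
  have hE : ∀ j ∈ D.erase i, cc' j = cc j := fun j hj => (hcc j (Finset.mem_erase.mp hj).1).symm
  rw [KK_split hχ hc lam hσ hi, KK_split hχ hc' lam hσ hi]
  simp_rw [EE_sign (h1 _), ff_congr hE, KK, LL_congr hE]
  have bf := ff_bm hχ hc i (D.erase i)
  have bL := LL_bm hχ hc 1 (D.erase i)
  have b1 := (bf.cont EE_cont).mul bL
  have b2 := (bf.cont (cont_bar lam (hc i).bm EE_cont)).mul bL
  have e : gg χ cc lam (cc i) i (D.erase i) = H0 lam (cc i)
      - ∫ a, EE (ff χ cc i (D.erase i) a) * LL χ cc 1 (D.erase i) a ∂(Measure.pi fun _ => lam)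
      + ∫ a, (∫ p, EE (cc i p * ff χ cc i (D.erase i) a) ∂lam) * LL χ cc 1 (D.erase i) a
        ∂(Measure.pi fun _ => lam) := by
    unfold gg
    simp_rw [phibar_eq lam (hc i).bm, add_mul, sub_mul]
    rw [integral_add ((((BM.const _).mul bL).sub b1).integrable _) (b2.integrable _),
      integral_sub (((BM.const _).mul bL).integrable _) (b1.integrable _), integral_const_mul,
      integral_LL hχ hc lam hσ, mul_one]
  rw [e]
  simp only [integral_const, probReal_univ, smul_eq_mul, one_mul]
  ring

lemma qq_eq (i : ι) (D : Finset ι) (lam : Measure α) : qq χ cc lam i D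
    = ∫ a, Xv (LL χ cc (fun k => χ k i) D a) (LL χ cc 1 D a) ∂(Measure.pi fun _ => lam) := rfl

lemma qq_step (hχ : Chars κ ι χ) (hc : ∀ j, OddFn σ (cc j)) {cc' : ι → α → ℝ}
    (hc' : ∀ j, OddFn σ (cc' j))
    (lam : Measure α) [IsProbabilityMeasure lam] (hσ : MeasurePreserving σ lam lam)
    (i : ι) {D : Finset ι} {j : ι} (hj : j ∈ D) (hcc : ∀ l, l ≠ j → cc l = cc' l)
    (h1 : ∀ p, cc' j p * cc' j p = 1) :
    qq χ cc lam i D ≤ qq χ cc' lam i D := by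
  have hE : ∀ l ∈ D.erase j, cc' l = cc l := fun l hl => (hcc l (Finset.mem_erase.mp hl).1).symm
  set D' := D.erase j with hD'
  let x : (ι → α) → ℝ → ℝ := fun a c =>
    Xv (LL χ cc (fun k => χ k i) D' a + c * LL χ cc (fun k => χ k i * χ k j) D' a)
      (LL χ cc 1 D' a + c * LL χ cc (fun k => χ k j) D' a)
  have hbound : ∀ a c, |c| ≤ 1 →
      |LL χ cc (fun k => χ k i) D' a + c * LL χ cc (fun k => χ k i * χ k j) D' a|
        ≤ LL χ cc 1 D' a + c * LL χ cc (fun k => χ k j) D' a := by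
    intro a c hcl
    have hc2 := abs_le.mp hcl
    unfold LL
    rw [mul_left_comm, ← mul_add, mul_left_comm c, ← mul_add, abs_mul,
      abs_of_pos (inv_pos.mpr card_pos')]
    refine mul_le_mul_of_nonneg_left ?_ (inv_pos.mpr card_pos').le
    rw [Finset.mul_sum, Finset.mul_sum, ← Finset.sum_add_distrib, ← Finset.sum_add_distrib]
    refine (Finset.abs_sum_le_sum_abs _ _).trans (Finset.sum_le_sum fun k _ => ?_)
    have hW := W_nonneg hχ hc D' k a
    have e : χ k i * W χ cc D' k a + c * (χ k i * χ k j * W χ cc D' k a)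
        = χ k i * ((1 + c * χ k j) * W χ cc D' k a) := by ring
    have hn : 0 ≤ 1 + c * χ k j := by
      rcases hχ.cases k j with h | h <;> rw [h] <;> linarith
    rw [e, abs_mul, hχ.abs, one_mul, abs_of_nonneg (mul_nonneg hn hW)]
    apply le_of_eq
    simp only [Pi.one_apply]
    ring
  have hXle : ∀ {n d : ℝ}, |n| ≤ d → |Xv n d| ≤ d := by
    intro n d h
    have hd : 0 ≤ d := (abs_nonneg _).trans h
    unfold Xv
    rw [abs_mul, abs_of_nonneg hd, abs_pow]
    exact mul_le_of_le_one_left hd (pow_le_one₀ (abs_nonneg _) (abs_div_le_one h))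
  have hXm : Measurable fun z : ℝ × ℝ => Xv z.1 z.2 := by
    unfold Xv
    exact ((measurable_fst.div measurable_snd).pow_const 2).mul measurable_snd
  have bA := LL_bm hχ hc (fun k => χ k i) D'
  have bB := LL_bm hχ hc (fun k => χ k i * χ k j) D'
  have bC := LL_bm hχ hc 1 D'
  have bE := LL_bm hχ hc (fun k => χ k j) D'
  have main : ∀ c : α → ℝ, OddFn σ c → BM (fun a : ι → α => x a (c (a j))) ∧
      (∀ a, BM (fun p => x a (c p))) ∧
      ∫ a, x a (c (a j)) ∂(Measure.pi fun _ : ι => lam)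
      = ∫ a, ∫ p, (x a (c p) + x a (-c p)) / 2 ∂lam ∂(Measure.pi fun _ : ι => lam) := by
    intro c hcc0
    have bc := hcc0.bm.comp (measurable_pi_apply (X := fun _ : ι => α) j)
    have m1 : BM (fun a : ι → α => x a (c (a j))) := by
      have bd := bC.add (bc.mul bE)
      obtain ⟨M, hM⟩ := bd.2
      exact ⟨hXm.comp ((bA.add (bc.mul bB)).1.prodMk bd.1), M, fun a =>
        (hXle (hbound a _ (hcc0.le _))).trans ((le_abs_self _).trans (hM a))⟩
    have m2 : ∀ a, BM (fun p => x a (c p)) := by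
      intro a
      have bd := (BM.const (LL χ cc 1 D' a)).add (hcc0.bm.mul (BM.const (LL χ cc (fun k => χ k j) D' a)))
      obtain ⟨M, hM⟩ := bd.2
      exact ⟨hXm.comp (((BM.const (LL χ cc (fun k => χ k i) D' a)).add
        (hcc0.bm.mul (BM.const (LL χ cc (fun k => χ k i * χ k j) D' a)))).1.prodMk bd.1), M, fun p =>
        (hXle (hbound a _ (hcc0.le _))).trans ((le_abs_self _).trans (hM p))⟩
    refine ⟨m1, m2, ?_⟩
    rw [integral_one lam (D := D') (i := j) (by simp [hD']) (G := fun a p => x a (c p)) m1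
      (fun a => (m2 a).1) (fun a b hab => by
        ext p; simp only [x]
        rw [LL_dep _ _ a b hab, LL_dep _ _ a b hab, LL_dep _ _ a b hab, LL_dep _ _ a b hab])]
    congr 1; ext a
    exact integral_symm lam hσ hcc0 (g := x a) (m2 a)
  have s1 : qq χ cc lam i D = ∫ a, x a (cc j (a j)) ∂(Measure.pi fun _ : ι => lam) := by
    rw [qq_eq]
    congr 1; ext a
    rw [LL_split hj, LL_split hj 1]
    simp [x, hD']
  have s2 : qq χ cc' lam i D = ∫ a, x a (cc' j (a j)) ∂(Measure.pi fun _ : ι => lam) := by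
    rw [qq_eq]
    congr 1; ext a
    rw [LL_split hj, LL_split hj 1, LL_congr hE, LL_congr hE, LL_congr hE, LL_congr hE]
    simp [x, hD']
  obtain ⟨m1, m1', i1⟩ := main _ (hc j)
  obtain ⟨m2, m2', i2⟩ := main _ (hc' j)
  have key : ∀ a p, (x a (cc' j p) + x a (-cc' j p)) / 2 = (x a 1 + x a (-1)) / 2 := by
    intro a p
    rcases mul_self_eq_one_iff.mp (h1 p) with h | h <;> rw [h]
    rw [neg_neg, add_comm]
  have conv : ∀ a c, |c| ≤ 1 → (x a c + x a (-c)) / 2 ≤ (x a 1 + x a (-1)) / 2 := by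
    have : ∀ a c, |c| ≤ 1 → x a c ≤ (1 + c) / 2 * x a 1 + (1 - c) / 2 * x a (-1) := by
      intro a c hcl
      have h2 := abs_le.mp hcl
      have := Xv_convex (s := (1 + c) / 2) (t := (1 - c) / 2) (by linarith) (by linarith)
        (hbound a 1 (by simp)) (hbound a (-1) (by simp))
      convert! this using 1
      simp only [x]
      congr 1 <;> ring
    intro a c hcl
    have h1 := this a c hcl
    have h2 := this a (-c) (by rwa [abs_neg])
    linarith
  have bm1 : ∀ c0 : ℝ, |c0| ≤ 1 → BM fun a => x a c0 := by
    intro c0 h0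
    have bd := bC.add ((BM.const c0).mul bE)
    obtain ⟨M, hM⟩ := bd.2
    exact ⟨hXm.comp ((bA.add ((BM.const c0).mul bB)).1.prodMk bd.1), M, fun a =>
      (hXle (hbound a _ h0)).trans ((le_abs_self _).trans (hM a))⟩
  rw [s1, s2, i2]
  simp_rw [key]
  rw [integral_one lam (D := D') (i := j) (by simp [hD']) (G := fun a p => x a (cc j p)) m1
      (fun a => (m1' a).1) (fun a b hab => by
        ext p; simp only [x]
        rw [LL_dep _ _ a b hab, LL_dep _ _ a b hab, LL_dep _ _ a b hab, LL_dep _ _ a b hab])]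
  have hle : ∀ a, ∫ p, x a (cc j p) ∂lam ≤ (x a 1 + x a (-1)) / 2 := by
    intro a
    rw [integral_symm lam hσ (hc j) (g := x a) (m1' a)]
    have : ∫ p, (x a 1 + x a (-1)) / 2 ∂lam = (x a 1 + x a (-1)) / 2 := by simp
    rw [← this]
    refine integral_mono_of_nonneg (Filter.Eventually.of_forall fun p => ?_) (integrable_const _)
      (Filter.Eventually.of_forall fun p => conv a _ ((hc j).le p))
    have nn : ∀ c, |c| ≤ 1 → 0 ≤ x a c := fun c h =>
      mul_nonneg (sq_nonneg _) ((abs_nonneg _).trans (hbound a c h))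
    have := nn _ ((hc j).le p)
    have := nn (-cc j p) (by rw [abs_neg]; exact (hc j).le p)
    simp only [Pi.zero_apply]
    linarith
  simp only [integral_const, probReal_univ, smul_eq_mul, one_mul]
  refine integral_mono_of_nonneg (Filter.Eventually.of_forall fun a => ?_) ?_
    (Filter.Eventually.of_forall hle)
  · refine integral_nonneg fun p => mul_nonneg (sq_nonneg _) ((abs_nonneg _).trans
      (hbound a _ ((hc j).le p)))
  · have := ((bm1 1 (by simp)).add (bm1 (-1) (by simp))).integrable (Measure.pi fun _ : ι => lam)
    exact this.div_const 2

end core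
end
end RMP

namespace RMP
set_option linter.unusedSectionVars false
set_option linter.unusedVariables false
noncomputable section

section sgn
variable {ι α κ : Type*} [Fintype ι] [DecidableEq ι] [MeasurableSpace α]
  [AddCommGroup κ] [Fintype κ]
variable {χ : κ → ι → ℝ} {cc : ι → α → ℝ}
variable {σ : α → α}

open Classical in
/-- number of words vanishing on `D` -/
def kc (χ : κ → ι → ℝ) (D : Finset ι) : ℕ :=
  (Finset.univ.filter fun k : κ => ∀ j ∈ D, χ k j = 1).card

lemma kc_pos (hχ : Chars κ ι χ) (D : Finset ι) : 0 < kc χ D := by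
  classical
  unfold kc
  exact Finset.card_pos.mpr ⟨0, by simp [hχ.zero]⟩

lemma prod_one_add (hχ : Chars κ ι χ) (D : Finset ι) (k : κ) [Decidable (∀ j ∈ D, χ k j = 1)] :
    ∏ j ∈ D, (1 + χ k j) = if ∀ j ∈ D, χ k j = 1 then (2 : ℝ) ^ D.card else 0 := by
  split_ifs with h
  · rw [Finset.prod_congr rfl (g := fun _ => (2 : ℝ)) fun j hj => by rw [h j hj]; norm_num]
    simp
  · push Not at h
    obtain ⟨j, hj, hne⟩ := h
    refine Finset.prod_eq_zero hj ?_
    rcases hχ.cases k j with e | e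
    · exact absurd e hne
    · rw [e]; norm_num

lemma LL_sign (hχ : Chars κ ι χ) (h1 : ∀ j p, cc j p * cc j p = 1) (D : Finset ι) (a : ι → α) :
    LL χ cc 1 D a = 0 ∨
      LL χ cc 1 D a = (Fintype.card κ : ℝ)⁻¹ * (2 ^ D.card * (kc χ D : ℝ)) := by
  classical
  by_cases h : ∀ k, W χ cc D k a = 0
  · left
    unfold LL
    simp [h]
  · right
    push Not at h
    obtain ⟨k0, hk0⟩ := h
    have hs : ∀ j ∈ D, cc j (a j) = χ k0 j := by
      intro j hj
      have := Finset.prod_ne_zero_iff.mp hk0 j hj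
      rcases mul_self_eq_one_iff.mp (h1 j (a j)) with e | e <;>
        rcases hχ.cases k0 j with e' | e' <;> rw [e, e'] at this ⊢ <;> norm_num at this
    have e : ∀ k, W χ cc D k a = ∏ j ∈ D, (1 + χ (k + k0) j) := by
      intro k
      refine Finset.prod_congr rfl fun j hj => ?_
      rw [hs j hj, hχ.add]
    unfold LL
    congr 1
    simp only [Pi.one_apply, one_mul, e]
    refine (Equiv.sum_comp (Equiv.addRight k0) (fun k => ∏ j ∈ D, (1 + χ k j))).trans ?_
    simp_rw [prod_one_add hχ]
    rw [← Finset.sum_filter, Finset.sum_const, nsmul_eq_mul, mul_comm]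
    rfl

lemma KK_sign (hχ : Chars κ ι χ) (hc : ∀ j, OddFn σ (cc j))
    (lam : Measure α) [IsProbabilityMeasure lam] (hσ : MeasurePreserving σ lam lam)
    (h1 : ∀ j p, cc j p * cc j p = 1) (D : Finset ι) :
    KK χ cc lam D = D.card * Real.log 2 + Real.log (kc χ D) - Real.log (Fintype.card κ) := by
  have e : ∀ a, eta (LL χ cc 1 D a) = LL χ cc 1 D a *
      Real.log ((Fintype.card κ : ℝ)⁻¹ * (2 ^ D.card * (kc χ D : ℝ))) := by
    intro a
    rcases LL_sign hχ h1 D a with h | h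
    · rw [h]; simp [eta]
    · rw [h]; simp only [eta]
  unfold KK
  simp_rw [e]
  rw [integral_mul_const, integral_LL hχ hc lam hσ, one_mul]
  have hk : (0 : ℝ) < kc χ D := by exact_mod_cast kc_pos hχ D
  have hκ : (0 : ℝ) < Fintype.card κ := card_pos'
  rw [Real.log_mul (by positivity) (by positivity), Real.log_mul (by positivity) (by positivity),
    Real.log_inv, Real.log_pow]
  ring
end sgn

lemma telesc_aux {ι : Type*} [LinearOrder ι] (G : Finset ι → ℝ) (S : Finset ι) :
    ∑ i ∈ S, (G (S.filter (· ≤ i)) - G (S.filter (· < i))) = G S - G ∅ := by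
  induction S using Finset.induction_on_max with
  | empty => simp
  | insert a s hs ih =>
    have ha : a ∉ s := fun h => lt_irrefl _ (hs a h)
    rw [Finset.sum_insert ha]
    have e1 : (insert a s).filter (· ≤ a) = insert a s := by
      apply Finset.filter_true_of_mem
      intro x hx
      rcases Finset.mem_insert.mp hx with rfl | h
      · exact le_rfl
      · exact (hs x h).le
    have e2 : (insert a s).filter (· < a) = s := by
      ext x
      simp only [Finset.mem_filter, Finset.mem_insert]
      constructor
      · rintro ⟨rfl | h, h'⟩
        · exact absurd h' (lt_irrefl _)
        · exact h
      · exact fun h => ⟨Or.inr h, hs x h⟩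
    have e3 : ∀ i ∈ s, G ((insert a s).filter (· ≤ i)) - G ((insert a s).filter (· < i))
        = G (s.filter (· ≤ i)) - G (s.filter (· < i)) := by
      intro i hi
      rw [Finset.filter_insert, Finset.filter_insert, if_neg (not_le.mpr (hs i hi)),
        if_neg (not_lt.mpr (hs i hi).le)]
    rw [Finset.sum_congr rfl e3, ih, e1, e2]
    ring

section fin
variable {ι α κ : Type*} [Fintype ι] [LinearOrder ι] [MeasurableSpace α]
  [AddCommGroup κ] [Fintype κ]
variable {χ : κ → ι → ℝ} {c0 c1 : α → ℝ}
variable {σ : α → α}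

/-- mixed channel: perfect observation on `T` -/
def cct (c0 c1 : α → ℝ) (T : Finset ι) (j : ι) : α → ℝ := if j ∈ T then c1 else c0

def lo (i : ι) : Finset ι := Finset.univ.filter (· < i)

lemma cct_odd (h0 : OddFn σ c0) (h1 : OddFn σ c1) (T : Finset ι) (j : ι) :
    OddFn σ (cct c0 c1 T j) := by
  unfold cct; split_ifs <;> assumption

lemma KK_tele (hχ : Chars κ ι χ) (h0 : OddFn σ c0) (h1 : OddFn σ c1)
    (hs : ∀ p, c1 p * c1 p = 1)
    (lam : Measure α) [IsProbabilityMeasure lam] (hσ : MeasurePreserving σ lam lam)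
    (D : Finset ι) :
    ∑ i ∈ D, gg χ (cct c0 c1 (lo i)) lam c0 i (D.erase i)
      = D.card * H0 lam c0 - (KK χ (fun _ => c1) lam D - KK χ (fun _ => c0) lam D) := by
  have t := telesc_aux (fun T => KK χ (cct c0 c1 T) lam D) (Finset.univ : Finset ι)
  have eU : (cct c0 c1 (Finset.univ : Finset ι)) = fun _ => c1 := by ext; simp [cct]
  have eE : (cct c0 c1 (∅ : Finset ι)) = fun _ => c0 := by ext; simp [cct]
  simp only [eU, eE] at t
  rw [← t, ← Finset.sum_subset (Finset.subset_univ D)]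
  · have : ∀ i ∈ D, KK χ (cct c0 c1 (Finset.univ.filter (· ≤ i))) lam D
        - KK χ (cct c0 c1 (Finset.univ.filter (· < i))) lam D
        = H0 lam c0 - gg χ (cct c0 c1 (lo i)) lam c0 i (D.erase i) := by
      intro i hi
      have hi0 : cct c0 c1 (lo i) i = c0 := by simp [cct, lo]
      have hi1 : cct c0 c1 (Finset.univ.filter (· ≤ i)) i = c1 := by simp [cct]
      have k := KK_diff hχ (cc := cct c0 c1 (lo i)) (cct_odd h0 h1 _)
        (cc' := cct c0 c1 (Finset.univ.filter (· ≤ i))) (cct_odd h0 h1 _) lam hσ hi ?_ ?_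
      · rw [hi0] at k
        exact k
      · intro j hj
        unfold cct lo
        simp only [Finset.mem_filter, Finset.mem_univ, true_and]
        by_cases h : j < i
        · simp [h, h.le]
        · have : ¬ j ≤ i := fun h' => h (lt_of_le_of_ne h' hj)
          simp [h, this]
      · rw [hi1]; exact hs
    rw [Finset.sum_congr rfl this, Finset.sum_sub_distrib]
    simp
  · intro i _ hi
    rw [sub_eq_zero]
    unfold KK
    rw [LL_congr]
    intro j hj
    unfold cct
    have hne : j ≠ i := fun h => hi (h ▸ hj)
    simp only [Finset.mem_filter, Finset.mem_univ, true_and]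
    by_cases h : j < i
    · simp [h, h.le]
    · have : ¬ j ≤ i := fun h' => h (lt_of_le_of_ne h' hne)
      simp [h, this]

lemma qq_cct (hχ : Chars κ ι χ) (h0 : OddFn σ c0) (h1 : OddFn σ c1)
    (hs : ∀ p, c1 p * c1 p = 1)
    (lam : Measure α) [IsProbabilityMeasure lam] (hσ : MeasurePreserving σ lam lam)
    (i : ι) (D T : Finset ι) :
    qq χ (fun _ => c0) lam i D ≤ qq χ (cct c0 c1 T) lam i D := by
  induction T using Finset.induction_on with
  | empty =>
    have eE : (cct c0 c1 (∅ : Finset ι)) = fun _ => c0 := by ext; simp [cct]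
    rw [eE]
  | insert j T hj ih =>
    refine ih.trans ?_
    have hne : ∀ l, l ≠ j → cct c0 c1 T l = cct c0 c1 (insert j T) l := by
      intro l hl
      simp [cct, hl]
    by_cases hD : j ∈ D
    · refine qq_step hχ (cct_odd h0 h1 _) (cct_odd h0 h1 _) lam hσ i hD hne ?_
      simpa [cct] using hs
    · have hcg : ∀ l ∈ D, cct c0 c1 T l = cct c0 c1 (insert j T) l :=
        fun l hl => hne l fun h => hD (h ▸ hl)
      unfold qq
      rw [ff_congr hcg, LL_congr hcg]

/-- the block of `D` or its complement containing `i` -/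
def blk (D : Finset ι) (i : ι) : Finset ι := if i ∈ D then D else Dᶜ

lemma gg_block (hχ : Chars κ ι χ) (h0 : OddFn σ c0) (h1 : OddFn σ c1)
    (hs : ∀ p, c1 p * c1 p = 1)
    (lam : Measure α) [IsProbabilityMeasure lam] (hσ : MeasurePreserving σ lam lam)
    (D : Finset ι) :
    ∑ i, (gg χ (cct c0 c1 (lo i)) lam c0 i ((blk D i).erase i)
        - gg χ (cct c0 c1 (lo i)) lam c0 i (Finset.univ.erase i))
      ≤ Real.log (kc χ (Finset.univ : Finset ι)) + Real.log (Fintype.card κ)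
        - Real.log (kc χ D) - Real.log (kc χ Dᶜ) := by
  rw [Finset.sum_sub_distrib, KK_tele hχ h0 h1 hs lam hσ Finset.univ,
    ← Finset.sum_add_sum_compl D]
  have e1 : ∑ i ∈ D, gg χ (cct c0 c1 (lo i)) lam c0 i ((blk D i).erase i)
      = ∑ i ∈ D, gg χ (cct c0 c1 (lo i)) lam c0 i (D.erase i) :=
    Finset.sum_congr rfl fun i hi => by simp [blk, hi]
  have e2 : ∑ i ∈ Dᶜ, gg χ (cct c0 c1 (lo i)) lam c0 i ((blk D i).erase i)
      = ∑ i ∈ Dᶜ, gg χ (cct c0 c1 (lo i)) lam c0 i (Dᶜ.erase i) :=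
    Finset.sum_congr rfl fun i hi => by simp [blk, Finset.mem_compl.mp hi]
  rw [e1, e2, KK_tele hχ h0 h1 hs lam hσ D, KK_tele hχ h0 h1 hs lam hσ Dᶜ]
  rw [KK_sign hχ (fun _ => h1) lam hσ (fun _ => hs), KK_sign hχ (fun _ => h1) lam hσ (fun _ => hs),
    KK_sign hχ (fun _ => h1) lam hσ (fun _ => hs)]
  have ksup := KK_super hχ (fun _ => h0) lam hσ D
  have ecard : ((Finset.univ : Finset ι).card : ℝ) = D.card + Dᶜ.card := by
    rw [Finset.card_univ]
    exact_mod_cast (Finset.card_add_card_compl D).symm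
  rw [ecard]
  linarith

lemma gg_le_EE (hχ : Chars κ ι χ) {cc : ι → α → ℝ} (hc : ∀ j, OddFn σ (cc j)) (h0 : OddFn σ c0)
    (lam : Measure α) [IsProbabilityMeasure lam] (hσ : MeasurePreserving σ lam lam)
    (i : ι) (D : Finset ι) :
    gg χ cc lam c0 i D ≤ Real.log 2 - ∫ a, EE (ff χ cc i D a) * LL χ cc 1 D a
      ∂(Measure.pi fun _ => lam) := by
  have bL := LL_bm (cc := cc) hχ hc 1 D
  have bf := ff_bm (cc := cc) hχ hc i D
  have hp : ∀ f : ℝ, |f| ≤ 1 → phibar lam c0 f ≤ Real.log 2 - EE f := by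
    intro f hf
    rw [phibar_eq lam h0.bm]
    unfold H0
    rw [integral_sub (integrable_const _) ((h0.bm.cont EE_cont).integrable _)]
    have : ∫ p, EE (c0 p * f) ∂lam ≤ ∫ p, EE (c0 p) ∂lam :=
      integral_mono (((h0.bm.mul (BM.const f)).cont EE_cont).integrable _)
        ((h0.bm.cont EE_cont).integrable _) fun p => EE_mul_le (h0.le p) hf
    simp at this ⊢
    linarith
  have hi := integral_LL hχ hc lam hσ D
  calc gg χ cc lam c0 i D ≤ ∫ a, (Real.log 2 * LL χ cc 1 D a - EE (ff χ cc i D a) * LL χ cc 1 D a)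
      ∂(Measure.pi fun _ => lam) := by
        refine integral_mono (((bf.cont (phibar_cont lam h0.bm)).mul bL).integrable _)
          ((((BM.const _).mul bL).sub ((bf.cont EE_cont).mul bL)).integrable _) fun a => ?_
        simp only
        rw [← sub_mul]
        exact mul_le_mul_of_nonneg_right (hp _ (ff_le hχ hc i D a)) (LL_nonneg hχ hc D a)
    _ = _ := by
        rw [integral_sub (((BM.const _).mul bL).integrable _)
          (((bf.cont EE_cont).mul bL).integrable _), integral_const_mul, hi, mul_one]

lemma qq_tangent (hχ : Chars κ ι χ) {cc : ι → α → ℝ} (hc : ∀ j, OddFn σ (cc j))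
    (lam : Measure α) [IsProbabilityMeasure lam] (hσ : MeasurePreserving σ lam lam)
    (i : ι) (D : Finset ι) {A x0 t : ℝ} (h : ∀ x, |x| ≤ 1 → A + t * (EE x0 - EE x) ≤ 1 - x ^ 2) :
    A + t * (EE x0 - ∫ a, EE (ff χ cc i D a) * LL χ cc 1 D a ∂(Measure.pi fun _ => lam))
      ≤ 1 - qq χ cc lam i D := by
  have bL := LL_bm (cc := cc) hχ hc 1 D
  have bf := ff_bm (cc := cc) hχ hc i D
  have hi := integral_LL hχ hc lam hσ D
  have b1 : BM fun a => EE (ff χ cc i D a) * LL χ cc 1 D a := (bf.cont EE_cont).mul bL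
  have b2 : BM fun a => ff χ cc i D a ^ 2 * LL χ cc 1 D a := (bf.pow 2).mul bL
  have key : ∫ a, ((A + t * EE x0) * LL χ cc 1 D a - t * (EE (ff χ cc i D a) * LL χ cc 1 D a))
      ∂(Measure.pi fun _ => lam) ≤ ∫ a, (LL χ cc 1 D a - ff χ cc i D a ^ 2 * LL χ cc 1 D a)
      ∂(Measure.pi fun _ => lam) := by
    refine integral_mono ((((BM.const _).mul bL).sub ((BM.const _).mul b1)).integrable _)
      ((bL.sub b2).integrable _) fun a => ?_
    have := mul_le_mul_of_nonneg_right (h _ (ff_le hχ hc i D a)) (LL_nonneg hχ hc D a)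
    simp only
    linarith
  rw [integral_sub (((BM.const _).mul bL).integrable _) (((BM.const _).mul b1).integrable _),
    integral_const_mul, integral_const_mul, integral_sub (bL.integrable _) (b2.integrable _),
    hi] at key
  unfold qq
  linarith

theorem core (hχ : Chars κ ι χ) (h0 : OddFn σ c0) (h1 : OddFn σ c1)
    (hs : ∀ p, c1 p * c1 p = 1)
    (lam : Measure α) [IsProbabilityMeasure lam] (hσ : MeasurePreserving σ lam lam)
    {ℒ : Type*} [Fintype ℒ] [Nonempty ℒ] (D : ℒ → Finset ι)
    (hD : ∀ i j, j ≠ i → 2 * (Finset.univ.filter fun l => j ∈ blk (D l) i).card ≤ Fintype.card ℒ)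
    {B : ℝ} (hB : ∀ l, Real.log (kc χ (Finset.univ : Finset ι)) + Real.log (Fintype.card κ)
        - Real.log (kc χ (D l)) - Real.log (kc χ (D l)ᶜ) ≤ B)
    {q0 : ℝ} (hq0 : 0 ≤ q0) (hq : ∀ i, q0 ≤ qq χ (fun _ => c0) lam i (Finset.univ.erase i))
    (hq1 : q1 lam c0 ≤ 1)
    {u : ℝ} (hu0 : 0 < u) (hu1 : u < 1)
    (hu : Fintype.card ι * (u * Real.log 2) ≤ Fintype.card ι * H0 lam c0
      - Fintype.card ι * Real.log 2 + Real.log (Fintype.card κ)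
      - Real.log (kc χ (Finset.univ : Finset ι))) :
    q0 * (1 - q1 lam c0) * (Fintype.card ι * psi u) ≤ 4 * B := by
  obtain ⟨x, hx0, hx1, hxi, hxe⟩ := hbInv_spec hu0 hu1
  have hpsi : psi u = 1 - x ^ 2 := by unfold psi; rw [hxi]; ring
  obtain ⟨t, ht0, ht⟩ := EE_tangent hx0 hx1
  set q : ι → ℝ := fun i => qq χ (cct c0 c1 (lo i)) lam i (Finset.univ.erase i) with hqdef
  set g : ι → ℝ := fun i => gg χ (cct c0 c1 (lo i)) lam c0 i (Finset.univ.erase i) with hgdef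
  have hcc : ∀ i j : ι, OddFn σ (cct c0 c1 (lo i) j) := fun i => cct_odd h0 h1 _
  -- lower bound on the sum of 1 - q
  have s1 : Fintype.card ι * psi u ≤ ∑ i, (1 - q i) := by
    have a1 : ∀ i, psi u + t * (g i - u * Real.log 2) ≤ 1 - q i := by
      intro i
      have := qq_tangent hχ (hcc i) lam hσ i (Finset.univ.erase i) ht
      have h2 := gg_le_EE hχ (hcc i) h0 lam hσ i (Finset.univ.erase i)
      rw [hpsi]
      refine le_trans ?_ this
      have : g i - u * Real.log 2 ≤ EE x - ∫ a, EE (ff χ (cct c0 c1 (lo i)) i (Finset.univ.erase i) a)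
          * LL χ (cct c0 c1 (lo i)) 1 (Finset.univ.erase i) a ∂(Measure.pi fun _ => lam) := by
        simp only [hgdef]; linarith
      have := mul_le_mul_of_nonneg_left this ht0
      linarith
    have a2 := Finset.sum_le_sum fun i (_ : i ∈ Finset.univ) => a1 i
    refine le_trans ?_ a2
    rw [Finset.sum_add_distrib, ← Finset.mul_sum, Finset.sum_sub_distrib]
    have a3 := KK_tele hχ h0 h1 hs lam hσ Finset.univ
    rw [KK_sign hχ (fun _ => h1) lam hσ (fun _ => hs)] at a3
    have a4 := KK_nonneg hχ (fun _ => h0) lam hσ Finset.univ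
    have a5 : 0 ≤ ∑ i, g i - ∑ i : ι, u * Real.log 2 := by
      simp only [hgdef]
      rw [a3]
      simp only [Finset.sum_const, Finset.card_univ, nsmul_eq_mul]
      linarith
    have := mul_nonneg ht0 a5
    simp only [Finset.sum_const, Finset.card_univ, nsmul_eq_mul] at this ⊢
    linarith
  have hM : (0 : ℝ) < Fintype.card ℒ := by exact_mod_cast Fintype.card_pos
  -- upper bound
  have s2 : ∀ i, Fintype.card ℒ * ((1 - q1 lam c0) * (q i * (1 - q i)))
      ≤ 4 * ∑ l, (gg χ (cct c0 c1 (lo i)) lam c0 i ((blk (D l) i).erase i) - g i) := by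
    intro i
    have es := qq_es hχ (hcc i) lam hσ i (fun l => blk (D l) i) (hD i)
    have : ∀ l, (1 - q1 lam c0) * (q i - qq χ (cct c0 c1 (lo i)) lam i ((blk (D l) i).erase i))
        ≤ 2 * (gg χ (cct c0 c1 (lo i)) lam c0 i ((blk (D l) i).erase i) - g i) := by
      intro l
      have := gg_sub hχ (hcc i) lam hσ h0
        (Finset.erase_subset_erase i (Finset.subset_univ (blk (D l) i))) i
      simp only [hgdef, hqdef]
      linarith
    have h3 := Finset.sum_le_sum fun l (_ : l ∈ Finset.univ) => this l
    rw [← Finset.mul_sum, ← Finset.mul_sum] at h3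
    have h4 := mul_le_mul_of_nonneg_left es (sub_nonneg.mpr hq1)
    simp only [hqdef] at h3 ⊢
    linarith
  have s3 : Fintype.card ℒ * ((1 - q1 lam c0) * ∑ i, q i * (1 - q i)) ≤ 4 * (Fintype.card ℒ * B) := by
    have h5 := Finset.sum_le_sum fun i (_ : i ∈ Finset.univ) => s2 i
    rw [← Finset.mul_sum, ← Finset.mul_sum, ← Finset.mul_sum, Finset.sum_comm] at h5
    refine h5.trans (mul_le_mul_of_nonneg_left ?_ (by norm_num))
    calc _ ≤ ∑ l : ℒ, B := Finset.sum_le_sum fun l _ =>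
          (gg_block hχ h0 h1 hs lam hσ (D l)).trans (hB l)
      _ = _ := by simp
  have s4 : q0 * ∑ i, (1 - q i) ≤ ∑ i, q i * (1 - q i) := by
    rw [Finset.mul_sum]
    refine Finset.sum_le_sum fun i _ => ?_
    refine mul_le_mul_of_nonneg_right ((hq i).trans (qq_cct hχ h0 h1 hs lam hσ i _ _)) ?_
    exact sub_nonneg.mpr (qq_le_one hχ (hcc i) lam hσ i _)
  have s5 : (1 - q1 lam c0) * ∑ i, q i * (1 - q i) ≤ 4 * B := by
    have : Fintype.card ℒ * ((1 - q1 lam c0) * ∑ i, q i * (1 - q i)) ≤ Fintype.card ℒ * (4 * B) := by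
      linarith
    exact le_of_mul_le_mul_left this hM
  calc q0 * (1 - q1 lam c0) * (Fintype.card ι * psi u)
      = (1 - q1 lam c0) * (q0 * (Fintype.card ι * psi u)) := by ring
    _ ≤ (1 - q1 lam c0) * ∑ i, q i * (1 - q i) := by
        refine mul_le_mul_of_nonneg_left ?_ (sub_nonneg.mpr hq1)
        exact (mul_le_mul_of_nonneg_left s1 hq0).trans s4
    _ ≤ 4 * B := s5

end fin
end
end RMP

namespace RMP
set_option linter.unusedSectionVars false
set_option linter.unusedVariables false
noncomputable section

section poly
variable {m : ℕ}

def mon (S : Finset (Fin m)) (x : Fin m → ZMod 2) : ZMod 2 := ∏ j ∈ S, x j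

def poly {A : Type*} [Fintype A] (s : A → Finset (Fin m)) (α : A → ZMod 2)
    (x : Fin m → ZMod 2) : ZMod 2 := ∑ a, α a * mon (s a) x

lemma mon_ind (S T : Finset (Fin m)) :
    mon S (fun j => if j ∈ T then 1 else 0) = if S ⊆ T then 1 else 0 := by
  unfold mon
  split_ifs with h
  · exact Finset.prod_eq_one fun j hj => by simp [h hj]
  · obtain ⟨j, hj, hn⟩ := Finset.not_subset.mp h
    exact Finset.prod_eq_zero hj (by simp [hn])

lemma poly_inj {A : Type*} [Fintype A] {s : A → Finset (Fin m)} (hs : Function.Injective s)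
    {α : A → ZMod 2} (h : ∀ x, poly s α x = 0) : α = 0 := by
  have key : ∀ n, ∀ a, (s a).card = n → α a = 0 := by
    intro n
    induction n using Nat.strong_induction_on with
    | _ n ih =>
      intro a ha
      have h1 := h (fun j => if j ∈ s a then 1 else 0)
      unfold poly at h1
      simp_rw [mon_ind] at h1
      rw [Finset.sum_eq_single a] at h1
      · simpa using h1
      · intro b _ hb
        by_cases hsub : s b ⊆ s a
        · have hlt : (s b).card < n := by
            rw [← ha]
            exact Finset.card_lt_card (Finset.ssubset_iff_subset_ne.mpr
              ⟨hsub, fun h => hb (hs h)⟩)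
          rw [ih _ hlt b rfl, zero_mul]
        · simp [hsub]
      · simp
  funext a
  exact key _ a rfl

abbrev Kap (r m : ℕ) := {S : Finset (Fin m) // S.card ≤ r} → ZMod 2

def pk (r : ℕ) : Kap r m →ₗ[ZMod 2] ((Fin m → ZMod 2) → ZMod 2) where
  toFun α := poly Subtype.val α
  map_add' α β := by
    ext x; simp [poly, add_mul, Finset.sum_add_distrib]
  map_smul' c α := by
    ext x; simp [poly, Finset.mul_sum, mul_assoc]

lemma pk_inj (r : ℕ) : Function.Injective (pk r : Kap r m →ₗ[ZMod 2] _) := by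
  rw [injective_iff_map_eq_zero]
  intro α h
  exact poly_inj Subtype.val_injective fun x => congrFun h x

lemma mon_mem {r : ℕ} {S : Finset (Fin m)} (hS : S.card ≤ r) :
    mon S ∈ LinearMap.range (pk r : Kap r m →ₗ[ZMod 2] _) := by
  classical
  refine ⟨Pi.single ⟨S, hS⟩ 1, ?_⟩
  ext x
  change ∑ a : {S : Finset (Fin m) // S.card ≤ r}, _ = _
  rw [Finset.sum_eq_single (⟨S, hS⟩ : {S : Finset (Fin m) // S.card ≤ r})]
  · simp
  · intro b _ hb
    rw [Pi.single_eq_of_ne hb, zero_mul]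
  · simp

lemma z2_idem (z : ZMod 2) : z * z = z := by revert z; decide

lemma mul_mon (t : Fin m) (S : Finset (Fin m)) (x : Fin m → ZMod 2) :
    x t * mon S x = mon (insert t S) x := by
  unfold mon
  by_cases h : t ∈ S
  · rw [Finset.insert_eq_of_mem h, ← Finset.mul_prod_erase S x h, ← mul_assoc, z2_idem]
  · rw [Finset.prod_insert h]

def dot (l x : Fin m → ZMod 2) : ZMod 2 := ∑ t, l t * x t

lemma dot_mul_mem {r : ℕ} (l : Fin m → ZMod 2) (b : ZMod 2) {A : Type*} [Fintype A]
    {s : A → Finset (Fin m)} (hs : ∀ a, (s a).card < r) (β : A → ZMod 2) :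
    (fun x => (dot l x - b) * poly s β x) ∈ LinearMap.range (pk r : Kap r m →ₗ[ZMod 2] _) := by
  have e : (fun x => (dot l x - b) * poly s β x)
      = ∑ a, β a • ((∑ t, l t • mon (insert t (s a))) - b • mon (s a)) := by
    ext x
    simp only [Finset.sum_apply, Pi.smul_apply, Pi.sub_apply, smul_eq_mul, ← mul_mon]
    unfold poly dot
    rw [Finset.mul_sum]
    refine Finset.sum_congr rfl fun a _ => ?_
    have : ∑ t, l t * (x t * mon (s a) x) = (∑ t, l t * x t) * mon (s a) x := by
      rw [Finset.sum_mul]; simp_rw [mul_assoc]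
    rw [this]; ring
  rw [e]
  refine Submodule.sum_mem _ fun a _ => Submodule.smul_mem _ _ (Submodule.sub_mem _
    (Submodule.sum_mem _ fun t _ => Submodule.smul_mem _ _ (mon_mem ?_))
    (Submodule.smul_mem _ _ (mon_mem (hs a).le)))
  exact (Finset.card_insert_le _ _).trans (hs a)

lemma shift_mem {r : ℕ} (w : Fin m → ZMod 2) (α : Kap r m) :
    (fun x => pk r α (x + w)) ∈ LinearMap.range (pk r : Kap r m →ₗ[ZMod 2] _) := by
  have e : (fun x => pk r α (x + w))
      = ∑ a : {S : Finset (Fin m) // S.card ≤ r}, α a • ∑ T ∈ a.1.powerset,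
        (∏ j ∈ a.1 \ T, w j) • mon T := by
    ext x
    change ∑ a : {S : Finset (Fin m) // S.card ≤ r}, _ = _
    simp only [Finset.sum_apply, Pi.smul_apply, smul_eq_mul]
    refine Finset.sum_congr rfl fun a _ => ?_
    congr 1
    unfold mon
    simp only [Pi.add_apply]
    rw [Finset.prod_add]
    exact Finset.sum_congr rfl fun T _ => mul_comm _ _
  rw [e]
  refine Submodule.sum_mem _ fun a _ => Submodule.smul_mem _ _ (Submodule.sum_mem _ fun T hT =>
    Submodule.smul_mem _ _ (mon_mem ?_))
  exact (Finset.card_le_card (Finset.mem_powerset.mp hT)).trans a.2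

lemma exists_shift (r : ℕ) (w : Fin m → ZMod 2) :
    ∃ ρ : Kap r m ≃ Kap r m, ∀ α x, pk r (ρ α) x = pk r α (x + w) := by
  choose f hf using fun α : Kap r m => shift_mem w α
  have hf' : ∀ α x, pk r (f α) x = pk r α (x + w) := fun α x => congrFun (hf α) x
  have hinj : Function.Injective f := by
    intro α β h
    apply pk_inj r
    ext x
    have h1 := hf' α (x - w)
    have h2 := hf' β (x - w)
    rw [sub_add_cancel] at h1 h2
    rw [← h1, ← h2, h]
  exact ⟨Equiv.ofBijective f (Finite.injective_iff_bijective.mp hinj), hf'⟩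

lemma card_sub (A : Finset (Fin m)) (r : ℕ) :
    Fintype.card {S : Finset (Fin m) // S ⊆ A ∧ S.card < r}
      = ∑ i ∈ Finset.range r, A.card.choose i := by
  rw [Fintype.card_subtype]
  have : (Finset.univ.filter fun S : Finset (Fin m) => S ⊆ A ∧ S.card < r)
      = (Finset.range r).biUnion fun i => A.powersetCard i := by
    ext S
    simp only [Finset.mem_filter, Finset.mem_univ, true_and, Finset.mem_biUnion, Finset.mem_range,
      Finset.mem_powersetCard]
    constructor
    · rintro ⟨h1, h2⟩
      exact ⟨_, h2, h1, rfl⟩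
    · rintro ⟨i, h2, h1, rfl⟩
      exact ⟨h1, h2⟩
  rw [this, Finset.card_biUnion]
  · simp
  · intro i _ j _ hij
    exact Finset.pairwise_disjoint_powersetCard A hij

lemma card_Kap (r : ℕ) : Fintype.card (Kap r m) = 2 ^ ∑ i ∈ Finset.range (r + 1), m.choose i := by
  rw [Fintype.card_fun, ZMod.card]
  congr 1
  have := card_sub (Finset.univ : Finset (Fin m)) (r + 1)
  rw [Finset.card_univ, Fintype.card_fin] at this
  rw [← this]
  refine Fintype.card_congr (Equiv.subtypeEquivRight fun S => ?_)
  simp [Nat.lt_succ_iff]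

lemma choose_split (n r : ℕ) :
    ∑ i ∈ Finset.range (r + 1), (n + 1).choose i
      = 2 * ∑ i ∈ Finset.range r, n.choose i + n.choose r := by
  induction r with
  | zero => simp
  | succ r ih =>
    rw [Finset.sum_range_succ, ih, Finset.sum_range_succ (fun i => n.choose i),
      Nat.choose_succ_succ]
    ring

lemma half_dot {w : Fin m → ZMod 2} (hw : w ≠ 0) :
    2 * (Finset.univ.filter fun l : Fin m → ZMod 2 => dot l w = 0).card
      ≤ Fintype.card (Fin m → ZMod 2) := by
  obtain ⟨t, ht⟩ := Function.ne_iff.mp hw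
  have ht1 : w t = 1 := by
    have : ∀ z : ZMod 2, z ≠ 0 → z = 1 := by decide
    exact this _ ht
  set F := Finset.univ.filter fun l : Fin m → ZMod 2 => dot l w = 0
  have h1 : F.card ≤ Fᶜ.card := by
    refine Finset.card_le_card_of_injOn (fun l => l + Pi.single t 1) ?_ ?_
    · intro l hl
      have hl' : dot l w = 0 := by simpa [F] using hl
      have : dot (l + Pi.single t 1) w = 1 := by
        have e : dot (l + Pi.single t 1) w = dot l w + w t := by
          unfold dot
          simp only [Pi.add_apply, add_mul, Finset.sum_add_distrib]
          congr 1
          rw [Finset.sum_eq_single t]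
          · simp
          · intro b _ hb; rw [Pi.single_eq_of_ne hb, zero_mul]
          · simp
        rw [e, hl', ht1, zero_add]
      simp [F, this]
    · intro a _ b _ h
      exact add_right_cancel h
  have h2 := Finset.card_add_card_compl F
  omega

end poly

lemma cb_sq (n : ℕ) : n.centralBinom ^ 2 * (2 * n + 1) ≤ 16 ^ n := by
  induction n with
  | zero => simp
  | succ n ih =>
    have h := Nat.succ_mul_centralBinom_succ n
    set x := (n + 1).centralBinom
    set y := n.centralBinom
    have h2 : (n + 1) ^ 2 * (x ^ 2 * (2 * (n + 1) + 1)) ≤ (n + 1) ^ 2 * 16 ^ (n + 1) := by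
      calc (n + 1) ^ 2 * (x ^ 2 * (2 * (n + 1) + 1)) = ((n + 1) * x) ^ 2 * (2 * n + 3) := by ring
        _ = (y ^ 2 * (2 * n + 1)) * (4 * ((2 * n + 1) * (2 * n + 3))) := by rw [h]; ring
        _ ≤ 16 ^ n * (4 * (4 * (n + 1) ^ 2)) := by
            refine Nat.mul_le_mul ih (Nat.mul_le_mul_left _ ?_)
            nlinarith
        _ = _ := by ring
    exact Nat.le_of_mul_le_mul_left h2 (by positivity)

lemma choose_sq (k r : ℕ) : (k.choose r) ^ 2 * (k + 1) ≤ 4 ^ k := by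
  have h1 := Nat.choose_le_middle r k
  have h3 : (k.choose (k / 2)) ^ 2 * (k + 1) ≤ 4 ^ k := by
    rcases Nat.even_or_odd' k with ⟨n, rfl | rfl⟩
    · have := cb_sq n
      rw [Nat.centralBinom_eq_two_mul_choose] at this
      rw [Nat.mul_div_cancel_left _ two_pos, pow_mul]
      simpa using this
    · have := cb_sq (n + 1)
      have e : (n + 1).centralBinom = 2 * (2 * n + 1).choose n := by
        rw [Nat.centralBinom_eq_two_mul_choose]
        have : 2 * (n + 1) = (2 * n + 1) + 1 := by ring
        rw [this, Nat.choose_succ_succ, Nat.choose_symm_half]; ring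
      rw [e] at this
      have e2 : (2 * n + 1) / 2 = n := by omega
      rw [e2]
      have e3 : (4 : ℕ) ^ (2 * n + 1) * 4 = 16 ^ (n + 1) := by
        rw [← pow_succ]
        have : 2 * n + 1 + 1 = 2 * (n + 1) := by ring
        rw [this, pow_mul]; norm_num
      nlinarith
  exact (Nat.mul_le_mul_right _ (Nat.pow_le_pow_left h1 2)).trans h3

lemma choose_bound {m : ℕ} (hm : 1 ≤ m) (r : ℕ) :
    ((m - 1).choose r : ℝ) / 2 ^ m ≤ 1 / (2 * Real.sqrt m) := by
  obtain ⟨k, rfl⟩ : ∃ k, m = k + 1 := ⟨m - 1, by omega⟩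
  have h := choose_sq k r
  have h' : ((k.choose r : ℝ)) ^ 2 * ((k + 1 : ℕ) : ℝ) ≤ 4 ^ k := by exact_mod_cast h
  rw [Nat.add_sub_cancel]
  have hp : (0 : ℝ) < ((k + 1 : ℕ) : ℝ) := by positivity
  have hs : 0 < Real.sqrt ((k + 1 : ℕ) : ℝ) := Real.sqrt_pos.mpr hp
  rw [div_le_div_iff₀ (by positivity) (by positivity)]
  have : (k.choose r : ℝ) * Real.sqrt ((k + 1 : ℕ) : ℝ) ≤ 2 ^ k := by
    refine abs_le_of_sq_le_sq' ?_ (by positivity) |>.2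
    rw [mul_pow, Real.sq_sqrt hp.le, ← pow_mul, mul_comm k 2, pow_mul]
    norm_num at h' ⊢
    exact h'
  rw [pow_succ]
  linarith

end
end RMP

namespace RMP
set_option linter.unusedSectionVars false
set_option linter.unusedVariables false
noncomputable section

/-- sign of a bit -/
def sg (z : ZMod 2) : ℝ := (-1 : ℝ) ^ z.val

lemma sg_zero : sg 0 = 1 := by simp [sg]
lemma sg_one : sg 1 = -1 := by simp [sg, ZMod.val_one]
lemma z2_cases (z : ZMod 2) : z = 0 ∨ z = 1 := by revert z; decide
lemma sg_add (a b : ZMod 2) : sg (a + b) = sg a * sg b := by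
  have h2 : (1 + 1 : ZMod 2) = 0 := by decide
  rcases z2_cases a with rfl | rfl <;> rcases z2_cases b with rfl | rfl <;>
    simp [sg_zero, sg_one, h2]
lemma sg_sq (a : ZMod 2) : sg a * sg a = 1 := by
  rcases z2_cases a with rfl | rfl <;> simp [sg_zero, sg_one]
lemma sg_eq_one {a : ZMod 2} : sg a = 1 ↔ a = 0 := by
  rcases z2_cases a with rfl | rfl
  · simp [sg_zero]
  · rw [sg_one]; constructor
    · intro h; norm_num at h
    · intro h; exact absurd h (by decide)
lemma sg_inj : Function.Injective sg := by
  intro a b h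
  rcases z2_cases a with rfl | rfl <;> rcases z2_cases b with rfl | rfl <;>
    simp [sg_zero, sg_one] at h ⊢ <;> norm_num at h

section
variable {m : ℕ}

/-- bits of the index -/
def vv (i : Fin (2 ^ m)) : Fin m → ZMod 2 := fun j => ((((i : ℕ) / 2 ^ (j : ℕ)) % 2 : ℕ) : ZMod 2)

lemma vv_bij : Function.Bijective (vv : Fin (2 ^ m) → Fin m → ZMod 2) := by
  have e : (vv : Fin (2 ^ m) → Fin m → ZMod 2) = (finFunctionFinEquiv (m := 2) (n := m)).symm := by
    funext i j
    apply Fin.ext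
    unfold vv
    have h1 : ((finFunctionFinEquiv (m := 2) (n := m)).symm i j : ℕ) = (i : ℕ) / 2 ^ (j : ℕ) % 2 := rfl
    rw [h1]
    exact (ZMod.val_natCast 2 _).trans (Nat.mod_mod _ _)
  rw [e]
  exact Equiv.bijective _

variable {r : ℕ}

def chi (α : Kap r m) (i : Fin (2 ^ m)) : ℝ := sg (pk r α (vv i))

lemma chi_chars : Chars (Kap r m) (Fin (2 ^ m)) chi where
  sq _ _ := sg_sq _
  add k k' j := by unfold chi; rw [map_add, Pi.add_apply, sg_add]

lemma chi_eq_one {α : Kap r m} {i : Fin (2 ^ m)} : chi α i = 1 ↔ pk r α (vv i) = 0 := sg_eq_one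

lemma kc_univ : kc (chi (r := r) (m := m)) Finset.univ = 1 := by
  classical
  unfold kc
  rw [Finset.card_eq_one]
  refine ⟨0, ?_⟩
  ext k
  simp only [Finset.mem_filter, Finset.mem_univ, true_and, true_implies, Finset.mem_singleton]
  constructor
  · intro h
    apply pk_inj r
    rw [map_zero]
    ext x
    obtain ⟨i, rfl⟩ := vv_bij.2 x
    exact chi_eq_one.mp (h i)
  · rintro rfl j
    exact chi_chars.zero j

lemma kc_empty : kc (chi (r := r) (m := m)) ∅ = Fintype.card (Kap r m) := by
  classical
  unfold kc
  simp [Finset.card_univ]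

/-- half space -/
def hs (l : Fin m → ZMod 2) : Finset (Fin (2 ^ m)) := Finset.univ.filter fun i => dot l (vv i) = 0

lemma kc_half {l : Fin m → ZMod 2} (hl : l ≠ 0) (b : ZMod 2) {D : Finset (Fin (2 ^ m))}
    (hD : ∀ i ∈ D, dot l (vv i) = b) :
    2 ^ ∑ i ∈ Finset.range r, (m - 1).choose i ≤ kc (chi (r := r) (m := m)) D := by
  classical
  obtain ⟨t, ht⟩ := Function.ne_iff.mp hl
  have ht1 : l t = 1 := (z2_cases (l t)).resolve_left ht
  set A := (Finset.univ : Finset (Fin m)).erase t with hA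
  have hcA : A.card = m - 1 := by rw [hA, Finset.card_erase_of_mem (Finset.mem_univ _)]; simp
  have hcard : Fintype.card ({S : Finset (Fin m) // S ⊆ A ∧ S.card < r} → ZMod 2)
      = 2 ^ ∑ i ∈ Finset.range r, (m - 1).choose i := by
    rw [Fintype.card_fun, ZMod.card, card_sub, hcA]
  rw [← hcard]
  choose f hf using fun β : {S : Finset (Fin m) // S ⊆ A ∧ S.card < r} → ZMod 2 =>
    dot_mul_mem l b (s := Subtype.val) (fun a => a.2.2) β
  have hf' : ∀ β x, pk r (f β) x = (dot l x - b) * poly Subtype.val β x :=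
    fun β x => congrFun (hf β) x
  unfold kc
  rw [← Finset.card_univ]
  refine Finset.card_le_card_of_injOn f ?_ ?_
  · intro β _
    simp only [Finset.coe_filter, Finset.mem_univ, true_and, Set.mem_setOf_eq]
    intro i hi
    rw [chi_eq_one, hf', hD i hi, sub_self, zero_mul]
  · intro β _ β' _ h
    rw [← sub_eq_zero]
    refine poly_inj Subtype.val_injective fun x => ?_
    have psub : ∀ y, poly Subtype.val (β - β') y = poly Subtype.val β y - poly Subtype.val β' y := by
      intro y; simp [poly, sub_mul, Finset.sum_sub_distrib]
    -- choose the free coordinate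
    have hind : ∀ (γ : {S : Finset (Fin m) // S ⊆ A ∧ S.card < r} → ZMod 2) (z : ZMod 2),
        poly Subtype.val γ (Function.update x t z) = poly Subtype.val γ x := by
      intro γ z
      unfold poly
      refine Finset.sum_congr rfl fun a _ => ?_
      congr 1
      unfold mon
      refine Finset.prod_congr rfl fun j hj => ?_
      have : j ≠ t := (Finset.mem_erase.mp (a.2.1 hj)).1
      rw [Function.update_of_ne this]
    have hdot : ∀ z, dot l (Function.update x t z) = dot l (Function.update x t 0) + z := by
      intro z
      unfold dot
      rw [← Finset.add_sum_erase _ _ (Finset.mem_univ t), ← Finset.add_sum_erase Finset.univ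
        (fun j => l j * Function.update x t 0 j) (Finset.mem_univ t)]
      have : ∑ j ∈ Finset.univ.erase t, l j * Function.update x t z j
          = ∑ j ∈ Finset.univ.erase t, l j * Function.update x t 0 j :=
        Finset.sum_congr rfl fun j hj => by
          rw [Function.update_of_ne (Finset.mem_erase.mp hj).1,
            Function.update_of_ne (Finset.mem_erase.mp hj).1]
      rw [this]
      simp [ht1]
      ring
    set z := 1 + b - dot l (Function.update x t 0) with hz
    have h1 := hf' β (Function.update x t z)
    have h2 := hf' β' (Function.update x t z)
    have e1 : dot l (Function.update x t z) - b = 1 := by rw [hdot, hz]; ring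
    rw [e1, one_mul, hind] at h1 h2
    rw [psub, ← h1, ← h2, h, sub_self]

lemma logB (hm : 1 ≤ m) (l : Fin m → ZMod 2) :
    Real.log (kc (chi (r := r) (m := m)) Finset.univ) + Real.log (Fintype.card (Kap r m))
      - Real.log (kc (chi (r := r) (m := m)) (hs l)) - Real.log (kc (chi (r := r) (m := m)) (hs l)ᶜ)
      ≤ (m - 1).choose r * Real.log 2 := by
  have hl2 := log2_pos
  by_cases hl : l = 0
  · have e : hs l = Finset.univ := by subst hl; ext; simp [hs, dot]
    rw [e, Finset.compl_univ, kc_empty, kc_univ]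
    simp
    positivity
  · have k1 := kc_half (r := r) hl 0 (D := hs l) (by intro i hi; simpa [hs] using hi)
    have k2 := kc_half (r := r) hl 1 (D := (hs l)ᶜ) (by
      intro i hi
      have : dot l (vv i) ≠ 0 := by simpa [hs] using hi
      exact (z2_cases _).resolve_left this)
    have L : ∀ n k : ℕ, 2 ^ n ≤ k → (n : ℝ) * Real.log 2 ≤ Real.log k := by
      intro n k h
      rw [← Real.log_pow]
      exact Real.log_le_log (by positivity) (by exact_mod_cast h)
    have l1 := L _ _ k1
    have l2 := L _ _ k2
    rw [kc_univ, card_Kap]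
    obtain ⟨n, rfl⟩ : ∃ n, m = n + 1 := ⟨m - 1, by omega⟩
    rw [choose_split]
    rw [Nat.add_sub_cancel] at *
    push_cast at *
    rw [Real.log_pow, Real.log_one]
    push_cast
    linarith

lemma half_blk (i j : Fin (2 ^ m)) (h : j ≠ i) :
    2 * (Finset.univ.filter fun l : Fin m → ZMod 2 => j ∈ blk (hs l) i).card
      ≤ Fintype.card (Fin m → ZMod 2) := by
  have hw : vv j - vv i ≠ 0 := fun h0 => h (vv_bij.1 (sub_eq_zero.mp h0))
  refine le_trans (Nat.mul_le_mul_left _ (Finset.card_le_card ?_)) (half_dot hw)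
  intro l hl
  simp only [Finset.mem_filter, Finset.mem_univ, true_and] at hl ⊢
  have e : dot l (vv j - vv i) = dot l (vv j) - dot l (vv i) := by
    simp [dot, mul_sub, Finset.sum_sub_distrib]
  rw [e, sub_eq_zero]
  unfold blk hs at hl
  by_cases hi : dot l (vv i) = 0
  · simp [hi] at hl
    rw [hl, hi]
  · simp [hi] at hl
    rw [(z2_cases _).resolve_left hl, (z2_cases _).resolve_left hi]

/-- translation invariance -/
lemma qq_trans {α : Type*} [MeasurableSpace α] (c0 : α → ℝ)
    (lam : Measure α) [IsProbabilityMeasure lam] (i0 i1 : Fin (2 ^ m)) :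
    qq (chi (r := r)) (fun _ => c0) lam i0 (Finset.univ.erase i0)
      = qq (chi (r := r)) (fun _ => c0) lam i1 (Finset.univ.erase i1) := by
  set w := vv i1 - vv i0 with hw
  obtain ⟨ρ, hρ⟩ := exists_shift r w
  let e := Equiv.ofBijective _ (vv_bij (m := m))
  let τ : Fin (2 ^ m) ≃ Fin (2 ^ m) := e.trans ((Equiv.addRight w).trans e.symm)
  have hτ : ∀ i, vv (τ i) = vv i + w := fun i => e.apply_symm_apply _
  have hτ0 : τ i0 = i1 := by
    apply vv_bij.1; rw [hτ, hw]; abel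
  have hχ : ∀ k i, chi (ρ k) i = chi k (τ i) := by
    intro k i; unfold chi; rw [hρ, hτ]
  let E := MeasurableEquiv.arrowCongr' τ.symm (MeasurableEquiv.refl α)
  have mp : MeasurePreserving E (Measure.pi fun _ => lam) (Measure.pi fun _ => lam) :=
    measurePreserving_arrowCongr' (fun _ => lam) (fun _ => lam) τ.symm (MeasurableEquiv.refl α)
      fun _ => MeasurePreserving.id lam
  have hE : ∀ a j, E a j = a (τ j) := fun a j => rfl
  have hLL : ∀ (f g : Kap r m → ℝ), (∀ k, f (ρ k) = g k) → ∀ a,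
      LL chi (fun _ => c0) f (Finset.univ.erase i0) (E a)
        = LL chi (fun _ => c0) g (Finset.univ.erase i1) a := by
    intro f g hfg a
    unfold LL
    congr 1
    rw [← Equiv.sum_comp ρ]
    refine Finset.sum_congr rfl fun k _ => ?_
    rw [hfg]
    congr 1
    unfold W
    simp_rw [hχ, hE]
    refine Finset.prod_equiv τ ?_ (fun _ _ => rfl)
    intro j
    simp [← hτ0]
  unfold qq
  rw [← mp.integral_comp E.measurableEmbedding]
  congr 1
  ext a
  unfold ff
  rw [hLL 1 1 (fun _ => rfl), hLL (fun k => chi k i0) (fun k => chi k i1)]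
  intro k
  rw [hχ, hτ0]

end

theorem rm_core {r m : ℕ} (hm : 1 ≤ m) {α : Type*} [MeasurableSpace α] {σ : α → α} {c0 c1 : α → ℝ}
    (h0 : OddFn σ c0) (h1 : OddFn σ c1) (hs1 : ∀ p, c1 p * c1 p = 1)
    (lam : Measure α) [IsProbabilityMeasure lam] (hσ : MeasurePreserving σ lam lam)
    {C : ℝ} (hC0 : 0 < C) (hC1 : C < 1) (hH : H0 lam c0 = (1 - C) * Real.log 2)
    (hR : C < RMrate r m) (hR1 : RMrate r m - C < 1) (i : Fin (2 ^ m)) :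
    qq (chi (r := r)) (fun _ => c0) lam i (Finset.univ.erase i) * psi (1 - C)
      * psi (RMrate r m - C) ≤ 4 * Real.log 2 * (((m - 1).choose r : ℝ) / 2 ^ m) := by
  have hl2 := log2_pos
  have hq : psi (1 - C) ≤ 1 - q1 lam c0 := by
    obtain ⟨x, hx0, hx1, hxi, hxe⟩ := hbInv_spec (u := 1 - C) (by linarith) (by linarith)
    obtain ⟨t, ht0, ht⟩ := EE_tangent hx0 hx1
    have hpsi : psi (1 - C) = 1 - x ^ 2 := by unfold psi; rw [hxi]; ring
    have key : ∫ p, (1 - x ^ 2 + t * (EE x - EE (c0 p))) ∂lam ≤ ∫ p, (1 - c0 p ^ 2) ∂lam :=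
      integral_mono (((BM.const _).add ((BM.const _).mul ((BM.const _).sub
        (h0.bm.cont EE_cont)))).integrable _)
        (((BM.const _).sub (h0.bm.pow 2)).integrable _) fun p => ht _ (h0.le p)
    have b1 := h0.bm.cont EE_cont
    rw [integral_sub (integrable_const _) ((h0.bm.pow 2).integrable _),
      integral_add (integrable_const _) (((BM.const _).mul ((BM.const _).sub b1)).integrable _),
      integral_const_mul, integral_sub (integrable_const _) (b1.integrable _)] at key
    unfold H0 at hH
    rw [integral_sub (integrable_const _) (b1.integrable _)] at hH
    simp only [integral_const, probReal_univ, one_smul] at key hH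
    have : EE x - ∫ p, EE (c0 p) ∂lam = 0 := by linarith
    rw [this] at key
    unfold q1
    rw [hpsi]; linarith
  have hp1 : 0 < psi (1 - C) := psi_pos (by linarith) (by linarith)
  have hp2 : 0 < psi (RMrate r m - C) := psi_pos (by linarith) hR1
  have hq0 := qq_nonneg (cc := fun _ => c0) (chi_chars (r := r) (m := m)) (fun _ => h0) lam i
    (Finset.univ.erase i)
  have k := core (chi_chars (r := r) (m := m)) h0 h1 hs1 lam hσ (ℒ := Fin m → ZMod 2) hs
    (fun i j h => half_blk i j h) (logB hm) hq0 (fun j => (qq_trans c0 lam i j).le) (by linarith)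
    (u := RMrate r m - C) (by linarith) hR1 (by
      rw [kc_univ, card_Kap, hH, Fintype.card_fin]
      push_cast
      rw [Real.log_pow, Real.log_one]
      unfold RMrate
      have : (2 ^ m : ℝ) * ((2 ^ m : ℝ)⁻¹ * ∑ i ∈ Finset.range (r + 1), (m.choose i : ℝ))
          = ∑ i ∈ Finset.range (r + 1), (m.choose i : ℝ) := by
        rw [← mul_assoc, mul_inv_cancel₀ (by positivity), one_mul]
      push_cast
      refine le_of_eq ?_
      linear_combination (Real.log 2) * this)
  rw [Fintype.card_fin] at k
  push_cast at k
  set q := qq (chi (r := r)) (fun _ => c0) lam i (Finset.univ.erase i)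
  rw [← mul_div_assoc, le_div_iff₀ (by positivity)]
  have h6 := mul_le_mul_of_nonneg_left hq (mul_nonneg hq0 (by positivity :
    0 ≤ 2 ^ m * psi (RMrate r m - C)))
  linarith

end
end RMP

namespace RMP
set_option linter.unusedSectionVars false
set_option linter.unusedVariables false
noncomputable section

section l1
variable {ι α κ : Type*} [Fintype ι] [DecidableEq ι] [MeasurableSpace α]
  [AddCommGroup κ] [Fintype κ]
variable {χ : κ → ι → ℝ} {c0 : α → ℝ}
variable {σ : α → α}

lemma abs_pair {n d c : ℝ} (h : |n| ≤ d) (hc : |c| ≤ 1) :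
    (|n + c * d| + |n + -c * d|) / 2 ≤ |c| * d + |n| * (1 - |c|) := by
  have h1 := neg_abs_le n
  have h2 := le_abs_self n
  have h3 : |n| * |c| ≤ |n| := mul_le_of_le_one_right (abs_nonneg _) hc
  have hd : 0 ≤ d := (abs_nonneg _).trans h
  have h5 : |n| * |c| ≤ d * |c| := mul_le_mul_of_nonneg_right h (abs_nonneg _)
  have h6 : |c * d| = |c| * d := by rw [abs_mul, abs_of_nonneg hd]
  have hm : (|n + c * d| + |n + -c * d|) / 2 ≤ max |n| |c * d| := by
    rw [neg_mul, ← sub_eq_add_neg]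
    have a1 := le_max_left |n| |c * d|
    have a2 := le_max_right |n| |c * d|
    have := neg_abs_le (c * d)
    have := le_abs_self (c * d)
    rcases abs_cases (n + c * d) with ⟨e, _⟩ | ⟨e, _⟩ <;>
      rcases abs_cases (n - c * d) with ⟨e', _⟩ | ⟨e', _⟩ <;> rw [e, e'] <;> linarith
  refine hm.trans (max_le ?_ ?_)
  · linarith
  · rw [h6]; linarith

lemma l1_bound (hχ : Chars κ ι χ) (h0 : OddFn σ c0)
    (lam : Measure α) [IsProbabilityMeasure lam] (hσ : MeasurePreserving σ lam lam) (i : ι) :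
    ∫ a, |LL χ (fun _ => c0) (fun k => χ k i) Finset.univ a| ∂(Measure.pi fun _ => lam)
      ≤ ∫ p, |c0 p| ∂lam + (1 - ∫ p, |c0 p| ∂lam)
        * Real.sqrt (qq χ (fun _ => c0) lam i (Finset.univ.erase i)) := by
  have hc : ∀ j : ι, OddFn σ ((fun _ => c0) j) := fun _ => h0
  set U := (Finset.univ : Finset ι).erase i with hU
  set n := LL χ (fun _ => c0) (fun k => χ k i) U with hn
  set d := LL χ (fun _ => c0) 1 U with hd
  set f := ff χ (fun _ => c0) i U with hf
  set A := ∫ p, |c0 p| ∂lam with hA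
  have bn : BM n := LL_bm hχ hc _ U
  have bd : BM d := LL_bm hχ hc _ U
  have bf : BM f := ff_bm hχ hc i U
  have hnd : ∀ a, |n a| ≤ d a := LL_chi_le hχ hc i U
  have hd1 : ∫ a, d a ∂(Measure.pi fun _ => lam) = 1 := integral_LL hχ hc lam hσ U
  have hd0 : ∀ a, 0 ≤ d a := LL_nonneg hχ hc U
  have hfn : ∀ a, f a * d a = n a := ff_mul hχ hc i U
  have hA1 : A ≤ 1 := by
    have : A ≤ ∫ p, (1 : ℝ) ∂lam := integral_mono (h0.bm.abs.integrable _) (integrable_const _) h0.le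
    simpa using this
  have e : ∀ a, LL χ (fun _ => c0) (fun k => χ k i) Finset.univ a = n a + c0 (a i) * d a := by
    intro a
    rw [LL_split (Finset.mem_univ i)]
    have : (fun k => χ k i * χ k i) = (1 : κ → ℝ) := by ext k; exact hχ.sq k i
    rw [this]
  simp_rw [e]
  have bG : BM fun a : ι → α => |n a + c0 (a i) * d a| :=
    (bn.add ((h0.bm.comp (measurable_pi_apply i)).mul bd)).abs
  have step1 := integral_one lam (D := U) (i := i) (by simp [hU]) (G := fun a p => |n a + c0 p * d a|) bG
    (fun a => (((BM.const (n a)).add (h0.bm.mul (BM.const (d a)))).abs).1)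
    (fun a b hab => by
      have h1 : n a = n b := LL_dep _ U a b hab
      have h2 : d a = d b := LL_dep _ U a b hab
      funext p; rw [h1, h2])
  rw [step1]
  have step2 : ∀ a, ∫ p, |n a + c0 p * d a| ∂lam ≤ A * d a + (1 - A) * |n a| := by
    intro a
    have b1 : ∀ s : ℝ, BM fun p => |n a + s * c0 p * d a| := fun s =>
      ((BM.const (n a)).add (((BM.const s).mul h0.bm).mul (BM.const (d a)))).abs
    have b2 := b1 1
    have b3 := b1 (-1)
    simp only [one_mul, neg_mul] at b2 b3
    rw [integral_symm lam hσ h0 (g := fun t => |n a + t * d a|) b2]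
    have : ∫ p, (|n a + c0 p * d a| + |n a + -c0 p * d a|) / 2 ∂lam
        ≤ ∫ p, (|c0 p| * d a + |n a| * (1 - |c0 p|)) ∂lam := by
      refine integral_mono ?_ ?_ fun p => abs_pair (hnd a) (h0.le p)
      · have := ((b2.add b3).mul (BM.const (1 / 2))).integrable lam
        refine this.congr (Filter.Eventually.of_forall fun p => ?_)
        simp only [neg_mul]; ring
      · exact ((h0.bm.abs.mul (BM.const _)).add ((BM.const _).mul
          ((BM.const 1).sub h0.bm.abs))).integrable _
    refine this.trans (le_of_eq ?_)
    rw [integral_add ((h0.bm.abs.mul (BM.const _)).integrable _) (((BM.const _).mul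
          ((BM.const 1).sub h0.bm.abs)).integrable _), integral_mul_const, integral_const_mul,
      integral_sub (integrable_const _) (h0.bm.abs.integrable _)]
    simp
    ring
  set s := ∫ a, |n a| ∂(Measure.pi fun _ => lam) with hs
  have step3 : s ≤ Real.sqrt (qq χ (fun _ => c0) lam i U) := by
    apply Real.le_sqrt_of_sq_le
    have e1 : ∀ a, |n a| = |f a| * d a := by
      intro a; rw [← hfn a, abs_mul, abs_of_nonneg (hd0 a)]
    have b4 : BM fun a => f a ^ 2 * d a := (bf.pow 2).mul bd
    have h3 : 0 ≤ ∫ a, (f a ^ 2 * d a - 2 * s * |n a| + s ^ 2 * d a) ∂(Measure.pi fun _ => lam) := by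
      refine integral_nonneg fun a => ?_
      simp only [Pi.zero_apply]
      rw [e1, ← sq_abs (f a)]
      have := mul_nonneg (sq_nonneg (|f a| - s)) (hd0 a)
      linarith
    rw [integral_add ((b4.sub ((BM.const _).mul bn.abs)).integrable _) (((BM.const _).mul bd).integrable _),
      integral_sub (b4.integrable _) (((BM.const _).mul bn.abs).integrable _),
      integral_const_mul, integral_const_mul, hd1, ← hs] at h3
    unfold qq
    linarith
  calc _ ≤ ∫ a, (A * d a + (1 - A) * |n a|) ∂(Measure.pi fun _ => lam) := by
        refine integral_mono_of_nonneg ?_ ?_ ?_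
        · exact Filter.Eventually.of_forall fun a => integral_nonneg fun p => abs_nonneg _
        · exact (((BM.const _).mul bd).add ((BM.const _).mul bn.abs)).integrable _
        · exact Filter.Eventually.of_forall step2
    _ = A + (1 - A) * s := by
        rw [integral_add (((BM.const _).mul bd).integrable _) (((BM.const _).mul bn.abs).integrable _),
          integral_const_mul, integral_const_mul, hd1, mul_one]
    _ ≤ _ := by
        have := mul_le_mul_of_nonneg_left step3 (sub_nonneg.mpr hA1)
        linarith
end l1

section cond
variable {Ω β : Type*} [MeasurableSpace Ω] [MeasurableSpace β]

lemma cond_pull (μ : Measure Ω) [IsProbabilityMeasure μ] {X : Ω → ℝ} (hX : Integrable X μ)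
    {V : Ω → β} (hV : Measurable V) {s : β → ℝ} (hs : BM s) :
    ∫ ω, condMean μ X V ω * s (V ω) ∂μ = ∫ ω, X ω * s (V ω) ∂μ := by
  obtain ⟨hsm, K, hK⟩ := hs
  have hm : MeasurableSpace.comap V inferInstance ≤ (inferInstance : MeasurableSpace Ω) :=
    hV.comap_le
  have hst : StronglyMeasurable[MeasurableSpace.comap V inferInstance] (fun ω => s (V ω)) :=
    (hsm.comp (comap_measurable V)).stronglyMeasurable
  have hIntg : Integrable (X * fun ω => s (V ω)) μ :=
    hX.mul_bdd (c := K) (hsm.comp hV).aestronglyMeasurable (Filter.Eventually.of_forall fun ω => hK _)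
  have h := condExp_mul_of_stronglyMeasurable_right hst hIntg hX
  have h2 := integral_congr_ae h
  rw [integral_condExp hm] at h2
  exact h2.symm

lemma cond_sgn (μ : Measure Ω) [IsProbabilityMeasure μ] {X : Ω → ℝ} (hX : Integrable X μ)
    {V : Ω → β} (hV : Measurable V) :
    ∃ s : β → ℝ, Measurable s ∧ (∀ b, |s b| ≤ 1) ∧
      ∫ ω, |condMean μ X V ω| ∂μ = ∫ ω, X ω * s (V ω) ∂μ := by
  have h1 : StronglyMeasurable[MeasurableSpace.comap V inferInstance] (condMean μ X V) :=
    stronglyMeasurable_condExp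
  obtain ⟨g, hg, hgV⟩ := h1.exists_eq_measurable_comp
  have hms : Measurable fun b => (if 0 ≤ g b then (1 : ℝ) else -1) :=
    Measurable.ite (measurableSet_le measurable_const hg.measurable) measurable_const measurable_const
  have hb : ∀ b, |(if 0 ≤ g b then (1 : ℝ) else -1)| ≤ 1 := by
    intro b; split_ifs <;> simp
  refine ⟨fun b => if 0 ≤ g b then 1 else -1, hms, hb, ?_⟩
  rw [← cond_pull μ hX hV ⟨hms, 1, hb⟩]
  congr 1; ext ω
  rw [hgV]
  simp only [Function.comp]
  split_ifs with h
  · rw [abs_of_nonneg h, mul_one]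
  · rw [abs_of_neg (not_le.mp h), mul_neg_one]

lemma cond_le (μ : Measure Ω) [IsProbabilityMeasure μ] {X : Ω → ℝ} (hX : Integrable X μ)
    {V : Ω → β} (hV : Measurable V) {s : β → ℝ} (hs : Measurable s) (hs1 : ∀ b, |s b| ≤ 1) :
    ∫ ω, X ω * s (V ω) ∂μ ≤ ∫ ω, |condMean μ X V ω| ∂μ := by
  rw [← cond_pull μ hX hV ⟨hs, 1, hs1⟩]
  have hi : Integrable (condMean μ X V) μ := integrable_condExp
  refine integral_mono (hi.mul_bdd (c := 1) (hs.comp hV).aestronglyMeasurable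
    (Filter.Eventually.of_forall fun ω => hs1 _)) hi.abs fun ω => ?_
  refine (le_abs_self _).trans ?_
  rw [abs_mul]
  exact mul_le_of_le_one_right (abs_nonneg _) (hs1 _)
end cond

end
end RMP

namespace RMP
set_option linter.unusedSectionVars false
set_option linter.unusedVariables false
noncomputable section

def s1 (x : ℝ) : ℝ := if 0 < x then 1 else -1

lemma s1_meas : Measurable s1 :=
  Measurable.ite measurableSet_Ioi measurable_const measurable_const
lemma s1_abs (x : ℝ) : |s1 x| ≤ 1 := by unfold s1; split_ifs <;> simp
lemma s1_sq (x : ℝ) : s1 x * s1 x = 1 := by unfold s1; split_ifs <;> simp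
lemma s1_one : s1 1 = 1 := by simp [s1]
lemma s1_neg_one : s1 (-1) = -1 := by unfold s1; norm_num
lemma s1_odd (x : ℝ) : s1 (-(s1 x)) = - s1 x := by
  unfold s1; split_ifs <;> norm_num at *

def yy (p : ℝ × ℝ) : ℝ := s1 p.1 * p.2
lemma yy_meas : Measurable yy := (s1_meas.comp measurable_fst).mul measurable_snd

def sig (p : ℝ × ℝ) : ℝ × ℝ := (-(s1 p.1), p.2)
lemma sig_meas : Measurable sig := ((s1_meas.comp measurable_fst).neg).prodMk measurable_snd

variable (PZ : Measure ℝ) [IsProbabilityMeasure PZ]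

def lamm : Measure (ℝ × ℝ) := signMeasure.prod PZ

lemma lamm_eq : lamm PZ = (2 : ENNReal)⁻¹ • (PZ.map (Prod.mk (-1)) + PZ.map (Prod.mk 1)) := by
  unfold lamm signMeasure
  rw [Measure.prod_smul_left, Measure.add_prod, Measure.dirac_prod, Measure.dirac_prod]

lemma map_prob (x : ℝ) : IsProbabilityMeasure (PZ.map (Prod.mk x)) :=
  Measure.isProbabilityMeasure_map measurable_prodMk_left.aemeasurable

instance lamm_prob : IsProbabilityMeasure (lamm PZ) := by
  have := map_prob PZ (-1)
  have := map_prob PZ 1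
  constructor
  rw [lamm_eq]
  simp only [Measure.smul_apply, Measure.add_apply, measure_univ, smul_eq_mul]
  rw [one_add_one_eq_two]
  exact ENNReal.inv_mul_cancel (by norm_num) (by norm_num)

lemma int_lam {F : ℝ × ℝ → ℝ} (hF : BM F) :
    ∫ p, F p ∂(lamm PZ) = (∫ z, F (-1, z) ∂PZ + ∫ z, F (1, z) ∂PZ) / 2 := by
  have := map_prob PZ (-1)
  have := map_prob PZ 1
  rw [lamm_eq, integral_smul_measure, integral_add_measure (hF.integrable _) (hF.integrable _),
    integral_map measurable_prodMk_left.aemeasurable hF.1.aestronglyMeasurable,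
    integral_map measurable_prodMk_left.aemeasurable hF.1.aestronglyMeasurable]
  simp
  ring

lemma ae_lam : ∀ᵐ p ∂(lamm PZ), s1 p.1 = p.1 := by
  rw [lamm_eq]
  have hms : MeasurableSet {p : ℝ × ℝ | s1 p.1 = p.1} :=
    measurableSet_eq_fun (s1_meas.comp measurable_fst) measurable_fst
  refine Measure.ae_smul_measure ?_ _
  rw [ae_add_measure_iff]
  constructor
  · rw [ae_map_iff measurable_prodMk_left.aemeasurable hms]
    exact Filter.Eventually.of_forall fun z => s1_neg_one
  · rw [ae_map_iff measurable_prodMk_left.aemeasurable hms]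
    exact Filter.Eventually.of_forall fun z => s1_one

lemma sig_mp : MeasurePreserving sig (lamm PZ) (lamm PZ) := by
  refine ⟨sig_meas, ?_⟩
  rw [lamm_eq, Measure.map_smul, Measure.map_add _ _ sig_meas,
    Measure.map_map sig_meas measurable_prodMk_left,
    Measure.map_map sig_meas measurable_prodMk_left, add_comm]
  have e1 : sig ∘ Prod.mk (-1) = Prod.mk 1 := by
    funext z; simp [sig, s1_neg_one]
  have e2 : sig ∘ Prod.mk 1 = Prod.mk (-1) := by
    funext z; simp [sig, s1_one]
  rw [e1, e2]

lemma fst_int : Integrable (fun q : ℝ × ℝ => q.1) (lamm PZ) := by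
  have b : BM fun q : ℝ × ℝ => s1 q.1 := ⟨s1_meas.comp measurable_fst, 1, fun q => s1_abs _⟩
  exact (b.integrable _).congr (ae_lam PZ)

lemma cond_channel {f : ℝ → ℝ} (hf : BM f) :
    ∫ p, condMean (lamm PZ) (fun q : ℝ × ℝ => q.1) (fun q : ℝ × ℝ => q.1 * q.2) p * f (p.1 * p.2)
      ∂(lamm PZ) = (∫ z, f z ∂PZ - ∫ z, f (-z) ∂PZ) / 2 := by
  rw [cond_pull (lamm PZ) (fst_int PZ) (V := fun q : ℝ × ℝ => q.1 * q.2) (measurable_fst.mul measurable_snd) hf]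
  have b : BM fun q : ℝ × ℝ => s1 q.1 * f (yy q) :=
    BM.mul ⟨s1_meas.comp measurable_fst, 1, fun q => s1_abs _⟩ (hf.comp yy_meas)
  have e : ∫ p : ℝ × ℝ, p.1 * f (p.1 * p.2) ∂(lamm PZ) = ∫ p, s1 p.1 * f (yy p) ∂(lamm PZ) := by
    refine integral_congr_ae ?_
    filter_upwards [ae_lam PZ] with p hp
    unfold yy
    rw [hp]
  rw [e, int_lam PZ b]
  simp only [yy, s1_one, s1_neg_one, one_mul, neg_mul, integral_neg]
  ring

lemma exists_a : ∃ a : ℝ → ℝ, Measurable a ∧ (∀ y, |a y| ≤ 1) ∧ (∀ y, a (-y) = - a y) ∧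
    condMean (lamm PZ) (fun q : ℝ × ℝ => q.1) (fun q : ℝ × ℝ => q.1 * q.2)
      =ᵐ[lamm PZ] fun p => a (yy p) := by
  set cm := condMean (lamm PZ) (fun q : ℝ × ℝ => q.1) (fun q : ℝ × ℝ => q.1 * q.2) with hcm
  have hst : StronglyMeasurable[MeasurableSpace.comap (fun q : ℝ × ℝ => q.1 * q.2) inferInstance] cm :=
    stronglyMeasurable_condExp
  obtain ⟨g, hg, hgV⟩ := hst.exists_eq_measurable_comp
  have hbd : ∀ᵐ p ∂(lamm PZ), |cm p| ≤ 1 := by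
    refine ae_bdd_condExp_of_ae_bdd (R := 1) ?_
    filter_upwards [ae_lam PZ] with p hp
    rw [← hp]; exact s1_abs _
  set a1 : ℝ → ℝ := fun y => max (-1) (min 1 (g y)) with ha1
  have ma1 : Measurable a1 := measurable_const.max (measurable_const.min hg.measurable)
  have ba1 : ∀ y, |a1 y| ≤ 1 := fun y => by
    rw [abs_le]; exact ⟨le_max_left _ _, max_le (by norm_num) (min_le_left _ _)⟩
  have b1 : BM a1 := ⟨ma1, 1, ba1⟩
  have hcm1 : cm =ᵐ[lamm PZ] fun p => a1 (yy p) := by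
    filter_upwards [ae_lam PZ, hbd] with p hp hb
    unfold yy
    rw [hp]
    rw [hgV] at hb ⊢
    simp only [Function.comp] at hb ⊢
    rw [abs_le] at hb
    simp only [ha1]
    rw [min_eq_right hb.2, max_eq_right hb.1]
  set e : ℝ → ℝ := fun y => a1 y + a1 (-y) with he
  have be : BM e := b1.add (b1.comp measurable_neg)
  have heven : ∀ y, e (-y) = e y := fun y => by simp only [he, neg_neg]; ring
  have h1 : ∫ p, a1 (yy p) * e (yy p) ∂(lamm PZ) = 0 := by
    have h2 := cond_channel PZ be
    simp_rw [heven] at h2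
    rw [sub_self, zero_div] at h2
    rw [← h2]
    refine integral_congr_ae ?_
    filter_upwards [ae_lam PZ, hcm1] with p hp hc
    rw [← hcm, hc]
    unfold yy
    rw [hp]
  rw [int_lam PZ ((b1.mul be).comp yy_meas)] at h1
  simp only [yy, s1_one, s1_neg_one, one_mul, neg_mul, heven] at h1
  have h3 : ∫ z, e z ^ 2 ∂PZ = 0 := by
    have : ∀ z, e z ^ 2 = a1 (-z) * e z + a1 z * e z := fun z => by simp only [he]; ring
    simp_rw [this]
    rw [integral_add (((b1.comp measurable_neg).mul be).integrable _) ((b1.mul be).integrable _)]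
    linarith
  have h4 : ∀ᵐ z ∂PZ, e z = 0 := by
    have := (integral_eq_zero_iff_of_nonneg (fun z => sq_nonneg (e z)) ((be.pow 2).integrable PZ)).mp h3
    filter_upwards [this] with z hz
    exact pow_eq_zero_iff (two_ne_zero) |>.mp hz
  have h5 : ∀ᵐ p ∂(lamm PZ), e p.2 = 0 := Measure.quasiMeasurePreserving_snd.ae h4
  refine ⟨fun y => (a1 y - a1 (-y)) / 2, (ma1.sub (ma1.comp measurable_neg)).div_const 2, ?_, ?_, ?_⟩
  · intro y
    have u1 := abs_le.mp (ba1 y)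
    have u2 := abs_le.mp (ba1 (-y))
    rw [abs_le]; constructor <;> linarith [u1.1, u1.2, u2.1, u2.2]
  · intro y; simp only [neg_neg]; ring
  · filter_upwards [hcm1, h5] with p hp h0
    rw [hp]
    have : e (yy p) = 0 := by
      unfold yy s1
      split_ifs
      · rw [one_mul]; exact h0
      · rw [neg_one_mul, heven]; exact h0
    simp only [he] at this
    linarith

section
variable {PZ} {a : ℝ → ℝ}

lemma c0_odd (ma : Measurable a) (ba : ∀ y, |a y| ≤ 1) (oa : ∀ y, a (-y) = - a y) :
    OddFn sig (fun p => a (yy p)) where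
  meas := ma.comp yy_meas
  le p := ba _
  odd p := by
    rw [← oa]; congr 1; unfold yy sig; simp only [s1_odd]; ring

lemma c1_odd : OddFn sig (fun p : ℝ × ℝ => s1 p.1) where
  meas := s1_meas.comp measurable_fst
  le p := s1_abs _
  odd p := s1_odd _

lemma KI (ma : Measurable a) (ba : ∀ y, |a y| ≤ 1)
    (hcm : condMean (lamm PZ) (fun q : ℝ × ℝ => q.1) (fun q : ℝ × ℝ => q.1 * q.2)
      =ᵐ[lamm PZ] fun p => a (yy p)) {x : ℝ} (hx : x = 1 ∨ x = -1) {f : ℝ → ℝ} (hf : BM f) :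
    ∫ p, f (yy p) * (1 + x * a (yy p)) ∂(lamm PZ) = ∫ z, f (x * z) ∂PZ := by
  have b1 : BM a := ⟨ma, 1, ba⟩
  have h1 : ∫ p, a (yy p) * f (yy p) ∂(lamm PZ) = (∫ z, f z ∂PZ - ∫ z, f (-z) ∂PZ) / 2 := by
    rw [← cond_channel PZ hf]
    refine integral_congr_ae ?_
    filter_upwards [ae_lam PZ, hcm] with p hp hc
    rw [hc]; unfold yy; rw [hp]
  have h2 : ∫ p, f (yy p) ∂(lamm PZ) = (∫ z, f z ∂PZ + ∫ z, f (-z) ∂PZ) / 2 := by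
    rw [int_lam PZ (hf.comp yy_meas)]
    simp only [yy, s1_one, s1_neg_one, one_mul, neg_mul]
    ring
  have e : ∀ p, f (yy p) * (1 + x * a (yy p)) = f (yy p) + x * (a (yy p) * f (yy p)) :=
    fun p => by ring
  simp_rw [e]
  rw [integral_add ((hf.comp yy_meas).integrable _) (((BM.const x).mul
    ((b1.comp yy_meas).mul (hf.comp yy_meas))).integrable _), integral_const_mul, h1, h2]
  rcases hx with rfl | rfl
  · simp only [one_mul]; ring
  · simp only [neg_mul, one_mul]; ring

lemma H0_cap (ma : Measurable a) (ba : ∀ y, |a y| ≤ 1)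
    (hcm : condMean (lamm PZ) (fun q : ℝ × ℝ => q.1) (fun q : ℝ × ℝ => q.1 * q.2)
      =ᵐ[lamm PZ] fun p => a (yy p)) :
    H0 (lamm PZ) (fun p => a (yy p)) = (1 - capacity PZ) * Real.log 2 := by
  unfold capacity
  change _ = (1 - (1 - ∫ p, hb ((1 + condMean (lamm PZ) (fun q : ℝ × ℝ => q.1)
    (fun q : ℝ × ℝ => q.1 * q.2) p) / 2) ∂(lamm PZ))) * Real.log 2
  have : ∫ p, hb ((1 + condMean (lamm PZ) (fun q : ℝ × ℝ => q.1)
      (fun q : ℝ × ℝ => q.1 * q.2) p) / 2) ∂(lamm PZ)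
      = ∫ p, (Real.log 2 - EE (a (yy p))) / Real.log 2 ∂(lamm PZ) := by
    refine integral_congr_ae ?_
    filter_upwards [hcm] with p hp
    rw [hp, hb_eq_EE]
  rw [this, integral_div]
  unfold H0
  have := log2_pos
  field_simp
  ring

/-- one-dimensional change of measure -/
lemma map_eq (ma : Measurable a) (ba : ∀ y, |a y| ≤ 1)
    (hcm : condMean (lamm PZ) (fun q : ℝ × ℝ => q.1) (fun q : ℝ × ℝ => q.1 * q.2)
      =ᵐ[lamm PZ] fun p => a (yy p)) {x : ℝ} (hx : x = 1 ∨ x = -1) :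
    ((lamm PZ).withDensity fun p => ENNReal.ofReal (1 + x * a (yy p))).map yy
      = PZ.map (fun z => x * z) := by
  ext E hE
  have bf : BM (E.indicator (fun _ => (1 : ℝ))) :=
    ⟨measurable_const.indicator hE, 1, fun y => by
      by_cases h : y ∈ E <;> simp [h]⟩
  have hk := KI ma ba hcm hx bf
  have hnn : ∀ p, 0 ≤ 1 + x * a (yy p) := by
    intro p
    have := abs_le.mp (ba (yy p))
    rcases hx with rfl | rfl <;> linarith [this.1, this.2]
  have bd : BM fun p => E.indicator (fun _ => (1 : ℝ)) (yy p) * (1 + x * a (yy p)) :=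
    (bf.comp yy_meas).mul ((BM.const 1).add ((BM.const x).mul (BM.comp ⟨ma, 1, ba⟩ yy_meas)))
  rw [Measure.map_apply yy_meas hE, Measure.map_apply (measurable_const_mul x) hE,
    withDensity_apply _ (yy_meas hE), ← lintegral_indicator (yy_meas hE)]
  have e1 : ∀ p, (yy ⁻¹' E).indicator (fun p => ENNReal.ofReal (1 + x * a (yy p))) p
      = ENNReal.ofReal (E.indicator (fun _ => (1 : ℝ)) (yy p) * (1 + x * a (yy p))) := by
    intro p
    by_cases h : yy p ∈ E
    · rw [Set.indicator_of_mem (show p ∈ yy ⁻¹' E from h), Set.indicator_of_mem h, one_mul]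
    · rw [Set.indicator_of_notMem (show p ∉ yy ⁻¹' E from h), Set.indicator_of_notMem h, zero_mul]
      simp
  simp_rw [e1]
  rw [← ofReal_integral_eq_lintegral_ofReal (bd.integrable _) (Filter.Eventually.of_forall fun p =>
    mul_nonneg (Set.indicator_nonneg (fun _ _ => zero_le_one) _) (hnn p)), hk]
  have e2 : ∀ z, E.indicator (fun _ => (1 : ℝ)) (x * z)
      = ((fun z => x * z) ⁻¹' E).indicator (fun _ => (1 : ℝ)) z := fun z => rfl
  simp_rw [e2]
  rw [integral_indicator_const _ (measurable_const_mul x hE)]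
  simp

/-- change of measure for a word -/
lemma word_int {ι κ : Type*} [Fintype ι] [DecidableEq ι] [AddCommGroup κ] [Fintype κ]
    {χ : κ → ι → ℝ} (hχ : Chars κ ι χ)
    (ma : Measurable a) (ba : ∀ y, |a y| ≤ 1) (oa : ∀ y, a (-y) = - a y)
    (hcm : condMean (lamm PZ) (fun q : ℝ × ℝ => q.1) (fun q : ℝ × ℝ => q.1 * q.2)
      =ᵐ[lamm PZ] fun p => a (yy p)) (k : κ) {s : (ι → ℝ) → ℝ} (hs : Measurable s) :
    ∫ z, s (fun j => χ k j * z j) ∂(Measure.pi fun _ => PZ)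
      = ∫ p, s (fun j => yy (p j)) * W χ (fun _ p => a (yy p)) Finset.univ k p
        ∂(Measure.pi fun _ => lamm PZ) := by
  set cc : ι → ℝ × ℝ → ℝ := fun j p => χ k j * a (yy p) with hcc
  have h0 := c0_odd ma ba oa
  have hc : ∀ j, OddFn sig (cc j) := by
    intro j
    refine ⟨h0.meas.const_mul _, fun p => ?_, fun p => ?_⟩
    · rw [abs_mul, hχ.abs, one_mul]; exact ba _
    · simp only [hcc]; rw [h0.odd]; ring
  have hp := Pp_prob hc (lamm PZ) (sig_mp PZ)
  have hm : ∀ j, IsProbabilityMeasure (PZ.map (fun z => χ k j * z)) := fun j =>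
    Measure.isProbabilityMeasure_map (measurable_const_mul _).aemeasurable
  have mp1 := measurePreserving_pi (fun _ : ι => PZ) (fun j => PZ.map (fun z => χ k j * z))
    (f := fun j z => χ k j * z) fun j => ⟨measurable_const_mul _, rfl⟩
  have mp2 := measurePreserving_pi (Pp cc (lamm PZ)) (fun j => PZ.map (fun z => χ k j * z))
    (f := fun j => yy) fun j => ⟨yy_meas, map_eq ma ba hcm (hχ.cases k j)⟩
  have i1 := integral_map (μ := Measure.pi fun _ : ι => PZ) mp1.measurable.aemeasurable (f := s) hs.aestronglyMeasurable
  have i2 := integral_map (μ := Measure.pi (Pp cc (lamm PZ))) mp2.measurable.aemeasurable (f := s) hs.aestronglyMeasurable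
  rw [mp1.map_eq] at i1
  rw [mp2.map_eq, integral_Pp hχ hc (lamm PZ) (sig_mp PZ)] at i2
  rw [← i1, i2]
  congr 1; ext p
  congr 1
  unfold W
  simp only [hcc, hχ.zero, one_mul]
end

end
end RMP

namespace RMP
set_option linter.unusedSectionVars false
set_option linter.unusedVariables false
noncomputable section

lemma chi_inj (r m : ℕ) : Function.Injective (chi : Kap r m → Fin (2 ^ m) → ℝ) := by
  intro α β h
  apply pk_inj r
  funext x
  obtain ⟨i, rfl⟩ := vv_bij.2 x
  exact sg_inj (congrFun h i)

lemma pk_word (r m : ℕ) (α : Finset (Fin m) → ZMod 2) (i : Fin (2 ^ m)) :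
    RMword r m α i = pk r (fun S : {S : Finset (Fin m) // S.card ≤ r} => α S.1) (vv i) := by
  have e : pk r (fun S : {S : Finset (Fin m) // S.card ≤ r} => α S.1) (vv i)
      = ∑ S : {S : Finset (Fin m) // S.card ≤ r}, α S.1 * mon S.1 (vv i) := rfl
  rw [e]
  unfold RMword
  exact Finset.sum_subtype (F := inferInstance) (p := fun S : Finset (Fin m) => S.card ≤ r) _
    (fun S => by simp) (fun S => α S * mon S (vv i))

lemma mem_bpskRM (r m : ℕ) (x : Fin (2 ^ m) → ℝ) :
    x ∈ bpskRM r m ↔ ∃ k : Kap r m, chi k = x := by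
  classical
  unfold bpskRM bpskImage RMcode
  simp only [Finset.mem_image, Finset.mem_univ, true_and]
  constructor
  · rintro ⟨c, ⟨α, rfl⟩, rfl⟩
    refine ⟨fun S => α S.1, ?_⟩
    funext i
    change sg (pk r _ (vv i)) = (-1 : ℝ) ^ (RMword r m α i).val
    rw [pk_word]; rfl
  · rintro ⟨k, rfl⟩
    refine ⟨_, ⟨fun S => if h : S.card ≤ r then k ⟨S, h⟩ else 0, rfl⟩, ?_⟩
    funext i
    change (-1 : ℝ) ^ (RMword r m _ i).val = sg (pk r k (vv i))
    rw [pk_word]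
    have e : (fun S : {S : Finset (Fin m) // S.card ≤ r} =>
        if h : S.1.card ≤ r then k ⟨S.1, h⟩ else 0) = k := by
      funext S
      simp [S.2]
    rw [e]
    rfl

lemma bpskRM_eq (r m : ℕ) :
    bpskRM r m = (Finset.univ : Finset (Kap r m)).map ⟨chi, chi_inj r m⟩ := by
  ext x
  rw [mem_bpskRM]
  simp

lemma uni_eq (r m : ℕ) :
    uniformOnFinset (bpskRM r m)
      = (Fintype.card (Kap r m) : ENNReal)⁻¹ • ∑ k : Kap r m, Measure.dirac (chi k) := by
  unfold uniformOnFinset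
  rw [bpskRM_eq, Finset.card_map, Finset.sum_map]
  rfl

lemma sum_prod_dirac {κ A B : Type*} [MeasurableSpace A] [MeasurableSpace B] (s : Finset κ)
    (f : κ → A) (ν : Measure B) [IsProbabilityMeasure ν] :
    (∑ k ∈ s, Measure.dirac (f k)).prod ν = ∑ k ∈ s, ν.map (Prod.mk (f k)) := by
  classical
  induction s using Finset.induction_on with
  | empty => simp
  | insert a s ha ih =>
    rw [Finset.sum_insert ha, Finset.sum_insert ha]
    have : IsFiniteMeasure (∑ k ∈ s, Measure.dirac (f k)) := inferInstance
    rw [Measure.add_prod, ih, Measure.dirac_prod]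

lemma int_law {r m : ℕ} {PZ : Measure ℝ} [IsProbabilityMeasure PZ]
    {F : (Fin (2 ^ m) → ℝ) × (Fin (2 ^ m) → ℝ) → ℝ} (hF : BM F) :
    ∫ q, F q ∂((uniformOnFinset (bpskRM r m)).prod (Measure.pi fun _ => PZ))
      = (Fintype.card (Kap r m) : ℝ)⁻¹ * ∑ k : Kap r m,
        ∫ z, F (chi k, z) ∂(Measure.pi fun _ => PZ) := by
  rw [uni_eq, Measure.prod_smul_left, sum_prod_dirac, integral_smul_measure,
    integral_finsetSum_measure]
  · simp only [ENNReal.toReal_inv, ENNReal.toReal_natCast, smul_eq_mul]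
    congr 1
    refine Finset.sum_congr rfl fun k _ => ?_
    exact integral_map (measurable_prodMk_left).aemeasurable hF.meas.aestronglyMeasurable
  · intro k _
    have : IsProbabilityMeasure ((Measure.pi fun _ : Fin (2 ^ m) => PZ).map (Prod.mk (chi k : Fin (2 ^ m) → ℝ))) :=
      Measure.isProbabilityMeasure_map (measurable_prodMk_left).aemeasurable
    exact hF.integrable _

section
variable {Ω : Type*} [MeasurableSpace Ω] {μ : Measure Ω} [IsProbabilityMeasure μ]
  {PZ : Measure ℝ} [IsProbabilityMeasure PZ] {r m : ℕ} {X Z : Ω → (Fin (2 ^ m) → ℝ)}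

/-- truncation to `[-1,1]` -/
def trn (x : ℝ) : ℝ := max (-1) (min 1 x)
lemma trn_meas : Measurable trn := (continuous_const.max (continuous_const.min continuous_id)).measurable
lemma trn_abs (x : ℝ) : |trn x| ≤ 1 := by
  unfold trn
  rw [abs_le]
  exact ⟨le_max_left _ _, max_le (by norm_num) (min_le_left _ _)⟩
lemma trn_sg (z : ZMod 2) : trn (sg z) = sg z := by
  unfold trn
  rcases z2_cases z with rfl | rfl <;> simp [sg_zero, sg_one]

lemma ae_X (hX : Measurable X) (hZ : Measurable Z)
    (hlaw : Measure.map (fun ω => (X ω, Z ω)) μ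
        = (uniformOnFinset (bpskRM r m)).prod (Measure.pi fun _ => PZ)) :
    ∀ᵐ ω ∂μ, ∀ i, X ω i = trn (X ω i) := by
  have hms : MeasurableSet {q : (Fin (2 ^ m) → ℝ) × (Fin (2 ^ m) → ℝ) | ∀ i, q.1 i = trn (q.1 i)} := by
    have : {q : (Fin (2 ^ m) → ℝ) × (Fin (2 ^ m) → ℝ) | ∀ i, q.1 i = trn (q.1 i)}
        = ⋂ i, {q | q.1 i = trn (q.1 i)} := by ext q; simp
    rw [this]
    refine MeasurableSet.iInter fun i => measurableSet_eq_fun ?_ ?_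
    · exact (measurable_pi_apply i).comp measurable_fst
    · exact trn_meas.comp ((measurable_pi_apply i).comp measurable_fst)
  have h := ae_map_iff (μ := μ) (hX.prodMk hZ).aemeasurable hms
  refine h.1 ?_
  rw [hlaw, uni_eq, Measure.prod_smul_left, sum_prod_dirac]
  refine Measure.ae_smul_measure ?_ _
  rw [← Measure.sum_fintype, Measure.ae_sum_iff]
  intro k
  rw [ae_map_iff measurable_prodMk_left.aemeasurable hms]
  refine Filter.Eventually.of_forall fun z i => ?_
  exact (trn_sg _).symm

lemma X_int (hX : Measurable X) (hZ : Measurable Z)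
    (hlaw : Measure.map (fun ω => (X ω, Z ω)) μ
        = (uniformOnFinset (bpskRM r m)).prod (Measure.pi fun _ => PZ)) (i : Fin (2 ^ m)) :
    Integrable (fun ω => X ω i) μ := by
  have b : BM fun ω => trn (X ω i) :=
    ⟨trn_meas.comp ((measurable_pi_apply i).comp hX), 1, fun ω => trn_abs _⟩
  refine (b.integrable μ).congr ?_
  filter_upwards [ae_X hX hZ hlaw] with ω h using (h i).symm

lemma int_XY (hX : Measurable X) (hZ : Measurable Z)
    (hlaw : Measure.map (fun ω => (X ω, Z ω)) μ
        = (uniformOnFinset (bpskRM r m)).prod (Measure.pi fun _ => PZ)) (i : Fin (2 ^ m))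
    {s : (Fin (2 ^ m) → ℝ) → ℝ} (hs : BM s) :
    ∫ ω, X ω i * s (fun j => X ω j * Z ω j) ∂μ
      = (Fintype.card (Kap r m) : ℝ)⁻¹ * ∑ k : Kap r m,
        chi k i * ∫ z, s (fun j => chi k j * z j) ∂(Measure.pi fun _ => PZ) := by
  set F : (Fin (2 ^ m) → ℝ) × (Fin (2 ^ m) → ℝ) → ℝ :=
    fun q => trn (q.1 i) * s (fun j => q.1 j * q.2 j) with hF
  have b : BM F := by
    refine BM.mul ⟨trn_meas.comp ((measurable_pi_apply i).comp measurable_fst), 1,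
      fun q => trn_abs _⟩ (hs.comp ?_)
    exact measurable_pi_lambda _ fun j => ((measurable_pi_apply j).comp measurable_fst).mul
      ((measurable_pi_apply j).comp measurable_snd)
  have e : ∫ ω, X ω i * s (fun j => X ω j * Z ω j) ∂μ = ∫ ω, F (X ω, Z ω) ∂μ := by
    refine integral_congr_ae ?_
    filter_upwards [ae_X hX hZ hlaw] with ω h
    simp only [hF]
    rw [← h i]
  rw [e, ← integral_map (hX.prodMk hZ).aemeasurable b.meas.aestronglyMeasurable, hlaw, int_law b]
  congr 1
  refine Finset.sum_congr rfl fun k _ => ?_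
  rw [← integral_const_mul]
  congr 1; ext z
  simp only [hF]
  congr 1
  exact trn_sg _

variable {a : ℝ → ℝ}

lemma upper (hX : Measurable X) (hZ : Measurable Z)
    (hlaw : Measure.map (fun ω => (X ω, Z ω)) μ
        = (uniformOnFinset (bpskRM r m)).prod (Measure.pi fun _ => PZ))
    (ma : Measurable a) (ba : ∀ y, |a y| ≤ 1) (oa : ∀ y, a (-y) = - a y)
    (hcm : condMean (lamm PZ) (fun q : ℝ × ℝ => q.1) (fun q : ℝ × ℝ => q.1 * q.2)
      =ᵐ[lamm PZ] fun p => a (yy p)) (i : Fin (2 ^ m)) :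
    ∫ ω, |condMean μ (fun ω => X ω i) (fun ω => fun j => X ω j * Z ω j) ω| ∂μ
      ≤ ∫ p, |a (yy p)| ∂(lamm PZ) + (1 - ∫ p, |a (yy p)| ∂(lamm PZ))
        * Real.sqrt (qq (chi (r := r)) (fun _ p => a (yy p)) (lamm PZ) i (Finset.univ.erase i)) := by
  have hV : Measurable (fun ω => fun j => X ω j * Z ω j) :=
    measurable_pi_lambda _ fun j => ((measurable_pi_apply j).comp hX).mul
      ((measurable_pi_apply j).comp hZ)
  obtain ⟨s, ms, bs, es⟩ := cond_sgn μ (X_int hX hZ hlaw i) hV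
  have h0 := c0_odd ma ba oa
  have hc : ∀ j : Fin (2 ^ m), OddFn sig ((fun _ p => a (yy p)) j) := fun _ => h0
  refine le_trans ?_ (l1_bound (chi_chars (r := r)) h0 (lamm PZ) (sig_mp PZ) i)
  rw [es, int_XY hX hZ hlaw i ⟨ms, 1, bs⟩]
  simp_rw [word_int (chi_chars (r := r)) ma ba oa hcm _ ms]
  have my : Measurable fun p : Fin (2 ^ m) → ℝ × ℝ => fun j => yy (p j) :=
    measurable_pi_lambda _ fun j => yy_meas.comp (measurable_pi_apply j)
  have bsy : BM fun p : Fin (2 ^ m) → ℝ × ℝ => s (fun j => yy (p j)) :=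
    ⟨ms.comp my, 1, fun p => bs _⟩
  have bW := fun k => W_bm (chi_chars (r := r)) hc Finset.univ k
  have bL := LL_bm (chi_chars (r := r)) hc (fun k => chi k i) Finset.univ
  have e : (Fintype.card (Kap r m) : ℝ)⁻¹ * ∑ k : Kap r m,
        chi k i * ∫ p, s (fun j => yy (p j)) * W chi (fun _ p => a (yy p)) Finset.univ k p
          ∂(Measure.pi fun _ => lamm PZ)
      = ∫ p, s (fun j => yy (p j)) * LL (chi (r := r)) (fun _ p => a (yy p)) (fun k => chi k i) Finset.univ p
          ∂(Measure.pi fun _ => lamm PZ) := by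
    simp_rw [← integral_const_mul]
    rw [← integral_finsetSum, ← integral_const_mul]
    · congr 1; ext p
      unfold LL
      rw [mul_left_comm, Finset.mul_sum, Finset.mul_sum, Finset.mul_sum]
      refine Finset.sum_congr rfl fun k _ => ?_
      ring
    · intro k _
      exact ((bsy.mul (bW k)).integrable _).const_mul _
  rw [e]
  refine integral_mono ((bsy.mul bL).integrable _) (bL.abs.integrable _) fun p => ?_
  refine (le_abs_self _).trans ?_
  rw [abs_mul]
  exact mul_le_of_le_one_left (abs_nonneg _) (bs _)

lemma lower (hX : Measurable X) (hZ : Measurable Z)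
    (hlaw : Measure.map (fun ω => (X ω, Z ω)) μ
        = (uniformOnFinset (bpskRM r m)).prod (Measure.pi fun _ => PZ))
    (ma : Measurable a) (ba : ∀ y, |a y| ≤ 1) (oa : ∀ y, a (-y) = - a y)
    (hcm : condMean (lamm PZ) (fun q : ℝ × ℝ => q.1) (fun q : ℝ × ℝ => q.1 * q.2)
      =ᵐ[lamm PZ] fun p => a (yy p)) (i : Fin (2 ^ m)) :
    ∫ p, |a (yy p)| ∂(lamm PZ)
      ≤ ∫ ω, |condMean μ (fun ω => X ω i) (fun ω => X ω i * Z ω i) ω| ∂μ := by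
  have hV : Measurable (fun ω => X ω i * Z ω i) :=
    ((measurable_pi_apply i).comp hX).mul ((measurable_pi_apply i).comp hZ)
  set s : ℝ → ℝ := fun y => if 0 < a y then 1 else if a y < 0 then -1 else 0 with hs
  have ms : Measurable s := Measurable.ite (measurableSet_lt measurable_const ma) measurable_const
    (Measurable.ite (measurableSet_lt ma measurable_const) measurable_const measurable_const)
  have bs : ∀ y, |s y| ≤ 1 := by intro y; simp only [hs]; split_ifs <;> simp
  have os : ∀ y, s (-y) = - s y := by
    intro y; simp only [hs, oa]
    split_ifs <;> first | (exfalso; linarith) | norm_num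
  have sa : ∀ y, s y * a y = |a y| := by
    intro y; simp only [hs]
    split_ifs with h1 h2
    · rw [abs_of_pos h1, one_mul]
    · rw [abs_of_neg h2]; ring
    · rw [le_antisymm (not_lt.1 h1) (not_lt.1 h2)]; simp
  have bS : BM s := ⟨ms, 1, bs⟩
  refine le_trans (le_of_eq ?_) (cond_le μ (X_int hX hZ hlaw i) hV ms bs)
  have h1 := int_XY hX hZ hlaw i (s := fun y => s (y i)) (bS.comp (measurable_pi_apply i))
  rw [h1]
  have h2 : ∀ k : Kap r m, chi k i * ∫ z : Fin (2 ^ m) → ℝ, s (chi k i * z i)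
      ∂(Measure.pi fun _ => PZ) = ∫ z, s z ∂PZ := by
    intro k
    have e : ∫ z : Fin (2 ^ m) → ℝ, s (z i) ∂(Measure.pi fun _ => PZ) = ∫ z, s z ∂PZ := by
      have mp := measurePreserving_eval (fun _ : Fin (2 ^ m) => PZ) i
      have := integral_map (μ := Measure.pi fun _ : Fin (2 ^ m) => PZ) mp.measurable.aemeasurable
        (f := s) ms.aestronglyMeasurable
      rw [mp.map_eq] at this
      exact this.symm
    rw [← e]
    rcases (chi_chars (r := r)).cases k i with h | h <;> rw [h]
    · simp
    · simp [os, integral_neg]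
  simp_rw [h2]
  have h3 := KI ma ba hcm (Or.inl rfl) bS
  simp only [one_mul] at h3
  have od : OddFn sig (fun p => s (yy p)) := c0_odd ms bs os
  have bsy : BM fun p => s (yy p) := od.bm
  have h4 : ∫ p, s (yy p) ∂(lamm PZ) = 0 :=
    integral_odd (ι := Unit) (cc := fun _ p => s (yy p)) (fun _ => od) (lamm PZ) (sig_mp PZ) ()
  have h5 : ∫ z, s z ∂PZ = ∫ p, |a (yy p)| ∂(lamm PZ) := by
    rw [← h3]
    have : (fun p => s (yy p) * (1 + a (yy p))) = fun p => s (yy p) + |a (yy p)| := by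
      funext p; rw [← sa]; ring
    rw [this, integral_add (bsy.integrable _) ((c0_odd ma ba oa).bm.abs.integrable _), h4, zero_add]
  rw [h5, Finset.sum_const, Finset.card_univ, nsmul_eq_mul, ← mul_assoc, inv_mul_cancel₀, one_mul]
  exact_mod_cast Fintype.card_ne_zero

lemma one_sub_A (ma : Measurable a) (ba : ∀ y, |a y| ≤ 1) (oa : ∀ y, a (-y) = - a y)
    (hcm : condMean (lamm PZ) (fun q : ℝ × ℝ => q.1) (fun q : ℝ × ℝ => q.1 * q.2)
      =ᵐ[lamm PZ] fun p => a (yy p)) :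
    1 - ∫ p, |a (yy p)| ∂(lamm PZ) ≤ 1 - capacity PZ := by
  have h := H0_cap ma ba hcm
  have b := (c0_odd ma ba oa).bm
  have h2 : (1 - ∫ p, |a (yy p)| ∂(lamm PZ)) * Real.log 2 ≤ H0 (lamm PZ) (fun p => a (yy p)) := by
    unfold H0
    have : (1 - ∫ p, |a (yy p)| ∂(lamm PZ)) * Real.log 2
        = ∫ p, (Real.log 2 - |a (yy p)| * Real.log 2) ∂(lamm PZ) := by
      rw [integral_sub (integrable_const _) ((b.abs.integrable _).mul_const _), integral_mul_const]
      simp; ring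
    rw [this]
    refine integral_mono ((integrable_const _).sub ((b.abs.integrable _).mul_const _))
      ((integrable_const _).sub ((b.cont EE_cont).integrable _)) fun p => ?_
    have := EE_le_abs (ba (yy p))
    simp only; linarith
  rw [h] at h2
  exact le_of_mul_le_mul_right h2 log2_pos

lemma rate_le (hrm : r ≤ m) : RMrate r m ≤ 1 := by
  unfold RMrate
  have h : (∑ i ∈ Finset.range (r + 1), (m.choose i : ℝ)) ≤ 2 ^ m := by
    have := Nat.sum_range_choose m
    have h2 : (∑ i ∈ Finset.range (m + 1), (m.choose i : ℝ)) = 2 ^ m := by exact_mod_cast this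
    rw [← h2]
    exact Finset.sum_le_sum_of_subset_of_nonneg (Finset.range_mono (by omega)) fun _ _ _ => by positivity
  rw [inv_mul_le_one₀ (by positivity)]
  exact h

lemma final_num {q B rh l p1 p2 P2 s : ℝ} (hs : 0 < s) (hl : 0 < l) (hp1 : 0 < p1) (hP : 0 < P2)
    (hPp : P2 ≤ p2) (hq0 : 0 ≤ q) (hB : B ≤ 1 / (2 * s)) (hr : 1 / s ≤ rh)
    (hq : q * p1 * p2 ≤ 4 * l * B) :
    Real.sqrt q / 2 ≤ Real.sqrt (l * rh / (2 * p1 * P2)) := by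
  have e : Real.sqrt q / 2 = Real.sqrt (q / 4) := by
    rw [Real.sqrt_div hq0, show (4 : ℝ) = 2 ^ 2 by norm_num, Real.sqrt_sq (by norm_num)]
  rw [e]
  apply Real.sqrt_le_sqrt
  rw [div_le_div_iff₀ (by norm_num) (by positivity)]
  have h1 : q * p1 * P2 ≤ q * p1 * p2 := by gcongr
  have h2 : 1 / (2 * s) = (1 / s) / 2 := by field_simp
  have h3 : l * B ≤ l * (rh / 2) := by
    apply mul_le_mul_of_nonneg_left _ hl.le; linarith
  nlinarith

end

theorem main {Ω : Type*} [MeasurableSpace Ω] (μ : Measure Ω) [IsProbabilityMeasure μ]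
    (PZ : Measure ℝ) [IsProbabilityMeasure PZ]
    (hC0 : 0 < capacity PZ) (hC1 : capacity PZ < 1)
    (r m : ℕ) (hrm : r ≤ m) (hm : 1 ≤ m)
    (X Z : Ω → (Fin (2 ^ m) → ℝ)) (hX : Measurable X) (hZ : Measurable Z)
    (hlaw : Measure.map (fun ω => (X ω, Z ω)) μ
        = (uniformOnFinset (bpskRM r m)).prod (Measure.pi fun _ => PZ))
    (hrate : capacity PZ < RMrate r m) (i : Fin (2 ^ m)) :
      BER μ (fun ω => X ω i) (fun ω => fun j => X ω j * Z ω j)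
        ≥ BER μ (fun ω => X ω i) (fun ω => X ω i * Z ω i)
          - (1 - capacity PZ) *
              Real.sqrt (Real.log 2 * rho m /
                (2 * psi (1 - capacity PZ) * PsiInt (RMrate r m - capacity PZ))) := by
  obtain ⟨a, ma, ba, oa, hcm⟩ := exists_a PZ
  have h0 := c0_odd ma ba oa
  have hu := upper hX hZ hlaw ma ba oa hcm i
  have hl := lower hX hZ hlaw ma ba oa hcm i
  have hA := one_sub_A ma ba oa hcm
  have hR1 := rate_le hrm
  have core := rm_core hm h0 c1_odd (fun p => s1_sq p.1) (lamm PZ) (sig_mp PZ) hC0 hC1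
    (H0_cap ma ba hcm) hrate (by linarith) i
  have hms : 0 < Real.sqrt m := Real.sqrt_pos.2 (by exact_mod_cast hm)
  have hrho : 1 / Real.sqrt m ≤ rho m := by
    unfold rho
    have hlg : 0 ≤ Real.log m := Real.log_nonneg (by exact_mod_cast hm)
    rw [div_le_div_iff₀ hms (by positivity)]
    nlinarith
  have fin := final_num hms log2_pos (psi_pos (by linarith) (by linarith))
    (PsiInt_pos (by linarith) (by linarith)) (PsiInt_le (by linarith) (by linarith))
    (qq_nonneg (chi_chars (r := r)) (fun _ => h0) (lamm PZ) i _)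
    (choose_bound hm r) hrho core
  set S := Real.sqrt (qq (chi (r := r)) (fun _ p => a (yy p)) (lamm PZ) i (Finset.univ.erase i)) with hS
  have hS0 : 0 ≤ S := Real.sqrt_nonneg _
  have k1 : (1 - ∫ p, |a (yy p)| ∂(lamm PZ)) * S ≤ (1 - capacity PZ) * S :=
    mul_le_mul_of_nonneg_right hA hS0
  have k2 := mul_le_mul_of_nonneg_left fin (show 0 ≤ 1 - capacity PZ by linarith)
  unfold BER
  linarith

end
end RMP

/-- For an RM(r,m) code over a BMS channel with capacity `C ∈ (0,1)`, if
`R(r,m) > C` then for every coordinate `i`,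
`BER(X_i | Y) ≥ BER(X_i | Y_i) − (1−C)·√(ln 2 · ρ(m) / (2 ψ(1−C) Ψ(R(r,m)−C)))`. -/
theorem stmt_1
    {Ω : Type*} [MeasurableSpace Ω] (μ : Measure Ω) [IsProbabilityMeasure μ]
    (PZ : Measure ℝ) [IsProbabilityMeasure PZ]
    (hC0 : 0 < capacity PZ) (hC1 : capacity PZ < 1)
    (r m : ℕ) (hrm : r ≤ m) (hm : 1 ≤ m)
    (X Z : Ω → (Fin (2 ^ m) → ℝ)) (hX : Measurable X) (hZ : Measurable Z)
    (hlaw : Measure.map (fun ω => (X ω, Z ω)) μ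
        = (uniformOnFinset (bpskRM r m)).prod (Measure.pi fun _ => PZ))
    (hrate : capacity PZ < RMrate r m) :
    ∀ i : Fin (2 ^ m),
      BER μ (fun ω => X ω i) (fun ω => fun j => X ω j * Z ω j)
        ≥ BER μ (fun ω => X ω i) (fun ω => X ω i * Z ω i)
          - (1 - capacity PZ) *
              Real.sqrt (Real.log 2 * rho m /
                (2 * psi (1 - capacity PZ) * PsiInt (RMrate r m - capacity PZ))) := by
  exact RMP.main μ PZ hC0 hC1 r m hrm hm X Z hX hZ hlaw hrate
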